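/- Let γ > 0 and let f : ℝ^N → [0,∞) be a Borel function with f ∈ 𝓛_α that is continuous at every point of ∂B. Then there exists exactly one nonnegative function u ∈ 𝓛_α such that u = f on B^c, the restriction of u to the closed unit ball is continuous, and u is a solution of Δ^{α/2}u = u^γ in B. Moreover this u satisfies u(x) + ∫_B G_B^α(x,y) u(y)^γ dy = H_{B(0,1)}^α f(x) for every x ∈ B. -/

import Mathlib

open MeasureTheory Real Filter Topology Metric Set

noncomputable section

abbrev EN (N : ℕ) := EuclideanSpace ℝ (Fin N)

/-- The normalizing constant `c_{N,α}` of the fractional Laplacian. -/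
def fracLapCoeff (N : ℕ) (α : ℝ) : ℝ :=
  2 ^ α * Real.pi ^ (-(N : ℝ) / 2) * Real.Gamma (((N : ℝ) + α) / 2) / |Real.Gamma (-α / 2)|

/-- `HasFracLap N α u x L` means the principal-value limit defining `Δ^{α/2} u (x)` exists
and equals `L`. -/
def HasFracLap (N : ℕ) (α : ℝ) (u : EN N → ℝ) (x : EN N) (L : ℝ) : Prop :=
  Tendsto (fun ε : ℝ =>
      fracLapCoeff N α * ∫ y in {y : EN N | ε < dist y x}, (u y - u x) / dist y x ^ ((N : ℝ) + α))
    (𝓝[>] (0 : ℝ)) (𝓝 L)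

/-- The value of the fractional Laplacian at `x` (junk value `0` where the limit fails). -/
def fracLap (N : ℕ) (α : ℝ) (u : EN N → ℝ) (x : EN N) : ℝ :=
  haveI := Classical.propDecidable (∃ L, HasFracLap N α u x L)
  if h : ∃ L, HasFracLap N α u x L then h.choose else 0

/-- The weighted space `𝓛_α`. -/
def memLalpha (N : ℕ) (α : ℝ) (u : EN N → ℝ) : Prop :=
  Integrable (fun y : EN N => u y * (1 + ‖y‖) ^ (-((N : ℝ) + α)))

/-- `δ(x) = 1 - |x|` on the unit ball, `0` outside. -/
def delta1 {N : ℕ} (x : EN N) : ℝ := if ‖x‖ < 1 then 1 - ‖x‖ else 0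

/-- The constant `κ_{N,α}`. -/
def greenCoeff (N : ℕ) (α : ℝ) : ℝ :=
  Real.Gamma ((N : ℝ) / 2) / (2 ^ α * Real.pi ^ ((N : ℝ) / 2) * Real.Gamma (α / 2) ^ 2)

/-- The Green function of the unit ball. -/
def greenB (N : ℕ) (α : ℝ) (x y : EN N) : ℝ :=
  if ‖x‖ < 1 ∧ ‖y‖ < 1 then
    greenCoeff N α * ‖x - y‖ ^ (α - (N : ℝ)) *
      ∫ s in (0:ℝ)..((1 - ‖x‖ ^ 2) * (1 - ‖y‖ ^ 2) / ‖x - y‖ ^ 2),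
        s ^ (α / 2 - 1) * (1 + s) ^ (-(N : ℝ) / 2)
  else 0

/-- The Green function of the ball `B(a,r)`, by scaling. -/
def greenBall (N : ℕ) (α : ℝ) (a : EN N) (r : ℝ) (x y : EN N) : ℝ :=
  r ^ (α - (N : ℝ)) * greenB N α (r⁻¹ • (x - a)) (r⁻¹ • (y - a))

/-- The constant `c_α^N` of the Poisson kernel. -/
def poissonCoeff (N : ℕ) (α : ℝ) : ℝ :=
  Real.pi ^ (-1 - (N : ℝ) / 2) * Real.Gamma ((N : ℝ) / 2) * Real.sin (Real.pi * α / 2)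

/-- The Poisson kernel of the ball `B(a,r)`. -/
def poissonBall (N : ℕ) (α : ℝ) (a : EN N) (r : ℝ) (x y : EN N) : ℝ :=
  poissonCoeff N α * ((r ^ 2 - ‖x - a‖ ^ 2) / (‖y - a‖ ^ 2 - r ^ 2)) ^ (α / 2) *
    ‖x - y‖ ^ (-(N : ℝ))

/-- The harmonic-measure operator `H^α_{B(a,r)} f`. -/
def Hball (N : ℕ) (α : ℝ) (a : EN N) (r : ℝ) (f : EN N → ℝ) (x : EN N) : ℝ :=
  ∫ y in {y : EN N | r < ‖y - a‖}, poissonBall N α a r x y * f y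

/-- Solution (in the distributional sense) of `Δ^{α/2} u = u^γ` in the open set `U`. -/
def IsSolution (N : ℕ) (α γ : ℝ) (U : Set (EN N)) (u : EN N → ℝ) : Prop :=
  (∀ x, 0 ≤ u x) ∧ ContinuousOn u U ∧ memLalpha N α u ∧
    ∀ φ : EN N → ℝ, ContDiff ℝ (⊤ : ℕ∞) φ → HasCompactSupport φ → tsupport φ ⊆ U →
      (∀ x, 0 ≤ φ x) →
        ∫ x, u x * fracLap N α φ x = ∫ x, u x ^ γ * φ x

/-- The surface measure `σ` on the unit sphere. -/
def sphereMeasure (N : ℕ) : Measure (Metric.sphere (0 : EN N) 1) :=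
  (volume : Measure (EN N)).toSphere

/-- The Martin integral `M_B^α g`. -/
def martinB (N : ℕ) (α : ℝ) (g : Metric.sphere (0 : EN N) 1 → ℝ) (x : EN N) : ℝ :=
  if ‖x‖ < 1 then
    ∫ y, (1 - ‖x‖ ^ 2) ^ (α / 2) * ‖x - (y : EN N)‖ ^ (-(N : ℝ)) * g y ∂(sphereMeasure N)
  else 0

/-- Solution of the moderate blow-up problem `(P_g)`. -/
def IsSolutionPg (N : ℕ) (α γ : ℝ) (g : Metric.sphere (0 : EN N) 1 → ℝ) (u : EN N → ℝ) : Prop :=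
  (∀ x, 0 ≤ u x) ∧ memLalpha N α u ∧ (∀ x : EN N, ¬ ‖x‖ < 1 → u x = 0) ∧
    IsSolution N α γ (Metric.ball (0 : EN N) 1) u ∧
    ∀ z : Metric.sphere (0 : EN N) 1,
      Tendsto (fun x => delta1 x ^ (1 - α / 2) * u x)
        (𝓝[Metric.ball (0 : EN N) 1] (z : EN N)) (𝓝 (g z))

/-- Solution of the blow-up problem `(P_∞)`. -/
def IsSolutionPinf (N : ℕ) (α γ : ℝ) (u : EN N → ℝ) : Prop :=
  (∀ x, 0 ≤ u x) ∧ memLalpha N α u ∧ (∀ x : EN N, ¬ ‖x‖ < 1 → u x = 0) ∧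
    IsSolution N α γ (Metric.ball (0 : EN N) 1) u ∧
    ∀ z : Metric.sphere (0 : EN N) 1,
      Tendsto (fun x => delta1 x ^ (1 - α / 2) * u x)
        (𝓝[Metric.ball (0 : EN N) 1] (z : EN N)) atTop



/-! ### Part 1: the classical Poisson kernel on the unit sphere -/

def pvL {N : ℕ} (y x : EN N) : ℝ := 1 - 2 * inner ℝ x y + ‖x‖ ^ 2 * ‖y‖ ^ 2

def pv {N : ℕ} (y x : EN N) : ℝ := (1 - ‖x‖ ^ 2 * ‖y‖ ^ 2) * (pvL y x) ^ (-(N : ℝ) / 2)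

def pvd1 {N : ℕ} (e y x : EN N) : ℝ :=
  (-2 * ‖y‖ ^ 2 * inner ℝ x e) * (pvL y x) ^ (-(N : ℝ) / 2) +
  (1 - ‖x‖ ^ 2 * ‖y‖ ^ 2) * ((2 * (‖y‖ ^ 2 * inner ℝ x e - inner ℝ e y)) * (-(N : ℝ) / 2) *
    (pvL y x) ^ (-(N : ℝ) / 2 - 1))

def pvd2 {N : ℕ} (e y x : EN N) : ℝ :=
  (-2 * ‖y‖ ^ 2) * (pvL y x) ^ (-(N : ℝ) / 2) +
  2 * ((-2 * ‖y‖ ^ 2 * inner ℝ x e) * ((2 * (‖y‖ ^ 2 * inner ℝ x e - inner ℝ e y)) * (-(N : ℝ) / 2) *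
    (pvL y x) ^ (-(N : ℝ) / 2 - 1))) +
  (1 - ‖x‖ ^ 2 * ‖y‖ ^ 2) * (2 * ‖y‖ ^ 2 * (-(N : ℝ) / 2) * (pvL y x) ^ (-(N : ℝ) / 2 - 1)
    + (2 * (‖y‖ ^ 2 * inner ℝ x e - inner ℝ e y)) ^ 2 * (-(N : ℝ) / 2) * (-(N : ℝ) / 2 - 1) *
    (pvL y x) ^ (-(N : ℝ) / 2 - 2))

lemma pvL_pos {N : ℕ} {y x : EN N} (h : ‖x‖ * ‖y‖ < 1) : 0 < pvL y x := by
  have h1 := real_inner_le_norm x y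
  have : 0 < (1 - ‖x‖ * ‖y‖) ^ 2 := by
    have : 0 < 1 - ‖x‖ * ‖y‖ := by linarith
    positivity
  unfold pvL
  nlinarith

lemma hasDerivAt_normsq_line {N : ℕ} (x e : EN N) (t : ℝ) :
    HasDerivAt (fun t : ℝ => ‖x + t • e‖ ^ 2) (2 * inner ℝ (x + t • e) e) t := by
  have h : HasDerivAt (fun t : ℝ => x + t • e) e t := by
    simpa using ((hasDerivAt_id t).smul_const e).const_add x
  exact h.norm_sq

lemma hasDerivAt_inner_line {N : ℕ} (x e y : EN N) (t : ℝ) :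
    HasDerivAt (fun t : ℝ => inner ℝ (x + t • e) y) (inner ℝ e y) t := by
  have h : HasDerivAt (fun t : ℝ => x + t • e) e t := by
    simpa using ((hasDerivAt_id t).smul_const e).const_add x
  simpa using h.inner ℝ (hasDerivAt_const t y)

lemma hasDerivAt_pvL {N : ℕ} (e y x : EN N) (t : ℝ) :
    HasDerivAt (fun t : ℝ => pvL y (x + t • e))
      (2 * (‖y‖ ^ 2 * inner ℝ (x + t • e) e - inner ℝ e y)) t := by
  have h1 := hasDerivAt_normsq_line x e t
  have h2 := hasDerivAt_inner_line x e y t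
  have := ((h2.const_mul 2).const_sub 1).add (h1.mul_const (‖y‖ ^ 2))
  refine this.congr_deriv ?_
  ring

lemma hasDerivAt_pvL_rpow {N : ℕ} (e y x : EN N) (t p : ℝ) (h : 0 < pvL y (x + t • e)) :
    HasDerivAt (fun t : ℝ => pvL y (x + t • e) ^ p)
      ((2 * (‖y‖ ^ 2 * inner ℝ (x + t • e) e - inner ℝ e y)) * p *
        pvL y (x + t • e) ^ (p - 1)) t :=
  (hasDerivAt_pvL e y x t).rpow_const (Or.inl h.ne')

lemma hasDerivAt_pv {N : ℕ} (e y x : EN N) (t : ℝ) (h : 0 < pvL y (x + t • e)) :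
    HasDerivAt (fun t : ℝ => pv y (x + t • e)) (pvd1 e y (x + t • e)) t := by
  have h1 := (hasDerivAt_normsq_line x e t)
  have h2 := ((h1.mul_const (‖y‖ ^ 2)).const_sub 1).mul
    (hasDerivAt_pvL_rpow e y x t (-(N : ℝ) / 2) h)
  refine h2.congr_deriv ?_
  simp only [pvd1]
  ring

lemma hasDerivAt_pvd1 {N : ℕ} (e y x : EN N) (he : ‖e‖ = 1) (t : ℝ) (h : 0 < pvL y (x + t • e)) :
    HasDerivAt (fun t : ℝ => pvd1 e y (x + t • e)) (pvd2 e y (x + t • e)) t := by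
  have h1 := (hasDerivAt_normsq_line x e t)
  have h3 := hasDerivAt_inner_line x e e t
  have hee : inner ℝ e e = (1 : ℝ) := by rw [real_inner_self_eq_norm_sq, he]; norm_num
  rw [hee] at h3
  have hA := (h3.const_mul (-2 * ‖y‖ ^ 2)).mul (hasDerivAt_pvL_rpow e y x t (-(N : ℝ) / 2) h)
  have hB := ((h1.mul_const (‖y‖ ^ 2)).const_sub 1).mul
    (((((h3.const_mul (‖y‖ ^ 2)).sub_const (inner ℝ e y)).const_mul 2).mul_const
      (-(N : ℝ) / 2)).mul (hasDerivAt_pvL_rpow e y x t (-(N : ℝ) / 2 - 1) h))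
  refine (hA.add hB).congr_deriv ?_
  simp only [pvd2, Pi.mul_apply]
  rw [show -(N : ℝ) / 2 - 1 - 1 = -(N : ℝ) / 2 - 2 by ring]
  ring

def ebas {N : ℕ} (i : Fin N) : EN N := EuclideanSpace.single i 1

lemma norm_ebas {N : ℕ} (i : Fin N) : ‖(ebas i : EN N)‖ = 1 := by simp [ebas]

lemma sum_pvd2 {N : ℕ} (y x : EN N) (h : 0 < pvL y x) :
    ∑ i, pvd2 (ebas i) y x = 0 := by
  have hx : ∀ i, inner ℝ x (ebas i : EN N) = x i := by
    intro i; simp [ebas, EuclideanSpace.inner_single_right]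
  have hy : ∀ i, inner ℝ (ebas i : EN N) y = y i := by
    intro i; simp [ebas, EuclideanSpace.inner_single_left]
  have hxx : ∑ i, x i ^ 2 = ‖x‖ ^ 2 := (EuclideanSpace.real_norm_sq_eq x).symm
  have hyy : ∑ i, y i ^ 2 = ‖y‖ ^ 2 := (EuclideanSpace.real_norm_sq_eq y).symm
  have hxy : ∑ i, x i * y i = inner ℝ x y := by
    simp [PiLp.inner_apply, mul_comm]
  set L := pvL y x with hL
  set P := L ^ (-(N : ℝ) / 2 - 2) with hP
  have e1 : L ^ (-(N : ℝ) / 2 - 1) = L * P := by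
    rw [hP, ← rpow_one_add' h.le]
    · congr 1; ring
    · have : (0:ℝ) ≤ N := Nat.cast_nonneg N
      intro h'; linarith
  have e0 : L ^ (-(N : ℝ) / 2) = L ^ 2 * P := by
    rw [hP, ← rpow_natCast, ← rpow_add h]
    congr 1; push_cast; ring
  set Y := ‖y‖ ^ 2 with hY
  set X := ‖x‖ ^ 2 with hX
  have hterm : ∀ i, pvd2 (ebas i) y x =
      (-2 * Y * L ^ 2 * P - (1 - X * Y) * Y * N * L * P) +
      (4 * Y * Y * N * L * P + (1 - X * Y) * (N) * (N + 2) * P * Y * Y) * x i ^ 2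
      + (-4 * Y * N * L * P - 2 * (1 - X * Y) * (N) * (N + 2) * P * Y) * (x i * y i)
      + ((1 - X * Y) * (N) * (N + 2) * P) * y i ^ 2 := by
    intro i
    simp only [pvd2, hx, hy, ← hL, ← hP, e1, e0, ← hY, ← hX]
    ring
  simp only [hterm, Finset.sum_add_distrib, ← Finset.mul_sum, hxx, hyy, hxy]
  simp only [Finset.sum_const, Finset.card_univ, Fintype.card_fin, nsmul_eq_mul]
  have : L = 1 - 2 * inner ℝ x y + X * Y := rfl
  set I : ℝ := inner ℝ x y
  rw [this]
  ring

/-- Weak pointwise harmonicity: coordinate second derivatives exist and sum to zero. -/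
def IsHarm {N : ℕ} (w : EN N → ℝ) (x : EN N) : Prop :=
  ∃ (d : Fin N → ℝ → ℝ) (s : Fin N → ℝ),
    (∀ i, (∀ᶠ t in 𝓝 (0:ℝ), HasDerivAt (fun t : ℝ => w (x + t • ebas i)) (d i t) t) ∧
      HasDerivAt (d i) (s i) 0) ∧ ∑ i, s i = 0

lemma IsHarm.sub {N : ℕ} {w v : EN N → ℝ} {x : EN N} (hw : IsHarm w x) (hv : IsHarm v x) :
    IsHarm (fun z => w z - v z) x := by
  obtain ⟨d, s, h, hs⟩ := hw
  obtain ⟨d', s', h', hs'⟩ := hv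
  refine ⟨fun i t => d i t - d' i t, fun i => s i - s' i, fun i => ⟨?_, (h i).2.sub (h' i).2⟩, ?_⟩
  · filter_upwards [(h i).1, (h' i).1] with t h1 h2 using h1.sub h2
  · rw [Finset.sum_sub_distrib, hs, hs', sub_zero]

lemma IsHarm.const_mul {N : ℕ} {w : EN N → ℝ} {x : EN N} (hw : IsHarm w x) (c : ℝ) :
    IsHarm (fun z => c * w z) x := by
  obtain ⟨d, s, h, hs⟩ := hw
  refine ⟨fun i t => c * d i t, fun i => c * s i, fun i => ⟨?_, (h i).2.const_mul c⟩, ?_⟩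
  · filter_upwards [(h i).1] with t h1 using h1.const_mul c
  · rw [← Finset.mul_sum, hs, mul_zero]

lemma second_deriv_nonpos {f d : ℝ → ℝ} {s : ℝ} (hmax : IsLocalMax f 0)
    (hd : ∀ᶠ t in 𝓝 (0:ℝ), HasDerivAt f (d t) t) (hs : HasDerivAt d s 0) : s ≤ 0 := by
  by_contra hpos
  push Not at hpos
  have hde : deriv f =ᶠ[𝓝 0] d := by
    filter_upwards [hd] with t ht using ht.deriv
  have h2 : deriv (deriv f) 0 = s := by
    rw [hde.deriv_eq]; exact hs.deriv
  have hmin : IsLocalMin f 0 := isLocalMin_of_deriv_deriv_pos (by rw [h2]; exact hpos)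
    hmax.deriv_eq_zero (hd.self_of_nhds).continuousAt
  have hconst : f =ᶠ[𝓝 0] fun _ => f 0 := by
    filter_upwards [hmin, hmax] with t h1 h2 using le_antisymm h2 h1
  have : deriv f =ᶠ[𝓝 0] fun _ => 0 := by
    have := hconst.deriv
    simpa using this
  have h3 : deriv (deriv f) 0 = 0 := by rw [this.deriv_eq]; simp
  linarith

/-- Classical maximum principle. -/
lemma harm_max {N : ℕ} (hN : 0 < N) {w : EN N → ℝ} {r M : ℝ}
    (hc : ContinuousOn w (closedBall 0 r)) (hh : ∀ x ∈ ball (0 : EN N) r, IsHarm w x)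
    (hb : ∀ x : EN N, ‖x‖ = r → w x ≤ M) : ∀ x ∈ ball (0 : EN N) r, w x ≤ M := by
  intro x hx
  by_contra hlt
  push Not at hlt
  have hr : 0 < r := by
    rw [mem_ball_zero_iff] at hx
    linarith [norm_nonneg x]
  set ε := (w x - M) / (2 * r ^ 2) with hε
  have hεpos : 0 < ε := by
    apply div_pos <;> [linarith; positivity]
  have hεr : ε * r ^ 2 = (w x - M) / 2 := by rw [hε]; field_simp
  have hcont : ContinuousOn (fun z => w z + ε * ‖z‖ ^ 2) (closedBall (0 : EN N) r) :=
    hc.add (by fun_prop)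
  obtain ⟨z, hz, hzmax⟩ := (isCompact_closedBall (0 : EN N) r).exists_isMaxOn
    ⟨x, ball_subset_closedBall hx⟩ hcont
  have hxz := hzmax (ball_subset_closedBall hx)
  simp only [mem_setOf_eq] at hxz
  rw [mem_closedBall_zero_iff] at hz
  have hzlt : ‖z‖ < r := by
    rcases hz.lt_or_eq with h | h
    · exact h
    · exfalso
      have h1 := hb z h
      rw [h] at hxz
      have : 0 ≤ ε * ‖x‖ ^ 2 := by positivity
      linarith
  obtain ⟨d, s, hds, hsum⟩ := hh z (by simpa using hzlt)
  have key : ∀ i, s i + 2 * ε ≤ 0 := by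
    intro i
    have hsq : ∀ t : ℝ, HasDerivAt (fun t : ℝ => ε * ‖z + t • (ebas i : EN N)‖ ^ 2)
        (ε * (2 * inner ℝ (z + t • ebas i) (ebas i))) t := fun t =>
      (hasDerivAt_normsq_line z (ebas i) t).const_mul ε
    have hsq2 : HasDerivAt (fun t : ℝ => ε * (2 * inner ℝ (z + t • (ebas i : EN N)) (ebas i)))
        (ε * (2 * 1)) 0 := by
      have h3 := hasDerivAt_inner_line z (ebas i) (ebas i) 0
      rw [real_inner_self_eq_norm_sq, norm_ebas] at h3
      simpa using (h3.const_mul 2).const_mul ε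
    have := second_deriv_nonpos (f := fun t : ℝ => w (z + t • ebas i) + ε * ‖z + t • (ebas i : EN N)‖ ^ 2)
      (d := fun t => d i t + ε * (2 * inner ℝ (z + t • (ebas i : EN N)) (ebas i)))
      (s := s i + ε * (2 * 1)) ?_ ?_ ((hds i).2.add hsq2)
    · linarith
    · have hcts : Tendsto (fun t : ℝ => z + t • (ebas i : EN N)) (𝓝 0) (𝓝 z) := by
        have : Continuous (fun t : ℝ => z + t • (ebas i : EN N)) := by fun_prop
        simpa using this.tendsto 0
      have hev := hcts.eventually (isOpen_ball.mem_nhds (show z ∈ ball (0 : EN N) r by simpa using hzlt))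
      filter_upwards [hev] with t ht
      have := hzmax (ball_subset_closedBall ht)
      simpa using this
    · filter_upwards [(hds i).1] with t ht using ht.add (hsq t)
  have : ∑ i : Fin N, (s i + 2 * ε) ≤ 0 := Finset.sum_nonpos fun i _ => key i
  rw [Finset.sum_add_distrib, hsum] at this
  simp only [Finset.sum_const, Finset.card_univ, Fintype.card_fin, nsmul_eq_mul, zero_add] at this
  have : 0 < (N : ℝ) * (2 * ε) := by positivity
  linarith



lemma hasDerivAt_integral_compact {X : Type*} [TopologicalSpace X] [CompactSpace X]
    [MeasurableSpace X] [OpensMeasurableSpace X] [SecondCountableTopology X]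
    (μ : Measure X) [IsFiniteMeasure μ]
    (F F' : ℝ → X → ℝ) (η : ℝ)
    (hF : ∀ t ∈ Ioo (-η) η, Continuous (F t))
    (hd : ∀ t ∈ Ioo (-η) η, ∀ σ, HasDerivAt (fun t => F t σ) (F' t σ) t)
    (hF' : ContinuousOn (fun p : ℝ × X => F' p.1 p.2) (Icc (-η) η ×ˢ univ))
    (t0 : ℝ) (ht0 : t0 ∈ Ioo (-η) η) :
    HasDerivAt (fun t => ∫ σ, F t σ ∂μ) (∫ σ, F' t0 σ ∂μ) t0 := by
  obtain ⟨C, hC⟩ := (isCompact_Icc.prod (isCompact_univ (X := X))).exists_bound_of_continuousOn hF'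
  have hcF' : Continuous (F' t0) := by
    rw [← continuousOn_univ]
    exact hF'.comp (by fun_prop : ContinuousOn (fun σ : X => (t0, σ)) univ)
      (fun σ _ => ⟨Ioo_subset_Icc_self ht0, mem_univ _⟩)
  have hintg : ∀ g : X → ℝ, Continuous g → Integrable g μ := fun g hg =>
    hg.integrable_of_hasCompactSupport (HasCompactSupport.of_compactSpace g)
  exact (hasDerivAt_integral_of_dominated_loc_of_deriv_le (bound := fun _ => C)
    (isOpen_Ioo.mem_nhds ht0)
    (by filter_upwards [isOpen_Ioo.mem_nhds ht0] with t ht using (hF t ht).aestronglyMeasurable)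
    (hintg _ (hF t0 ht0)) hcF'.aestronglyMeasurable
    (Eventually.of_forall fun σ t ht => hC (t, σ) ⟨Ioo_subset_Icc_self ht, mem_univ _⟩)
    (integrable_const _) (Eventually.of_forall fun σ t ht => hd t ht σ)).2

abbrev Sph (N : ℕ) := Metric.sphere (0 : EN N) 1

lemma norm_sph {N : ℕ} (σ : Sph N) : ‖(σ : EN N)‖ = 1 := by
  have := σ.2; simpa using this

lemma line_norm_lt {N : ℕ} {x e : EN N} (he : ‖e‖ = 1) {t : ℝ}
    (ht : t ∈ Icc (-((1 - ‖x‖) / 2)) ((1 - ‖x‖) / 2)) (hx : ‖x‖ < 1) : ‖x + t • e‖ < 1 := by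
  have h1 := norm_add_le x (t • e)
  rw [norm_smul, he, mul_one, Real.norm_eq_abs] at h1
  have := abs_le.2 ht
  linarith

lemma continuousOn_pvL_rpow {N : ℕ} (p : ℝ) {s : Set (EN N × EN N)}
    (hs : ∀ q ∈ s, 0 < pvL q.1 q.2) :
    ContinuousOn (fun q : EN N × EN N => pvL q.1 q.2 ^ p) s := by
  apply ContinuousOn.rpow_const
  · unfold pvL; fun_prop
  · intro q hq; exact Or.inl (hs q hq).ne'

lemma continuousOn_pv {N : ℕ} {s : Set (EN N × EN N)}
    (hs : ∀ q ∈ s, 0 < pvL q.1 q.2) :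
    ContinuousOn (fun q : EN N × EN N => pv q.1 q.2) s := by
  unfold pv
  exact (by fun_prop : ContinuousOn (fun q : EN N × EN N => 1 - ‖q.2‖ ^ 2 * ‖q.1‖ ^ 2) s).mul
    (continuousOn_pvL_rpow _ hs)

lemma continuousOn_pvd1 {N : ℕ} (e : EN N) {s : Set (EN N × EN N)}
    (hs : ∀ q ∈ s, 0 < pvL q.1 q.2) :
    ContinuousOn (fun q : EN N × EN N => pvd1 e q.1 q.2) s := by
  unfold pvd1
  have h1 := continuousOn_pvL_rpow (-(N:ℝ)/2) hs
  have h2 := continuousOn_pvL_rpow (-(N:ℝ)/2-1) hs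
  fun_prop

lemma continuousOn_pvd2 {N : ℕ} (e : EN N) {s : Set (EN N × EN N)}
    (hs : ∀ q ∈ s, 0 < pvL q.1 q.2) :
    ContinuousOn (fun q : EN N × EN N => pvd2 e q.1 q.2) s := by
  unfold pvd2
  have h1 := continuousOn_pvL_rpow (-(N:ℝ)/2) hs
  have h2 := continuousOn_pvL_rpow (-(N:ℝ)/2-1) hs
  have h3 := continuousOn_pvL_rpow (-(N:ℝ)/2-2) hs
  fun_prop

lemma pvL_pos_sph {N : ℕ} (σ : Sph N) {x : EN N} (hx : ‖x‖ < 1) : 0 < pvL (σ : EN N) x :=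
  pvL_pos (by rw [norm_sph, mul_one]; exact hx)

lemma isHarm_pv {N : ℕ} {y x : EN N} (h : ‖x‖ * ‖y‖ < 1) : IsHarm (pv y) x := by
  refine ⟨fun i t => pvd1 (ebas i) y (x + t • ebas i), fun i => pvd2 (ebas i) y x, ?_, sum_pvd2 y x (pvL_pos h)⟩
  intro i
  constructor
  · have hc : Continuous (fun t : ℝ => pvL y (x + t • ebas i)) := by unfold pvL; fun_prop
    have : ∀ᶠ t in 𝓝 (0:ℝ), 0 < pvL y (x + t • ebas i) :=
      hc.continuousAt.eventually (lt_mem_nhds (by simpa using pvL_pos h))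
    filter_upwards [this] with t ht using hasDerivAt_pv _ _ _ _ ht
  · have := hasDerivAt_pvd1 (ebas i) y x (norm_ebas i) 0 (by simpa using pvL_pos h)
    simpa using this

lemma isHarm_sphere_integral {N : ℕ} (μ : Measure (Sph N)) [IsFiniteMeasure μ] (g : Sph N → ℝ)
    (hg : Continuous g) {x : EN N} (hx : ‖x‖ < 1) :
    IsHarm (fun x => ∫ σ, pv (σ : EN N) x * g σ ∂μ) x := by
  set η := (1 - ‖x‖) / 2 with hη
  have hη0 : 0 < η := by rw [hη]; linarith
  have hmap : ∀ i : Fin N, MapsTo (fun p : ℝ × Sph N => ((p.2 : EN N), x + p.1 • (ebas i : EN N))) (Icc (-η) η ×ˢ univ)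
      {q : EN N × EN N | 0 < pvL q.1 q.2} := by
    rintro i ⟨t, σ⟩ ⟨ht, -⟩
    exact pvL_pos_sph σ (line_norm_lt (norm_ebas i) ht hx)
  have hmap' : ∀ i : Fin N, ∀ t ∈ Ioo (-η) η, MapsTo (fun σ : Sph N => ((σ : EN N), x + t • (ebas i : EN N))) univ
      {q : EN N × EN N | 0 < pvL q.1 q.2} := by
    intro i t ht σ _
    exact hmap i (x := (t, σ)) ⟨Ioo_subset_Icc_self ht, mem_univ _⟩
  have hc0 : ∀ i : Fin N, ∀ t ∈ Ioo (-η) η, Continuous (fun σ : Sph N => pv (σ : EN N) (x + t • ebas i) * g σ) := by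
    intro i t ht
    have := (continuousOn_pv (N := N) (s := {q | 0 < pvL q.1 q.2}) (fun q hq => hq)).comp
      (by fun_prop) (hmap' i t ht)
    exact (continuousOn_univ.1 this).mul hg
  have hc1 : ∀ i : Fin N, ContinuousOn (fun p : ℝ × Sph N => pvd1 (ebas i) (p.2 : EN N) (x + p.1 • ebas i) * g p.2) (Icc (-η) η ×ˢ univ) := by
    intro i
    have := (continuousOn_pvd1 (N := N) (ebas i) (s := {q | 0 < pvL q.1 q.2}) (fun q hq => hq)).comp
      (by fun_prop) (hmap i)
    exact this.mul (by fun_prop)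
  have hc1' : ∀ i : Fin N, ∀ t ∈ Ioo (-η) η, Continuous (fun σ : Sph N => pvd1 (ebas i) (σ : EN N) (x + t • ebas i) * g σ) := by
    intro i t ht
    have := (continuousOn_pvd1 (N := N) (ebas i) (s := {q | 0 < pvL q.1 q.2}) (fun q hq => hq)).comp
      (by fun_prop) (hmap' i t ht)
    exact (continuousOn_univ.1 this).mul hg
  have hc2 : ∀ i : Fin N, ContinuousOn (fun p : ℝ × Sph N => pvd2 (ebas i) (p.2 : EN N) (x + p.1 • ebas i) * g p.2) (Icc (-η) η ×ˢ univ) := by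
    intro i
    have := (continuousOn_pvd2 (N := N) (ebas i) (s := {q | 0 < pvL q.1 q.2}) (fun q hq => hq)).comp
      (by fun_prop) (hmap i)
    exact this.mul (by fun_prop)
  have h0mem : (0:ℝ) ∈ Ioo (-η) η := ⟨by linarith, hη0⟩
  refine ⟨fun i t => ∫ σ, pvd1 (ebas i) (σ : EN N) (x + t • ebas i) * g σ ∂μ,
    fun i => ∫ σ, pvd2 (ebas i) (σ : EN N) (x + (0:ℝ) • ebas i) * g σ ∂μ, ?_, ?_⟩
  · intro i
    constructor
    · filter_upwards [isOpen_Ioo.mem_nhds h0mem] with t ht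
      exact hasDerivAt_integral_compact μ (fun t (σ : Sph N) => pv (σ : EN N) (x + t • ebas i) * g σ)
        (fun t (σ : Sph N) => pvd1 (ebas i) (σ : EN N) (x + t • ebas i) * g σ) η (hc0 i)
        (fun t ht σ => (hasDerivAt_pv (ebas i) (σ : EN N) x t (hmap' i t ht (mem_univ σ))).mul_const _)
        (hc1 i) t ht
    · exact hasDerivAt_integral_compact μ (fun t (σ : Sph N) => pvd1 (ebas i) (σ : EN N) (x + t • ebas i) * g σ)
        (fun t (σ : Sph N) => pvd2 (ebas i) (σ : EN N) (x + t • ebas i) * g σ) η (hc1' i)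
        (fun t ht σ => (hasDerivAt_pvd1 (ebas i) (σ : EN N) x (norm_ebas i) t (hmap' i t ht (mem_univ σ))).mul_const _)
        (hc2 i) 0 h0mem
  · rw [← integral_finset_sum]
    · simp_rw [← Finset.sum_mul]
      rw [integral_eq_zero_of_ae]
      refine Eventually.of_forall fun σ => ?_
      have := sum_pvd2 (σ : EN N) x (pvL_pos_sph σ hx)
      simp [this]
    · intro i _
      have : Continuous (fun σ : Sph N => pvd2 (ebas i) (σ : EN N) (x + (0:ℝ) • ebas i) * g σ) := by
        have := (continuousOn_pvd2 (N := N) (ebas i) (s := {q | 0 < pvL q.1 q.2}) (fun q hq => hq)).comp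
          (by fun_prop) (hmap' i 0 h0mem)
        exact (continuousOn_univ.1 this).mul hg
      exact this.integrable_of_hasCompactSupport (HasCompactSupport.of_compactSpace _)



/-- surface measure -/
def sM (N : ℕ) : Measure (Sph N) := (volume : Measure (EN N)).toSphere

instance (N : ℕ) : IsFiniteMeasure (sM N) := by unfold sM; infer_instance

def sphMap {N : ℕ} (U : EN N ≃ₗᵢ[ℝ] EN N) (σ : Sph N) : Sph N :=
  ⟨U σ, by have := norm_sph σ; simp [this]⟩

open scoped Pointwise in
lemma sphMap_measurePreserving {N : ℕ} (U : EN N ≃ₗᵢ[ℝ] EN N) :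
    MeasurePreserving (sphMap U) (sM N) (sM N) := by
  have hmeas : Measurable (sphMap U) := by
    unfold sphMap
    exact (Measurable.subtype_mk (U.continuous.measurable.comp measurable_subtype_coe))
  refine ⟨hmeas, ?_⟩
  ext s hs
  rw [Measure.map_apply hmeas hs, sM, Measure.toSphere_apply' _ hs, Measure.toSphere_apply' _ (hmeas hs)]
  congr 1
  have : (Ioo (0:ℝ) 1 • ((↑) '' (sphMap U ⁻¹' s) : Set (EN N))) = U ⁻¹' (Ioo (0:ℝ) 1 • ((↑) '' s : Set (EN N))) := by
    ext x
    simp only [Set.mem_smul, mem_preimage, mem_image]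
    constructor
    · rintro ⟨t, ht, _, ⟨σ, hσ, rfl⟩, rfl⟩
      exact ⟨t, ht, U σ, ⟨sphMap U σ, hσ, rfl⟩, by simp⟩
    · rintro ⟨t, ht, _, ⟨σ, hσ, rfl⟩, h⟩
      refine ⟨t, ht, _, ⟨sphMap U.symm σ, ?_, rfl⟩, ?_⟩
      · simp only [sphMap, LinearIsometryEquiv.apply_symm_apply]; exact hσ
      · apply U.injective
        simp [sphMap, ← h]
  rw [this]
  exact U.measurePreserving.measure_preimage_emb U.toHomeomorph.measurableEmbedding _

lemma pv_isom {N : ℕ} (U : EN N ≃ₗᵢ[ℝ] EN N) (y x : EN N) : pv (U y) (U x) = pv y x := by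
  simp [pv, pvL]

lemma sphMap_measurableEmbedding {N : ℕ} (U : EN N ≃ₗᵢ[ℝ] EN N) : MeasurableEmbedding (sphMap U) := by
  have hc : ∀ U : EN N ≃ₗᵢ[ℝ] EN N, Continuous (sphMap U) := by
    intro U; unfold sphMap; fun_prop
  let h : Sph N ≃ₜ Sph N := ⟨⟨sphMap U, sphMap U.symm, fun σ => by ext1; simp [sphMap], fun σ => by ext1; simp [sphMap]⟩,
    hc U, hc U.symm⟩
  exact h.measurableEmbedding

lemma int_pv_rot {N : ℕ} {x x' : EN N} (h : ‖x‖ = ‖x'‖) :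
    ∫ σ, pv (σ : EN N) x ∂(sM N) = ∫ σ, pv (σ : EN N) x' ∂(sM N) := by
  set U := (ℝ ∙ (x - x'))ᗮ.reflection with hU
  have hUx : U x = x' := Submodule.reflection_sub h
  symm
  rw [← (sphMap_measurePreserving U).integral_comp (sphMap_measurableEmbedding U)]
  congr 1
  ext σ
  rw [← hUx, show ((sphMap U σ : Sph N) : EN N) = U σ from rfl, pv_isom]

/-- total mass -/
def om (N : ℕ) : ℝ := (sM N).real univ

lemma continuousOn_int_pv {N : ℕ} (g : Sph N → ℝ) (hg : Continuous g) :
    ContinuousOn (fun x : EN N => ∫ σ, pv (σ : EN N) x * g σ ∂(sM N)) (ball 0 1) := by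
  intro x hx
  apply ContinuousAt.continuousWithinAt
  have hx1 : ‖x‖ < 1 := by simpa using hx
  set r := (1 + ‖x‖) / 2 with hr
  have hc : ContinuousOn (fun p : EN N × Sph N => pv (p.2 : EN N) p.1 * g p.2) (closedBall 0 r ×ˢ univ) := by
    have h1 := (continuousOn_pv (N := N) (s := {q | 0 < pvL q.1 q.2}) (fun q hq => hq)).comp
      (f := fun p : EN N × Sph N => ((p.2 : EN N), p.1)) (s := closedBall 0 r ×ˢ univ) (by fun_prop) (by
        rintro ⟨z, σ⟩ ⟨hz, -⟩
        have hz' : ‖z‖ ≤ r := by simpa using hz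
        exact pvL_pos_sph σ (by linarith))
    exact h1.mul (by fun_prop)
  obtain ⟨C, hC⟩ := ((isCompact_closedBall (0 : EN N) r).prod (isCompact_univ (X := Sph N))).exists_bound_of_continuousOn hc
  have hnb : ball (0 : EN N) r ∈ 𝓝 x := isOpen_ball.mem_nhds (by simp; linarith)
  apply continuousAt_of_dominated (bound := fun _ => C)
  · filter_upwards [hnb] with z hz
    apply Continuous.aestronglyMeasurable
    rw [← continuousOn_univ]
    exact hc.comp (f := fun σ : Sph N => (z, σ)) (by fun_prop) (fun σ _ => ⟨ball_subset_closedBall hz, mem_univ _⟩)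
  · filter_upwards [hnb] with z hz
    exact Eventually.of_forall fun σ => hC (z, σ) ⟨ball_subset_closedBall hz, mem_univ _⟩
  · exact integrable_const _
  · refine Eventually.of_forall fun σ => ?_
    have h2 : ContinuousOn (fun z : EN N => pv (σ : EN N) z * g σ) (closedBall 0 r) :=
      hc.comp (f := fun z : EN N => (z, σ)) (by fun_prop) (fun z hz => ⟨hz, mem_univ _⟩)
    exact h2.continuousAt (mem_of_superset hnb ball_subset_closedBall)

lemma pv_zero {N : ℕ} (y : EN N) : pv y 0 = 1 := by simp [pv, pvL]

lemma int_pv {N : ℕ} (hN : 0 < N) {x : EN N} (hx : ‖x‖ < 1) :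
    ∫ σ, pv (σ : EN N) x ∂(sM N) = om N := by
  have h0 : ∫ σ, pv (σ : EN N) 0 ∂(sM N) = om N := by
    simp [pv_zero, om]
  set r := (1 + ‖x‖) / 2 with hr
  have hr1 : r < 1 := by linarith
  have hr0 : 0 < r := by have := norm_nonneg x; linarith
  set e : EN N := r • ebas ⟨0, hN⟩
  have he : ‖e‖ = r := by simp [e, norm_smul, norm_ebas, abs_of_pos hr0]
  set W := fun x : EN N => ∫ σ, pv (σ : EN N) x ∂(sM N) with hW
  have hWc : ContinuousOn W (closedBall 0 r) := by
    have := continuousOn_int_pv (N := N) (fun _ => 1) continuous_const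
    simp only [mul_one] at this
    exact this.mono (closedBall_subset_ball hr1)
  have hWh : ∀ x ∈ ball (0 : EN N) r, IsHarm W x := by
    intro x hx
    have := isHarm_sphere_integral (sM N) (fun _ => 1) continuous_const (x := x)
      (by have : ‖x‖ < r := by simpa using hx
          linarith)
    simpa only [mul_one] using this
  have hWr : ∀ x, ‖x‖ = r → W x = W e := fun x hx => int_pv_rot (hx.trans he.symm)
  have hup := harm_max hN hWc hWh (M := W e) (fun x hx => (hWr x hx).le)
  have hlo := harm_max hN (w := fun x => (-1) * W x) (M := -1 * W e) (by fun_prop)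
    (fun x hx => (hWh x hx).const_mul (-1)) (fun x hx => by rw [hWr x hx])
  have key : ∀ x ∈ ball (0 : EN N) r, W x = W e := by
    intro x hx
    have h1 := hup x hx
    have h2 := hlo x hx
    linarith
  have h1 := key x (by simp; linarith)
  have h2 := key 0 (by simpa using hr0)
  rw [← h0]
  exact h1.trans h2.symm



lemma pvL_sph {N : ℕ} (σ : Sph N) (x : EN N) : pvL (σ : EN N) x = ‖x - σ‖ ^ 2 := by
  rw [pvL, norm_sph, norm_sub_sq_real, norm_sph]; ring

lemma sq_rpow_half {a p : ℝ} (ha : 0 ≤ a) : (a ^ 2) ^ (p / 2) = a ^ p := by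
  rw [← rpow_natCast, ← rpow_mul ha]; congr 1; push_cast; ring

lemma pv_sph {N : ℕ} (σ : Sph N) (x : EN N) :
    pv (σ : EN N) x = (1 - ‖x‖ ^ 2) * ‖x - σ‖ ^ (-(N : ℝ)) := by
  rw [pv, pvL_sph, norm_sph, sq_rpow_half (norm_nonneg _)]; ring

lemma pvL_symm {N : ℕ} (y x : EN N) : pvL y x = pvL x y := by
  unfold pvL; rw [real_inner_comm]; ring

lemma pv_symm {N : ℕ} (y x : EN N) : pv y x = pv x y := by
  unfold pv; rw [pvL_symm]; ring

lemma continuous_pv_sph {N : ℕ} {x : EN N} (hx : ‖x‖ < 1) :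
    Continuous (fun σ : Sph N => pv (σ : EN N) x) := by
  rw [← continuousOn_univ]
  exact (continuousOn_pv (N := N) (s := {q | 0 < pvL q.1 q.2}) (fun q hq => hq)).comp
      (f := fun σ : Sph N => ((σ : EN N), x)) (by fun_prop) (fun σ _ => pvL_pos_sph σ hx)

lemma int_pv_pv {N : ℕ} (hN : 0 < N) {x y : EN N} (hx : ‖x‖ < 1) (hy : ‖y‖ < 1) :
    ∫ σ, pv (σ : EN N) x * pv (σ : EN N) y ∂(sM N) = om N * pv y x := by
  have hI : ∀ g : Sph N → ℝ, Continuous g → Integrable g (sM N) := fun g hg =>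
    hg.integrable_of_hasCompactSupport (HasCompactSupport.of_compactSpace g)
  have hom : 0 ≤ om N := measureReal_nonneg
  set E := fun x : EN N => (∫ σ, pv (σ : EN N) x * pv (σ : EN N) y ∂(sM N)) - om N * pv y x with hE
  have hcy : ContinuousOn (pv y) (closedBall (0 : EN N) 1) :=
    (continuousOn_pv (N := N) (s := {q | 0 < pvL q.1 q.2}) (fun q hq => hq)).comp
      (f := fun z : EN N => (y, z)) (by fun_prop) (fun z hz => pvL_pos (by
        have hz' : ‖z‖ ≤ 1 := by simpa using hz
        nlinarith [norm_nonneg z, norm_nonneg y]))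
  have huc := (isCompact_closedBall (0 : EN N) 1).uniformContinuousOn_of_continuous hcy
  obtain ⟨C, hC⟩ := (isCompact_closedBall (0 : EN N) 1).exists_bound_of_continuousOn hcy
  have hC0 : 0 ≤ C := (norm_nonneg _).trans (hC 0 (by simp))
  rw [Metric.uniformContinuousOn_iff] at huc
  have hbd : ∀ ε > 0, ∃ r0 < 1, ∀ z : EN N, r0 ≤ ‖z‖ → ‖z‖ < 1 → |E z| ≤ 2 * ε * om N := by
    intro ε hε
    obtain ⟨δ, hδ, hδ'⟩ := huc ε hε
    set K := 2 * C * δ ^ (-(N : ℝ)) with hK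
    have hK0 : 0 ≤ K := by positivity
    refine ⟨1 - ε / (2 * (K + 1)), by have : 0 < ε / (2 * (K + 1)) := by positivity
                                      linarith, ?_⟩
    intro z hz hz1
    have hz2 : K * (1 - ‖z‖ ^ 2) ≤ ε := by
      have h1 : 1 - ‖z‖ ^ 2 ≤ 2 * (ε / (2 * (K + 1))) := by nlinarith [norm_nonneg z]
      have h2 : 2 * (ε / (2 * (K + 1))) = ε / (K + 1) := by field_simp
      rw [h2, le_div_iff₀ (by positivity)] at h1
      nlinarith [norm_nonneg z]
    have hEz : E z = ∫ σ, pv (σ : EN N) z * (pv y σ - pv y z) ∂(sM N) := by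
      have h1 : om N * pv y z = ∫ σ, pv (σ : EN N) z * pv y z ∂(sM N) := by
        rw [integral_mul_const, int_pv hN hz1]
      simp only [hE]
      rw [h1, ← integral_sub]
      · congr 1; ext σ; rw [pv_symm y (σ : EN N)]; ring
      · exact hI _ ((continuous_pv_sph hz1).mul (continuous_pv_sph hy))
      · exact hI _ ((continuous_pv_sph hz1).mul continuous_const)
    rw [hEz]
    have hpt : ∀ σ : Sph N, ‖pv (σ : EN N) z * (pv y σ - pv y z)‖ ≤ ε * pv (σ : EN N) z + ε := by
      intro σ
      have hp0 : 0 ≤ pv (σ : EN N) z := by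
        rw [pv_sph]; have : 0 ≤ 1 - ‖z‖ ^ 2 := by nlinarith [norm_nonneg z]
        positivity
      rw [norm_mul, Real.norm_of_nonneg hp0]
      have hzc : z ∈ closedBall (0 : EN N) 1 := by simpa using hz1.le
      have hσc : (σ : EN N) ∈ closedBall (0 : EN N) 1 := by simp
      by_cases hd : dist (σ : EN N) z < δ
      · have := hδ' σ hσc z hzc hd
        rw [Real.dist_eq] at this
        rw [Real.norm_eq_abs]
        nlinarith
      · push Not at hd
        have h1 : ‖pv y σ - pv y z‖ ≤ 2 * C := by
          have := norm_sub_le (pv y σ) (pv y z)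
          linarith [hC σ hσc, hC z hzc]
        have h2 : pv (σ : EN N) z ≤ (1 - ‖z‖ ^ 2) * δ ^ (-(N : ℝ)) := by
          rw [pv_sph]
          have : 0 ≤ 1 - ‖z‖ ^ 2 := by nlinarith [norm_nonneg z]
          apply mul_le_mul_of_nonneg_left _ this
          apply rpow_le_rpow_of_nonpos hδ
          · rw [← dist_eq_norm, dist_comm]; exact hd
          · simp
        calc pv (σ : EN N) z * ‖pv y σ - pv y z‖ ≤ ((1 - ‖z‖ ^ 2) * δ ^ (-(N : ℝ))) * (2 * C) := by
              gcongr; exact hp0.trans h2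
          _ = K * (1 - ‖z‖ ^ 2) := by rw [hK]; ring
          _ ≤ ε := hz2
          _ ≤ _ := by nlinarith
    calc _ ≤ ∫ σ, (ε * pv (σ : EN N) z + ε) ∂(sM N) := by
          apply norm_integral_le_of_norm_le _ (Eventually.of_forall hpt)
          exact hI _ (((continuous_pv_sph hz1).const_mul ε |>.add continuous_const))
      _ = 2 * ε * om N := by
          rw [integral_add (hI _ (by have := continuous_pv_sph hz1; fun_prop)) (integrable_const _), integral_const_mul, int_pv hN hz1]
          simp [om]; ring
  have hEc : ContinuousOn E (ball 0 1) := by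
    apply (continuousOn_int_pv (fun σ : Sph N => pv (σ : EN N) y) (continuous_pv_sph hy)).sub
    exact (hcy.mono ball_subset_closedBall).const_smul (om N)
  have hEh : ∀ z : EN N, ‖z‖ < 1 → IsHarm E z := by
    intro z hz
    apply (isHarm_sphere_integral (sM N) _ (continuous_pv_sph hy) hz).sub
    exact (isHarm_pv (by nlinarith [norm_nonneg z, norm_nonneg y])).const_mul _
  have hfin : ∀ ε > 0, |E x| ≤ 2 * ε * om N := by
    intro ε hε
    obtain ⟨r0, hr0, h⟩ := hbd ε hε
    obtain ⟨r, hr, hr1⟩ := exists_between (max_lt hr0 hx)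
    have hr' := max_lt_iff.1 hr
    have hsub : closedBall (0 : EN N) r ⊆ ball 0 1 := closedBall_subset_ball hr1
    have hx' : x ∈ ball (0 : EN N) r := by simpa using hr'.2
    have hup := harm_max hN (hEc.mono hsub) (fun z hz => hEh z (by
      have := hsub (ball_subset_closedBall hz); simpa using this)) (M := 2 * ε * om N)
      (fun z hz => (le_abs_self _).trans (h z (by linarith) (by linarith))) x hx'
    have hlo := harm_max hN (w := fun z => (-1) * E z) ((hEc.mono hsub).const_smul (-1 : ℝ)) (fun z hz => (hEh z (by
      have := hsub (ball_subset_closedBall hz); simpa using this)).const_mul (-1)) (M := 2 * ε * om N)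
      (fun z hz => by
        have := (neg_le_abs _).trans (h z (by linarith) (by linarith))
        linarith) x hx'
    rw [abs_le]; constructor <;> linarith
  have : |E x| ≤ 0 := by
    apply le_of_forall_pos_le_add
    intro ε hε
    have h1 := hfin (ε / (2 * (om N + 1))) (by positivity)
    have h2 : 2 * (ε / (2 * (om N + 1))) * om N ≤ ε := by
      have : 2 * (ε / (2 * (om N + 1))) = ε / (om N + 1) := by field_simp
      rw [this, div_mul_eq_mul_div, div_le_iff₀ (by positivity)]
      nlinarith
    linarith
  have h0 := abs_nonpos_iff.1 this
  simp only [hE] at h0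
  linarith



lemma om_nonneg (N : ℕ) : 0 ≤ om N := measureReal_nonneg

lemma lint_unit {N : ℕ} (hN : 0 < N) {x y : EN N} (hx : ‖x‖ < 1) (hy : ‖y‖ < 1) :
    ∫⁻ σ, ENNReal.ofReal (‖x - (σ : EN N)‖ ^ (-(N:ℝ)) * ‖y - (σ : EN N)‖ ^ (-(N:ℝ))) ∂(sM N) =
      ENNReal.ofReal (om N * (1 - ‖x‖ ^ 2 * ‖y‖ ^ 2) / ((1 - ‖x‖ ^ 2) * (1 - ‖y‖ ^ 2)) *
        pvL y x ^ (-(N:ℝ) / 2)) := by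
  have h1 : 0 < 1 - ‖x‖ ^ 2 := by nlinarith [norm_nonneg x]
  have h2 : 0 < 1 - ‖y‖ ^ 2 := by nlinarith [norm_nonneg y]
  have hpt : ∀ σ : Sph N, ‖x - (σ : EN N)‖ ^ (-(N:ℝ)) * ‖y - (σ : EN N)‖ ^ (-(N:ℝ)) =
      ((1 - ‖x‖ ^ 2) * (1 - ‖y‖ ^ 2))⁻¹ * (pv (σ : EN N) x * pv (σ : EN N) y) := by
    intro σ; rw [pv_sph, pv_sph]; field_simp
  have hc : Continuous (fun σ : Sph N => ((1 - ‖x‖ ^ 2) * (1 - ‖y‖ ^ 2))⁻¹ * (pv (σ : EN N) x * pv (σ : EN N) y)) :=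
    ((continuous_pv_sph hx).mul (continuous_pv_sph hy)).const_mul _
  simp_rw [hpt]
  rw [← ofReal_integral_eq_lintegral_ofReal
    (hc.integrable_of_hasCompactSupport (HasCompactSupport.of_compactSpace _))
    (Eventually.of_forall fun σ => by simp only [Pi.zero_apply]; rw [← hpt]; positivity),
    integral_const_mul, int_pv_pv hN hx hy, pv]
  congr 1
  field_simp

def Lr {N : ℕ} (r : ℝ) (x y : EN N) : ℝ :=
  ‖x - y‖ ^ 2 * r ^ 2 + (r ^ 2 - ‖x‖ ^ 2) * (r ^ 2 - ‖y‖ ^ 2)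

lemma Lr_eq {N : ℕ} (r : ℝ) (x y : EN N) :
    Lr r x y = r ^ 4 - 2 * r ^ 2 * inner ℝ x y + ‖x‖ ^ 2 * ‖y‖ ^ 2 := by
  rw [Lr, norm_sub_sq_real]; ring

lemma Lr_pos {N : ℕ} {r : ℝ} {x y : EN N} (hx : ‖x‖ < r) (hy : ‖y‖ < r) : 0 < Lr r x y := by
  have h1 : 0 < r ^ 2 - ‖x‖ ^ 2 := by nlinarith [norm_nonneg x]
  have h2 : 0 < r ^ 2 - ‖y‖ ^ 2 := by nlinarith [norm_nonneg y]
  unfold Lr; positivity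

lemma lint_in {N : ℕ} (hN : 0 < N) {r : ℝ} {x y : EN N} (hx : ‖x‖ < r) (hy : ‖y‖ < r) :
    ∫⁻ σ, ENNReal.ofReal (‖x - r • (σ : EN N)‖ ^ (-(N:ℝ)) * ‖y - r • (σ : EN N)‖ ^ (-(N:ℝ))) ∂(sM N) =
      ENNReal.ofReal (om N * (r ^ 4 - ‖x‖ ^ 2 * ‖y‖ ^ 2) / ((r ^ 2 - ‖x‖ ^ 2) * (r ^ 2 - ‖y‖ ^ 2)) *
        Lr r x y ^ (-(N:ℝ) / 2)) := by
  have hr : 0 < r := (norm_nonneg x).trans_lt hx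
  have hnx : ‖r⁻¹ • x‖ = r⁻¹ * ‖x‖ := by rw [norm_smul, norm_inv, Real.norm_of_nonneg hr.le]
  have hny : ‖r⁻¹ • y‖ = r⁻¹ * ‖y‖ := by rw [norm_smul, norm_inv, Real.norm_of_nonneg hr.le]
  have hx1 : ‖r⁻¹ • x‖ < 1 := by rw [hnx, inv_mul_lt_one₀ hr]; exact hx
  have hy1 : ‖r⁻¹ • y‖ < 1 := by rw [hny, inv_mul_lt_one₀ hr]; exact hy
  have hsc : ∀ (z : EN N) (σ : Sph N), ‖z - r • (σ : EN N)‖ ^ (-(N:ℝ)) =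
      r ^ (-(N:ℝ)) * ‖r⁻¹ • z - (σ : EN N)‖ ^ (-(N:ℝ)) := by
    intro z σ
    rw [← mul_rpow hr.le (norm_nonneg _)]
    congr 1
    rw [← Real.norm_of_nonneg hr.le, ← norm_smul, Real.norm_of_nonneg hr.le, smul_sub, smul_inv_smul₀ hr.ne']
  have hpt : ∀ σ : Sph N, ENNReal.ofReal (‖x - r • (σ : EN N)‖ ^ (-(N:ℝ)) * ‖y - r • (σ : EN N)‖ ^ (-(N:ℝ))) =
      ENNReal.ofReal (r ^ (-(N:ℝ)) * r ^ (-(N:ℝ))) *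
      ENNReal.ofReal (‖r⁻¹ • x - (σ : EN N)‖ ^ (-(N:ℝ)) * ‖r⁻¹ • y - (σ : EN N)‖ ^ (-(N:ℝ))) := by
    intro σ
    rw [hsc, hsc, ← ENNReal.ofReal_mul (by positivity)]; congr 1; ring
  simp_rw [hpt]
  rw [lintegral_const_mul' _ _ ENNReal.ofReal_ne_top, lint_unit hN hx1 hy1, ← ENNReal.ofReal_mul (by positivity)]
  congr 1
  have hL : pvL (r⁻¹ • y) (r⁻¹ • x) = (r ^ 4)⁻¹ * Lr r x y := by
    rw [pvL, Lr_eq, hnx, hny, inner_smul_left, inner_smul_right]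
    simp only [conj_trivial]
    field_simp
  rw [hL, mul_rpow (by positivity) (Lr_pos hx hy).le, hnx, hny]
  have hr4 : ((r ^ 4)⁻¹) ^ (-(N:ℝ)/2) = (r ^ (-(N:ℝ)) * r ^ (-(N:ℝ)))⁻¹ := by
    rw [inv_rpow (by positivity), ← rpow_add hr, ← rpow_natCast, ← rpow_mul hr.le]
    congr 2; push_cast; ring
  rw [hr4]
  have h1 : r ^ 2 - ‖x‖ ^ 2 ≠ 0 := by nlinarith [norm_nonneg x]
  have h2 : r ^ 2 - ‖y‖ ^ 2 ≠ 0 := by nlinarith [norm_nonneg y]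
  have h3 : 1 - (r⁻¹ * ‖x‖) ^ 2 = (r ^ 2 - ‖x‖ ^ 2) / r ^ 2 := by field_simp
  have h4 : 1 - (r⁻¹ * ‖y‖) ^ 2 = (r ^ 2 - ‖y‖ ^ 2) / r ^ 2 := by field_simp
  have h5 : 1 - (r⁻¹ * ‖x‖) ^ 2 * (r⁻¹ * ‖y‖) ^ 2 = (r ^ 4 - ‖x‖ ^ 2 * ‖y‖ ^ 2) / r ^ 4 := by field_simp
  rw [h3, h4, h5]
  have h6 : r ^ (-(N:ℝ)) ≠ 0 := (rpow_pos_of_pos hr _).ne'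
  field_simp

lemma lint_one {N : ℕ} (hN : 0 < N) {r : ℝ} {x : EN N} (hx : ‖x‖ < r) :
    ∫⁻ σ, ENNReal.ofReal (‖x - r • (σ : EN N)‖ ^ (-(N:ℝ))) ∂(sM N) =
      ENNReal.ofReal (om N * r ^ (2 - (N:ℝ)) / (r ^ 2 - ‖x‖ ^ 2)) := by
  have hr : 0 < r := (norm_nonneg x).trans_lt hx
  have h := lint_in hN hx (y := 0) (by simpa using hr)
  have hp : 0 < r ^ (N:ℝ) := rpow_pos_of_pos hr _
  have hpt : ∀ σ : Sph N, ENNReal.ofReal (‖x - r • (σ : EN N)‖ ^ (-(N:ℝ))) =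
      ENNReal.ofReal (r ^ (N:ℝ)) * ENNReal.ofReal (‖x - r • (σ : EN N)‖ ^ (-(N:ℝ)) * ‖(0 : EN N) - r • (σ : EN N)‖ ^ (-(N:ℝ))) := by
    intro σ
    rw [← ENNReal.ofReal_mul hp.le]
    congr 1
    rw [zero_sub, norm_neg, norm_smul, norm_sph, mul_one, Real.norm_of_nonneg hr.le, rpow_neg hr.le]
    field_simp
  simp_rw [hpt]
  rw [lintegral_const_mul' _ _ ENNReal.ofReal_ne_top, h, ← ENNReal.ofReal_mul hp.le]
  congr 1
  have hL : Lr r x 0 = r ^ 4 := by rw [Lr]; simp; ring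
  have : (r ^ 4) ^ (-(N:ℝ)/2) = (r ^ (N:ℝ) * r ^ (N:ℝ))⁻¹ := by
    rw [← rpow_add hr, ← rpow_neg hr.le, ← rpow_natCast, ← rpow_mul hr.le]
    congr 1; push_cast; ring
  have h1 : r ^ 2 - ‖x‖ ^ 2 ≠ 0 := by nlinarith [norm_nonneg x]
  rw [hL, this, rpow_sub hr, rpow_two]
  simp
  field_simp

lemma lint_out {N : ℕ} (hN : 0 < N) {r : ℝ} {x ζ : EN N} (hx : ‖x‖ < r) (hζ : r < ‖ζ‖) :
    ∫⁻ σ, ENNReal.ofReal (‖x - r • (σ : EN N)‖ ^ (-(N:ℝ)) * ‖r • (σ : EN N) - ζ‖ ^ (-(N:ℝ))) ∂(sM N) =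
      ENNReal.ofReal (om N * r ^ (2 - (N:ℝ)) * (‖ζ‖ ^ 2 - ‖x‖ ^ 2) /
        ((r ^ 2 - ‖x‖ ^ 2) * (‖ζ‖ ^ 2 - r ^ 2)) * ‖x - ζ‖ ^ (-(N:ℝ))) := by
  have hr : 0 < r := (norm_nonneg x).trans_lt hx
  have hz : 0 < ‖ζ‖ := hr.trans hζ
  set y : EN N := (r ^ 2 / ‖ζ‖ ^ 2) • ζ with hy
  have hny : ‖y‖ = r ^ 2 / ‖ζ‖ := by
    rw [hy, norm_smul, Real.norm_of_nonneg (by positivity)]; field_simp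
  have hyr : ‖y‖ < r := by
    rw [hny, div_lt_iff₀ hz]; nlinarith
  have h := lint_in hN hx hyr
  have hsq : ∀ σ : Sph N, ‖r • (σ : EN N) - ζ‖ = (‖ζ‖ / r) * ‖y - r • (σ : EN N)‖ := by
    intro σ
    rw [← abs_of_nonneg (norm_nonneg (r • (σ : EN N) - ζ)), ← abs_of_nonneg (by positivity : 0 ≤ (‖ζ‖ / r) * ‖y - r • (σ : EN N)‖), ← sq_eq_sq_iff_abs_eq_abs,
      mul_pow, norm_sub_sq_real, norm_sub_sq_real, hny, hy, inner_smul_left, inner_smul_left, inner_smul_right, norm_smul, norm_sph, Real.norm_of_nonneg hr.le, real_inner_comm]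
    simp only [conj_trivial]
    field_simp
  have hc0 : 0 ≤ (‖ζ‖ / r) ^ (-(N:ℝ)) := by positivity
  have hpt : ∀ σ : Sph N, ENNReal.ofReal (‖x - r • (σ : EN N)‖ ^ (-(N:ℝ)) * ‖r • (σ : EN N) - ζ‖ ^ (-(N:ℝ))) =
      ENNReal.ofReal ((‖ζ‖ / r) ^ (-(N:ℝ))) * ENNReal.ofReal (‖x - r • (σ : EN N)‖ ^ (-(N:ℝ)) * ‖y - r • (σ : EN N)‖ ^ (-(N:ℝ))) := by
    intro σ
    rw [hsq, mul_rpow (by positivity) (norm_nonneg _), ← ENNReal.ofReal_mul hc0]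
    congr 1; ring
  simp_rw [hpt]
  rw [lintegral_const_mul' _ _ ENNReal.ofReal_ne_top, h, ← ENNReal.ofReal_mul hc0]
  congr 1
  have hL : Lr r x y = (r ^ 2 / ‖ζ‖ * ‖x - ζ‖) ^ 2 := by
    rw [Lr_eq, hny, hy, inner_smul_right, mul_pow, norm_sub_sq_real]
    field_simp
    ring
  rw [hL, sq_rpow_half (by positivity), mul_rpow (by positivity) (norm_nonneg _), hny]
  have e1 : (‖ζ‖ / r) ^ (-(N:ℝ)) * (r ^ 2 / ‖ζ‖) ^ (-(N:ℝ)) = r ^ (-(N:ℝ)) := by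
    rw [← mul_rpow (by positivity) (by positivity)]; congr 1; field_simp
  have e2 : r ^ (2 - (N:ℝ)) = r ^ 2 * r ^ (-(N:ℝ)) := by
    rw [sub_eq_add_neg, rpow_add hr, rpow_two]
  have h1 : r ^ 2 - ‖x‖ ^ 2 ≠ 0 := by nlinarith [norm_nonneg x]
  have h2 : ‖ζ‖ ^ 2 - r ^ 2 ≠ 0 := by nlinarith [norm_nonneg x]
  have h3 : r ^ 2 - (r ^ 2 / ‖ζ‖) ^ 2 = r ^ 2 * (‖ζ‖ ^ 2 - r ^ 2) / ‖ζ‖ ^ 2 := by field_simp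
  have h4 : r ^ 4 - ‖x‖ ^ 2 * (r ^ 2 / ‖ζ‖) ^ 2 = r ^ 4 * (‖ζ‖ ^ 2 - ‖x‖ ^ 2) / ‖ζ‖ ^ 2 := by field_simp
  rw [e2, ← e1, h3, h4]
  field_simp



lemma lintegral_polar {N : ℕ} (hN : 0 < N) (F : EN N → ENNReal) (hF : Measurable F) :
    ∫⁻ x, F x = ∫⁻ r in Ioi (0:ℝ), ENNReal.ofReal (r ^ (N - 1)) * ∫⁻ σ, F (r • (σ : EN N)) ∂(sM N) := by
  have : Nonempty (Fin N) := ⟨⟨0, hN⟩⟩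
  have : Nontrivial (EN N) := inferInstance
  have h := (volume : Measure (EN N)).measurePreserving_homeomorphUnitSphereProd
  set e := homeomorphUnitSphereProd (EN N)
  have hdim : Module.finrank ℝ (EN N) = N := by simp
  rw [hdim] at h
  calc ∫⁻ x, F x = ∫⁻ x : ({(0)}ᶜ : Set (EN N)), F x ∂((volume : Measure (EN N)).comap Subtype.val) := by
        rw [lintegral_subtype_comap (measurableSet_singleton _).compl F, restrict_compl_singleton]
    _ = ∫⁻ x : ({(0)}ᶜ : Set (EN N)), F ((e x).2.1 • ((e x).1 : EN N)) ∂((volume : Measure (EN N)).comap Subtype.val) := by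
        congr 1; ext x
        have := congrArg Subtype.val (e.symm_apply_apply x)
        simp only [e, homeomorphUnitSphereProd_symm_apply_coe] at this
        rw [this]
    _ = ∫⁻ p, F (p.2.1 • (p.1 : EN N)) ∂((sM N).prod (Measure.volumeIoiPow (N - 1))) := by
        exact h.lintegral_comp_emb e.measurableEmbedding (fun p => F (p.2.1 • (p.1 : EN N)))
    _ = ∫⁻ r, ∫⁻ σ, F (r.1 • (σ : EN N)) ∂(sM N) ∂(Measure.volumeIoiPow (N - 1)) := by
        rw [lintegral_prod_symm']
        exact hF.comp (by fun_prop)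
    _ = _ := by
        rw [Measure.volumeIoiPow, lintegral_withDensity_eq_lintegral_mul₀]
        · simp only [Pi.mul_apply]
          rw [lintegral_subtype_comap measurableSet_Ioi (fun r : ℝ => ENNReal.ofReal (r ^ (N - 1)) * ∫⁻ σ, F (r • (σ : EN N)) ∂(sM N))]
        · fun_prop
        · apply Measurable.aemeasurable
          exact (hF.comp (by fun_prop : Measurable fun p : Ioi (0:ℝ) × Sph N => p.1.1 • (p.2 : EN N))).lintegral_prod_right'

lemma om_eq {N : ℕ} (hN : 0 < N) : om N = 2 * π ^ ((N:ℝ) / 2) / Gamma ((N:ℝ) / 2) := by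
  have : Nonempty (Fin N) := ⟨⟨0, hN⟩⟩
  rw [om, sM, Measure.toSphere_real_apply_univ, measureReal_def, EuclideanSpace.volume_ball]
  simp only [finrank_euclideanSpace, Fintype.card_fin, ENNReal.ofReal_one, one_pow, one_mul]
  have hN' : (0:ℝ) < N / 2 := by positivity
  rw [ENNReal.toReal_ofReal (by positivity), Gamma_add_one hN'.ne', sqrt_eq_rpow, ← rpow_natCast, ← rpow_mul pi_pos.le]
  have := Gamma_pos_of_pos hN'
  rw [show 1 / 2 * (N:ℝ) = N / 2 by ring]
  field_simp

lemma lintegral_Gamma {a r : ℝ} (ha : 0 < a) (hr : 0 < r) :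
    ∫⁻ t in Ioi (0:ℝ), ENNReal.ofReal (t ^ (a - 1) * exp (-(r * t))) =
      ENNReal.ofReal ((1 / r) ^ a * Gamma a) := by
  have h := integral_rpow_mul_exp_neg_mul_Ioi ha hr
  have hpos : 0 < (1 / r) ^ a * Gamma a := mul_pos (by positivity) (Gamma_pos_of_pos ha)
  have hi : IntegrableOn (fun t : ℝ => t ^ (a - 1) * exp (-(r * t))) (Ioi 0) := by
    by_contra hn
    rw [integral_undef hn] at h
    linarith
  rw [← h, ofReal_integral_eq_lintegral_ofReal hi]
  filter_upwards [ae_restrict_mem measurableSet_Ioi] with t ht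
  have : (0:ℝ) < t := ht
  simp only [Pi.zero_apply]; positivity

lemma lintegral_Beta {p q : ℝ} (hp : 0 < p) (hq : 0 < q) :
    ∫⁻ s in Ioi (0:ℝ), ENNReal.ofReal (s ^ (p - 1) * (1 + s) ^ (-(p + q))) =
      ENNReal.ofReal (Gamma p * Gamma q / Gamma (p + q)) := by
  have hG := Gamma_pos_of_pos (add_pos hp hq)
  have hGp := Gamma_pos_of_pos hp
  have hGq := Gamma_pos_of_pos hq
  have key : ENNReal.ofReal (Gamma (p + q)) * ∫⁻ s in Ioi (0:ℝ), ENNReal.ofReal (s ^ (p - 1) * (1 + s) ^ (-(p + q))) =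
      ENNReal.ofReal (Gamma p * Gamma q) := by
    rw [← lintegral_const_mul' _ _ ENNReal.ofReal_ne_top]
    calc _ = ∫⁻ s in Ioi (0:ℝ), ∫⁻ t in Ioi (0:ℝ), ENNReal.ofReal (s ^ (p - 1)) * ENNReal.ofReal (t ^ (p + q - 1) * exp (-((1 + s) * t))) := by
          apply setLIntegral_congr_fun measurableSet_Ioi
          intro s hs
          have hs : (0:ℝ) < s := hs
          simp only
          rw [lintegral_const_mul' _ _ ENNReal.ofReal_ne_top, lintegral_Gamma (add_pos hp hq) (by positivity), ← ENNReal.ofReal_mul hG.le, ← ENNReal.ofReal_mul (by positivity)]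
          congr 1
          rw [one_div, inv_rpow (by positivity), rpow_neg (by positivity)]; ring
      _ = ∫⁻ t in Ioi (0:ℝ), ∫⁻ s in Ioi (0:ℝ), ENNReal.ofReal (s ^ (p - 1)) * ENNReal.ofReal (t ^ (p + q - 1) * exp (-((1 + s) * t))) := by
          rw [lintegral_lintegral_swap]
          apply Measurable.aemeasurable
          fun_prop
      _ = ∫⁻ t in Ioi (0:ℝ), ENNReal.ofReal (Gamma p) * ENNReal.ofReal (t ^ (q - 1) * exp (-(1 * t))) := by
          apply setLIntegral_congr_fun measurableSet_Ioi
          intro t ht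
          have ht : (0:ℝ) < t := ht
          simp only
          calc _ = ∫⁻ s in Ioi (0:ℝ), ENNReal.ofReal (t ^ (p + q - 1) * exp (-t)) * ENNReal.ofReal (s ^ (p - 1) * exp (-(t * s))) := by
                apply setLIntegral_congr_fun measurableSet_Ioi
                intro s hs
                have hs : (0:ℝ) < s := hs
                simp only
                rw [← ENNReal.ofReal_mul (by positivity), ← ENNReal.ofReal_mul (by positivity),
                  show -((1 + s) * t) = -t + -(t * s) by ring, exp_add]
                congr 1; ring
            _ = _ := by
                rw [lintegral_const_mul' _ _ ENNReal.ofReal_ne_top, lintegral_Gamma hp ht, ← ENNReal.ofReal_mul (by positivity), ← ENNReal.ofReal_mul hGp.le]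
                congr 1
                rw [one_div, inv_rpow ht.le, show p + q - 1 = p + (q - 1) by ring, rpow_add ht, one_mul]
                have := rpow_pos_of_pos ht p
                field_simp
      _ = _ := by
          rw [lintegral_const_mul' _ _ ENNReal.ofReal_ne_top, lintegral_Gamma hq one_pos, ← ENNReal.ofReal_mul hGp.le]
          simp
  rw [ENNReal.ofReal_div_of_pos hG, ENNReal.eq_div_iff (by simpa using hG) ENNReal.ofReal_ne_top]
  exact key

lemma lint_J {a u w : ℝ} (ha : 0 < a) (ha1 : a < 1) (hu : 0 < u) (hw : 0 < w) :
    ∫⁻ t in Ioi (0:ℝ), ENNReal.ofReal (t ^ (-a) / (u + w * t)) =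
      ENNReal.ofReal (u ^ (-a) * w ^ (a - 1) * (π / sin (π * a))) := by
  have him : (fun s : ℝ => (u / w) * s) '' Ioi 0 = Ioi 0 := by
    ext t
    simp only [mem_image, mem_Ioi]
    constructor
    · rintro ⟨s, hs, rfl⟩; positivity
    · intro ht; exact ⟨t / (u / w), by positivity, by field_simp⟩
  have hB := lintegral_Beta (p := 1 - a) (q := a) (by linarith) ha
  rw [show 1 - a + a = 1 by ring, Gamma_one, div_one, mul_comm (Gamma (1 - a)), Gamma_mul_Gamma_one_sub] at hB
  rw [← him, lintegral_image_eq_lintegral_deriv_mul_of_monotoneOn (f' := fun _ => u / w) measurableSet_Ioi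
    (fun x _ => by simpa using ((hasDerivAt_id x).const_mul (u / w)).hasDerivWithinAt)
    (fun x _ y _ h => by gcongr)]
  have : ∀ s ∈ Ioi (0:ℝ), ENNReal.ofReal (u / w) * ENNReal.ofReal ((u / w * s) ^ (-a) / (u + w * (u / w * s)))
      = ENNReal.ofReal (u ^ (-a) * w ^ (a - 1)) * ENNReal.ofReal (s ^ (1 - a - 1) * (1 + s) ^ (-(1:ℝ))) := by
    intro s hs
    have hs : (0:ℝ) < s := hs
    rw [← ENNReal.ofReal_mul (by positivity), ← ENNReal.ofReal_mul (by positivity)]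
    congr 1
    rw [mul_rpow (by positivity) hs.le, div_rpow hu.le hw.le, rpow_neg_one, rpow_sub hw, rpow_one, rpow_neg hw.le,
      show 1 - a - 1 = -a by ring]
    have := rpow_pos_of_pos hw a
    field_simp
  rw [setLIntegral_congr_fun measurableSet_Ioi this, lintegral_const_mul' _ _ ENNReal.ofReal_ne_top, hB, ← ENNReal.ofReal_mul (by positivity)]

lemma lint_J2 {a p b : ℝ} (ha : 0 < a) (ha1 : a < 1) (hp : p < 1) (hb : 1 < b) :
    ∫⁻ s in Ioo 1 b, ENNReal.ofReal ((s - 1) ^ (-a) * (b - s) ^ (a - 1) / (s - p)) =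
      ENNReal.ofReal ((1 - p) ^ (-a) * (b - p) ^ (a - 1) * (π / sin (π * a))) := by
  rw [← lint_J ha ha1 (sub_pos.2 hp) (by linarith : 0 < b - p)]
  have him : (fun s : ℝ => (s - 1) / (b - s)) '' Ioo 1 b = Ioi 0 := by
    ext t
    simp only [mem_image, mem_Ioi, mem_Ioo]
    constructor
    · rintro ⟨s, hs, rfl⟩; exact div_pos (by linarith) (by linarith)
    · intro ht
      refine ⟨(1 + t * b) / (1 + t), ⟨?_, ?_⟩, ?_⟩
      · rw [lt_div_iff₀ (by positivity)]; nlinarith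
      · rw [div_lt_iff₀ (by positivity)]; nlinarith
      · have e1 : (1 + t * b) / (1 + t) - 1 = t * (b - 1) / (1 + t) := by field_simp; ring
        have e2 : b - (1 + t * b) / (1 + t) = (b - 1) / (1 + t) := by field_simp; ring
        have : b - 1 ≠ 0 := by linarith
        rw [e1, e2]; field_simp
  rw [← him, lintegral_image_eq_lintegral_deriv_mul_of_monotoneOn (f' := fun s => (b - 1) / (b - s) ^ 2) measurableSet_Ioo]
  · apply setLIntegral_congr_fun measurableSet_Ioo
    intro s hs
    have h1 : 0 < s - 1 := by linarith [hs.1]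
    have h2 : 0 < b - s := by linarith [hs.2]
    have h3 : 0 < s - p := by linarith
    have h4 : 0 < b - 1 := by linarith
    simp only
    rw [← ENNReal.ofReal_mul (by positivity)]
    congr 1
    have e : 1 - p + (b - p) * ((s - 1) / (b - s)) = (b - 1) * (s - p) / (b - s) := by field_simp; ring
    rw [e, div_rpow h1.le h2.le, rpow_sub h2, rpow_one, rpow_neg h2.le]
    have := rpow_pos_of_pos h2 a
    field_simp
  · intro s hs
    have h2 : b - s ≠ 0 := by linarith [hs.2]
    have := ((hasDerivAt_id s).sub_const 1).div ((hasDerivAt_id s).const_sub b) h2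
    refine (this.congr_deriv ?_).hasDerivWithinAt
    simp only [id]
    ring
  · intro s hs t ht h
    simp only
    have h1 : 0 < t - 1 := by linarith [ht.1]
    have h2 : 0 < b - t := by linarith [ht.2]
    gcongr



def mE {N : ℕ} (α : ℝ) (x ζ : EN N) : ENNReal :=
  if ‖x‖ < ‖ζ‖ then ENNReal.ofReal ((‖ζ‖ ^ 2 - ‖x‖ ^ 2) ^ (α / 2) * ‖x - ζ‖ ^ (-(N:ℝ))) else 0

def KE {N : ℕ} (α : ℝ) (x y : EN N) : ENNReal :=
  if 1 < ‖y‖ then ENNReal.ofReal (poissonBall N α 0 1 x y) else 0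

lemma measurable_mE {N : ℕ} (α : ℝ) : Measurable (fun p : EN N × EN N => mE α p.1 p.2) := by
  unfold mE
  refine Measurable.ite (measurableSet_lt (by fun_prop) (by fun_prop)) ?_ measurable_const
  fun_prop

lemma measurable_KE {N : ℕ} (α : ℝ) : Measurable (fun p : EN N × EN N => KE α p.1 p.2) := by
  unfold KE poissonBall
  refine Measurable.ite (measurableSet_lt (by fun_prop) (by fun_prop)) ?_ measurable_const
  fun_prop

lemma measurable_KE_right {N : ℕ} (α : ℝ) (x : EN N) : Measurable (fun y : EN N => KE α x y) := by
  unfold KE poissonBall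
  refine Measurable.ite (measurableSet_lt (by fun_prop) (by fun_prop)) ?_ measurable_const
  fun_prop

lemma measurable_mE_left {N : ℕ} (α : ℝ) (y : EN N) : Measurable (fun x : EN N => mE α x y) := by
  unfold mE
  refine Measurable.ite (measurableSet_lt (by fun_prop) (by fun_prop)) ?_ measurable_const
  fun_prop

lemma measurable_mE_right {N : ℕ} (α : ℝ) (x : EN N) : Measurable (fun y : EN N => mE α x y) := by
  unfold mE
  refine Measurable.ite (measurableSet_lt (by fun_prop) (by fun_prop)) ?_ measurable_const
  fun_prop

lemma poissonCoeff_pos {N : ℕ} (hN : 0 < N) {α : ℝ} (hα0 : 0 < α) (hα2 : α < 2) : 0 < poissonCoeff N α := by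
  unfold poissonCoeff
  have h1 : 0 < Gamma ((N:ℝ) / 2) := Gamma_pos_of_pos (by positivity)
  have h2 : 0 < sin (π * α / 2) := sin_pos_of_pos_of_lt_pi (by positivity) (by nlinarith [pi_pos])
  positivity

lemma poissonCoeff_om {N : ℕ} (hN : 0 < N) {α : ℝ} (hα0 : 0 < α) (hα2 : α < 2) :
    poissonCoeff N α * om N * (π / sin (π * (α / 2))) = 2 := by
  have h1 : 0 < Gamma ((N:ℝ) / 2) := Gamma_pos_of_pos (by positivity)
  have h2 : 0 < sin (π * α / 2) := sin_pos_of_pos_of_lt_pi (by positivity) (by nlinarith [pi_pos])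
  rw [poissonCoeff, om_eq hN, show π * (α / 2) = π * α / 2 by ring, show -1 - (N:ℝ)/2 = -1 + -((N:ℝ)/2) by ring,
    rpow_add pi_pos, rpow_neg_one, rpow_neg pi_pos.le]
  have := rpow_pos_of_pos pi_pos ((N:ℝ)/2)
  field_simp

lemma pow_mul_rpow_aux {N : ℕ} (hN : 0 < N) {r : ℝ} (hr : 0 < r) (p : ℝ) :
    r ^ (N - 1) * r ^ (p - (N:ℝ)) = r ^ (p - 1) := by
  rw [← rpow_natCast, ← rpow_add hr]
  congr 1
  rw [Nat.cast_sub hN]; push_cast; ring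

lemma norm_smul_sph {N : ℕ} {r : ℝ} (hr : 0 < r) (σ : Sph N) : ‖r • (σ : EN N)‖ = r := by
  rw [norm_smul, norm_sph, mul_one, Real.norm_of_nonneg hr.le]

lemma poissonBall_eq {N : ℕ} {α : ℝ} {x y : EN N} (hx : ‖x‖ < 1) (hy : 1 < ‖y‖) :
    poissonBall N α 0 1 x y = poissonCoeff N α * (1 - ‖x‖ ^ 2) ^ (α / 2) * (‖y‖ ^ 2 - 1) ^ (-(α / 2)) *
      ‖x - y‖ ^ (-(N:ℝ)) := by
  have h1 : 0 ≤ 1 - ‖x‖ ^ 2 := by nlinarith [norm_nonneg x]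
  have h2 : 0 ≤ ‖y‖ ^ 2 - 1 := by nlinarith [norm_nonneg y]
  unfold poissonBall
  rw [sub_zero, sub_zero, one_pow, div_rpow h1 h2, rpow_neg h2]
  ring

lemma lint_KE {N : ℕ} (hN : 0 < N) {α : ℝ} (hα0 : 0 < α) (hα2 : α < 2) {x : EN N} (hx : ‖x‖ < 1) :
    ∫⁻ y, KE α x y = 1 := by
  have h1 : 0 < 1 - ‖x‖ ^ 2 := by nlinarith [norm_nonneg x]
  have hc := poissonCoeff_pos hN hα0 hα2
  rw [lintegral_polar hN (fun y => KE α x y) (measurable_KE_right α x)]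
  set c := poissonCoeff N α with hcdef
  have hpt : ∀ r ∈ Ioi (0:ℝ), ENNReal.ofReal (r ^ (N - 1)) * ∫⁻ σ, KE α x (r • (σ : EN N)) ∂(sM N) =
      (Ioi (1:ℝ)).indicator (fun r => ENNReal.ofReal (c * om N / 2 * (1 - ‖x‖ ^ 2) ^ (α / 2)) *
        (ENNReal.ofReal (2 * r) * ENNReal.ofReal ((r ^ 2 - 1) ^ (-(α / 2)) / ((1 - ‖x‖ ^ 2) + 1 * (r ^ 2 - 1))))) r := by
    intro r hr
    have hr : (0:ℝ) < r := hr
    by_cases h : 1 < r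
    · have h3 : 0 < r ^ 2 - 1 := by nlinarith
      rw [indicator_of_mem (by exact h)]
      have : ∀ σ : Sph N, KE α x (r • (σ : EN N)) = ENNReal.ofReal (c * (1 - ‖x‖ ^ 2) ^ (α / 2) * (r ^ 2 - 1) ^ (-(α / 2))) *
          ENNReal.ofReal (‖x - r • (σ : EN N)‖ ^ (-(N:ℝ))) := by
        intro σ
        rw [KE, if_pos (by rw [norm_smul_sph hr]; exact h), poissonBall_eq hx (by rw [norm_smul_sph hr]; exact h),
          norm_smul_sph hr, ← ENNReal.ofReal_mul (by positivity)]
      simp_rw [this]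
      have h4 : 0 < r ^ 2 - ‖x‖ ^ 2 := by linarith
      have hom := om_nonneg N
      rw [lintegral_const_mul' _ _ ENNReal.ofReal_ne_top, lint_one hN (by linarith), ← ENNReal.ofReal_mul (by positivity),
        ← ENNReal.ofReal_mul (by positivity), ← ENNReal.ofReal_mul (by positivity), ← ENNReal.ofReal_mul (by positivity)]
      congr 1
      have h5 := pow_mul_rpow_aux hN hr 2
      rw [show (2:ℝ) - 1 = 1 by norm_num, rpow_one] at h5
      rw [show 1 - ‖x‖ ^ 2 + 1 * (r ^ 2 - 1) = r ^ 2 - ‖x‖ ^ 2 by ring]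
      calc _ = (r ^ (N - 1) * r ^ (2 - (N:ℝ))) * (c * (1 - ‖x‖ ^ 2) ^ (α / 2) * (r ^ 2 - 1) ^ (-(α / 2)) * om N / (r ^ 2 - ‖x‖ ^ 2)) := by ring
        _ = _ := by rw [h5]; ring
    · rw [indicator_of_notMem (by exact h)]
      have : ∀ σ : Sph N, KE α x (r • (σ : EN N)) = 0 := by
        intro σ
        rw [KE, if_neg (by rw [norm_smul_sph hr]; exact h)]
      simp [this]
  have him : (fun r : ℝ => r ^ 2 - 1) '' Ioi 1 = Ioi 0 := by
    ext t
    simp only [mem_image, mem_Ioi]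
    constructor
    · rintro ⟨s, hs, rfl⟩; nlinarith
    · intro ht; exact ⟨√(t + 1), by rw [lt_sqrt (by norm_num)]; linarith, by rw [sq_sqrt (by positivity)]; ring⟩
  rw [setLIntegral_congr_fun measurableSet_Ioi hpt, setLIntegral_indicator measurableSet_Ioi,
    inter_eq_left.2 (Ioi_subset_Ioi zero_le_one), lintegral_const_mul' _ _ ENNReal.ofReal_ne_top,
    ← lintegral_image_eq_lintegral_deriv_mul_of_monotoneOn (s := Ioi 1) (f := fun r : ℝ => r ^ 2 - 1) (f' := fun r => 2 * r) measurableSet_Ioi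
    (fun r _ => by simpa using ((hasDerivAt_pow 2 r).sub_const 1).hasDerivWithinAt)
    (fun r hr s hs h => by
      have : (1:ℝ) < r := hr
      simp only; gcongr)
    (fun t => ENNReal.ofReal (t ^ (-(α / 2)) / ((1 - ‖x‖ ^ 2) + 1 * t))), him,
    lint_J (by linarith) (by linarith) h1 one_pos, ← ENNReal.ofReal_mul (by have := om_nonneg N; positivity), ← ENNReal.ofReal_one]
  congr 1
  have := poissonCoeff_om hN hα0 hα2
  rw [one_rpow, rpow_neg h1.le]
  have h6 := rpow_pos_of_pos h1 (α / 2)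
  calc _ = (c * om N * (π / sin (π * (α / 2)))) / 2 := by field_simp
    _ = 1 := by rw [hcdef, this]; norm_num

lemma lint_KE_mE {N : ℕ} (hN : 0 < N) {α : ℝ} (hα0 : 0 < α) (hα2 : α < 2) {x ζ : EN N} (hx : ‖x‖ < 1)
    (hζ : 1 < ‖ζ‖) :
    ∫⁻ y, KE α x y * mE α y ζ = mE α x ζ := by
  have h1 : 0 < 1 - ‖x‖ ^ 2 := by nlinarith [norm_nonneg x]
  have hc := poissonCoeff_pos hN hα0 hα2
  have hom := om_nonneg N
  set R := ‖ζ‖ with hR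
  have hRx : 0 < R ^ 2 - ‖x‖ ^ 2 := by nlinarith [norm_nonneg x]
  rw [lintegral_polar hN (fun y => KE α x y * mE α y ζ) ((measurable_KE_right α x).mul (measurable_mE_left α ζ))]
  set c := poissonCoeff N α with hcdef
  have hpt : ∀ r ∈ Ioi (0:ℝ), ENNReal.ofReal (r ^ (N - 1)) * ∫⁻ σ, KE α x (r • (σ : EN N)) * mE α (r • (σ : EN N)) ζ ∂(sM N) =
      (Ioo (1:ℝ) R).indicator (fun r => ENNReal.ofReal (c * om N / 2 * (1 - ‖x‖ ^ 2) ^ (α / 2) * (R ^ 2 - ‖x‖ ^ 2) * ‖x - ζ‖ ^ (-(N:ℝ))) *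
        (ENNReal.ofReal (2 * r) * ENNReal.ofReal ((r ^ 2 - 1) ^ (-(α / 2)) * (R ^ 2 - r ^ 2) ^ (α / 2 - 1) / (r ^ 2 - ‖x‖ ^ 2)))) r := by
    intro r hr
    have hr : (0:ℝ) < r := hr
    by_cases h : r ∈ Ioo 1 R
    · obtain ⟨ha, hb⟩ := h
      have h3 : 0 < r ^ 2 - 1 := by nlinarith
      have h3' : 0 < R ^ 2 - r ^ 2 := by nlinarith
      rw [indicator_of_mem (by exact ⟨ha, hb⟩)]
      have : ∀ σ : Sph N, KE α x (r • (σ : EN N)) * mE α (r • (σ : EN N)) ζ =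
          ENNReal.ofReal (c * (1 - ‖x‖ ^ 2) ^ (α / 2) * (r ^ 2 - 1) ^ (-(α / 2)) * (R ^ 2 - r ^ 2) ^ (α / 2)) *
          ENNReal.ofReal (‖x - r • (σ : EN N)‖ ^ (-(N:ℝ)) * ‖r • (σ : EN N) - ζ‖ ^ (-(N:ℝ))) := by
        intro σ
        rw [KE, if_pos (by rw [norm_smul_sph hr]; exact ha), poissonBall_eq hx (by rw [norm_smul_sph hr]; exact ha),
          mE, if_pos (by rw [norm_smul_sph hr]; exact hb),
          norm_smul_sph hr, ← ENNReal.ofReal_mul (by positivity), ← ENNReal.ofReal_mul (by positivity)]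
        congr 1; ring
      simp_rw [this]
      have h4 : 0 < r ^ 2 - ‖x‖ ^ 2 := by linarith
      rw [lintegral_const_mul' _ _ ENNReal.ofReal_ne_top, lint_out hN (by linarith) hb, ← ENNReal.ofReal_mul (by positivity),
        ← ENNReal.ofReal_mul (by positivity), ← ENNReal.ofReal_mul (by positivity), ← ENNReal.ofReal_mul (by positivity)]
      congr 1
      have h5 := pow_mul_rpow_aux hN hr 2
      rw [show (2:ℝ) - 1 = 1 by norm_num, rpow_one] at h5
      rw [← hR, rpow_sub h3', rpow_one]
      calc _ = (r ^ (N - 1) * r ^ (2 - (N:ℝ))) * (c * (1 - ‖x‖ ^ 2) ^ (α / 2) * (r ^ 2 - 1) ^ (-(α / 2)) * (R ^ 2 - r ^ 2) ^ (α / 2) * (om N * (R ^ 2 - ‖x‖ ^ 2) / ((r ^ 2 - ‖x‖ ^ 2) * (R ^ 2 - r ^ 2)) * ‖x - ζ‖ ^ (-(N:ℝ)))) := by ring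
        _ = _ := by rw [h5]; field_simp
    · rw [indicator_of_notMem h]
      have : ∀ σ : Sph N, KE α x (r • (σ : EN N)) * mE α (r • (σ : EN N)) ζ = 0 := by
        intro σ
        rw [KE, mE, norm_smul_sph hr]
        by_cases h' : 1 < r
        · rw [if_neg (fun h2 => h ⟨h', h2⟩), mul_zero]
        · rw [if_neg h', zero_mul]
      simp [this]
  have him : (fun r : ℝ => r ^ 2) '' Ioo 1 R = Ioo 1 (R ^ 2) := by
    ext t
    simp only [mem_image, mem_Ioo]
    constructor
    · rintro ⟨s, hs, rfl⟩; constructor <;> nlinarith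
    · intro ht; exact ⟨√t, ⟨by rw [lt_sqrt (by norm_num)]; linarith, by rw [sqrt_lt' (by linarith)]; exact ht.2⟩, by rw [sq_sqrt (by linarith)]⟩
  rw [setLIntegral_congr_fun measurableSet_Ioi hpt, setLIntegral_indicator measurableSet_Ioo,
    inter_eq_left.2 (show Ioo 1 R ⊆ Ioi 0 from fun r hr => lt_trans zero_lt_one hr.1), lintegral_const_mul' _ _ ENNReal.ofReal_ne_top,
    ← lintegral_image_eq_lintegral_deriv_mul_of_monotoneOn (s := Ioo 1 R) (f := fun r : ℝ => r ^ 2) (f' := fun r => 2 * r) measurableSet_Ioo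
    (fun r _ => by simpa using ((hasDerivAt_pow 2 r)).hasDerivWithinAt)
    (fun r hr s hs h => by
      have : (1:ℝ) < r := hr.1
      simp only; gcongr)
    (fun t => ENNReal.ofReal ((t - 1) ^ (-(α / 2)) * (R ^ 2 - t) ^ (α / 2 - 1) / (t - ‖x‖ ^ 2))), him,
    lint_J2 (by linarith) (by linarith) (by linarith) (by nlinarith), ← ENNReal.ofReal_mul (by positivity),
    mE, if_pos (by linarith)]
  congr 1
  have := poissonCoeff_om hN hα0 hα2
  rw [rpow_neg h1.le, rpow_sub hRx, rpow_one]
  have h6 := rpow_pos_of_pos h1 (α / 2)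
  calc _ = (c * om N * (π / sin (π * (α / 2)))) / 2 * ((R ^ 2 - ‖x‖ ^ 2) ^ (α / 2) * ‖x - ζ‖ ^ (-(N:ℝ))) := by field_simp
    _ = _ := by rw [hcdef, this, hR]; norm_num



def sf {N : ℕ} (x y : EN N) (r : ℝ) : ℝ := (r - ‖x‖ ^ 2 / r) * (r - ‖y‖ ^ 2 / r) / ‖x - y‖ ^ 2

lemma sf_strictMono {N : ℕ} {x y : EN N} (hxy : x ≠ y) :
    StrictMonoOn (sf x y) (Ici (max ‖x‖ ‖y‖)) := by
  have hd : 0 < ‖x - y‖ ^ 2 := by have := norm_pos_iff.2 (sub_ne_zero.2 hxy); positivity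
  have hρ : 0 < max ‖x‖ ‖y‖ := by
    by_contra h
    push Not at h
    have h1 := (le_max_left ‖x‖ ‖y‖).trans h
    have h2 := (le_max_right ‖x‖ ‖y‖).trans h
    rw [norm_le_zero_iff] at h1 h2
    exact hxy (h1.trans h2.symm)
  intro r hr s hs hrs
  have hr' : max ‖x‖ ‖y‖ ≤ r := hr
  have hr0 : 0 < r := hρ.trans_le hr'
  have hs0 : 0 < s := hr0.trans hrs
  unfold sf
  apply div_lt_div_of_pos_right _ hd
  have key : ∀ b : ℝ, 0 ≤ b → b ≤ r → 0 ≤ r - b ^ 2 / r ∧ r - b ^ 2 / r < s - b ^ 2 / s := by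
    intro b hb hbr
    constructor
    · rw [sub_nonneg, div_le_iff₀ hr0]; nlinarith
    · have : b ^ 2 / s ≤ b ^ 2 / r := by gcongr
      linarith
  have h1 := key ‖x‖ (norm_nonneg _) ((le_max_left _ _).trans hr')
  have h2 := key ‖y‖ (norm_nonneg _) ((le_max_right _ _).trans hr')
  exact mul_lt_mul'' h1.2 h2.2 h1.1 h2.1

lemma max_norm_pos {N : ℕ} {x y : EN N} (hxy : x ≠ y) : 0 < max ‖x‖ ‖y‖ := by
  by_contra h
  push Not at h
  have h1 := (le_max_left ‖x‖ ‖y‖).trans h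
  have h2 := (le_max_right ‖x‖ ‖y‖).trans h
  rw [norm_le_zero_iff] at h1 h2
  exact hxy (h1.trans h2.symm)

lemma sf_max {N : ℕ} {x y : EN N} : sf x y (max ‖x‖ ‖y‖) = 0 := by
  have key : ∀ b : ℝ, b - b ^ 2 / b = 0 := by
    intro b
    by_cases hb : b = 0
    · simp [hb]
    · field_simp; ring
  unfold sf
  rcases max_choice ‖x‖ ‖y‖ with h | h <;> rw [h, key] <;> simp

lemma hasDerivAt_sf {N : ℕ} {x y : EN N} {r : ℝ} (hr : 0 < r) :
    HasDerivAt (sf x y) (2 * (r ^ 4 - ‖x‖ ^ 2 * ‖y‖ ^ 2) / (r ^ 3 * ‖x - y‖ ^ 2)) r := by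
  have h : ∀ b : ℝ, HasDerivAt (fun r : ℝ => r - b / r) (1 + b / r ^ 2) r := by
    intro b
    have := (hasDerivAt_id r).sub ((hasDerivAt_inv hr.ne').const_mul b)
    refine (this.congr_deriv ?_)
    field_simp
    ring
  have := ((h (‖x‖ ^ 2)).mul (h (‖y‖ ^ 2))).div_const (‖x - y‖ ^ 2)
  refine this.congr_deriv ?_
  by_cases hd : ‖x - y‖ = 0
  · simp [hd]
  · field_simp; ring

lemma sf_image_Ioo {N : ℕ} {x y : EN N} (hxy : x ≠ y) {R : ℝ} (hR : max ‖x‖ ‖y‖ < R) :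
    sf x y '' Ioo (max ‖x‖ ‖y‖) R = Ioo 0 (sf x y R) := by
  have hm := sf_strictMono hxy
  have hc : ContinuousOn (sf x y) (Icc (max ‖x‖ ‖y‖) R) := fun r hr =>
    (hasDerivAt_sf ((max_norm_pos hxy).trans_le hr.1)).continuousAt.continuousWithinAt
  apply Subset.antisymm
  · rintro _ ⟨r, hr, rfl⟩
    have := hm self_mem_Ici (mem_Ici.2 hr.1.le) hr.1
    rw [sf_max] at this
    exact ⟨this, hm (mem_Ici.2 hr.1.le) (mem_Ici.2 hR.le) hr.2⟩
  · have := intermediate_value_Ioo hR.le hc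
    rwa [sf_max] at this

lemma sf_image_Ioi {N : ℕ} {x y : EN N} (hxy : x ≠ y) :
    sf x y '' Ioi (max ‖x‖ ‖y‖) = Ioi 0 := by
  have hm := sf_strictMono hxy
  apply Subset.antisymm
  · rintro _ ⟨r, hr, rfl⟩
    have hr' : max ‖x‖ ‖y‖ < r := hr
    have := hm self_mem_Ici (mem_Ici.2 hr'.le) hr'
    rw [sf_max] at this
    exact this
  · intro t ht
    have ht : 0 < t := ht
    set ρ := max ‖x‖ ‖y‖
    have hρ : 0 < ρ := max_norm_pos hxy
    have hd : 0 < ‖x - y‖ := norm_pos_iff.2 (sub_ne_zero.2 hxy)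
    set d := ‖x - y‖
    set R := 2 * ρ + 2 * d * (1 + t) with hRd
    have hR0 : 0 < R := by positivity
    have hdt : 0 < d * (1 + t) := by positivity
    have hρR : ρ < R := by linarith
    have key : ∀ b : ℝ, 0 ≤ b → b ≤ ρ → R / 2 ≤ R - b ^ 2 / R := by
      intro b hb hbρ
      have : b ^ 2 / R ≤ R / 2 := by
        rw [div_le_iff₀ hR0]; nlinarith
      linarith
    have hbig : t < sf x y R := by
      unfold sf
      rw [lt_div_iff₀ (by positivity)]
      have h1 := key ‖x‖ (norm_nonneg _) (le_max_left _ _)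
      have h2 := key ‖y‖ (norm_nonneg _) (le_max_right _ _)
      have h3 : (R / 2) * (R / 2) ≤ (R - ‖x‖ ^ 2 / R) * (R - ‖y‖ ^ 2 / R) := by
        apply mul_le_mul h1 h2 (by positivity) (by linarith)
      have h4 : d * (1 + t) ≤ R / 2 := by linarith
      have h5 : (d * (1 + t)) * (d * (1 + t)) ≤ (R / 2) * (R / 2) := by gcongr
      nlinarith [sq_nonneg t, mul_pos hd hd]
    have := sf_image_Ioo hxy hρR
    have ht' : t ∈ Ioo 0 (sf x y R) := ⟨ht, hbig⟩
    rw [← this] at ht'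
    obtain ⟨r, hr, h⟩ := ht'
    exact ⟨r, hr.1, h⟩

lemma lint_M {N : ℕ} (hN : 0 < N) {α : ℝ} {x y : EN N} (hxy : x ≠ y) {T : Set ℝ} (hT : MeasurableSet T) :
    ∫⁻ ζ in {ζ : EN N | ‖ζ‖ ∈ T}, mE α x ζ * mE α y ζ * ENNReal.ofReal (‖ζ‖ ^ (-α)) =
    ENNReal.ofReal (om N / 2 * ‖x - y‖ ^ (α - N)) *
      ∫⁻ s in sf x y '' (T ∩ Ioi (max ‖x‖ ‖y‖)), ENNReal.ofReal (s ^ (α / 2 - 1) * (1 + s) ^ (-(N:ℝ) / 2)) := by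
  have hom := om_nonneg N
  have hd : 0 < ‖x - y‖ := norm_pos_iff.2 (sub_ne_zero.2 hxy)
  set d := ‖x - y‖ with hdd
  set ρ := max ‖x‖ ‖y‖ with hρd
  have hρ : 0 < ρ := max_norm_pos hxy
  have hTm : MeasurableSet {ζ : EN N | ‖ζ‖ ∈ T} := measurable_norm hT
  rw [← lintegral_indicator hTm]
  have hmeas : Measurable (fun ζ : EN N => mE α x ζ * mE α y ζ * ENNReal.ofReal (‖ζ‖ ^ (-α))) :=
    ((measurable_mE_right α x).mul (measurable_mE_right α y)).mul (by fun_prop)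
  rw [lintegral_polar hN (({ζ : EN N | ‖ζ‖ ∈ T}).indicator (fun ζ => mE α x ζ * mE α y ζ * ENNReal.ofReal (‖ζ‖ ^ (-α))))
    (hmeas.indicator hTm)]
  have hpt : ∀ r ∈ Ioi (0:ℝ), ENNReal.ofReal (r ^ (N - 1)) * ∫⁻ σ, ({ζ : EN N | ‖ζ‖ ∈ T}).indicator (fun ζ => mE α x ζ * mE α y ζ * ENNReal.ofReal (‖ζ‖ ^ (-α))) (r • (σ : EN N)) ∂(sM N) =
      (T ∩ Ioi ρ).indicator (fun r => ENNReal.ofReal (om N / 2 * d ^ (α - N)) *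
        (ENNReal.ofReal (2 * (r ^ 4 - ‖x‖ ^ 2 * ‖y‖ ^ 2) / (r ^ 3 * d ^ 2)) *
          ENNReal.ofReal ((sf x y r) ^ (α / 2 - 1) * (1 + sf x y r) ^ (-(N:ℝ) / 2)))) r := by
    intro r hr
    have hr : (0:ℝ) < r := hr
    by_cases h : r ∈ T ∩ Ioi ρ
    · rw [indicator_of_mem h]
      have hrρ : ρ < r := h.2
      have hx : ‖x‖ < r := (le_max_left _ _).trans_lt hrρ
      have hy : ‖y‖ < r := (le_max_right _ _).trans_lt hrρ
      have h1 : 0 < r ^ 2 - ‖x‖ ^ 2 := by nlinarith [norm_nonneg x]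
      have h2 : 0 < r ^ 2 - ‖y‖ ^ 2 := by nlinarith [norm_nonneg y]
      have : ∀ σ : Sph N, ({ζ : EN N | ‖ζ‖ ∈ T}).indicator (fun ζ => mE α x ζ * mE α y ζ * ENNReal.ofReal (‖ζ‖ ^ (-α))) (r • (σ : EN N)) =
        ENNReal.ofReal ((r ^ 2 - ‖x‖ ^ 2) ^ (α / 2) * (r ^ 2 - ‖y‖ ^ 2) ^ (α / 2) * r ^ (-α)) *
        ENNReal.ofReal (‖x - r • (σ : EN N)‖ ^ (-(N:ℝ)) * ‖y - r • (σ : EN N)‖ ^ (-(N:ℝ))) := by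
        intro σ
        have hmem : r • (σ : EN N) ∈ {ζ : EN N | ‖ζ‖ ∈ T} := by
          show ‖r • (σ : EN N)‖ ∈ T
          rw [norm_smul_sph hr]; exact h.1
        rw [indicator_of_mem hmem]
        simp only [mE]
        rw [norm_smul_sph hr, if_pos hx, if_pos hy, ← ENNReal.ofReal_mul (by positivity), ← ENNReal.ofReal_mul (by positivity), ← ENNReal.ofReal_mul (by positivity)]
        congr 1; ring
      simp_rw [this]
      have hL := Lr_pos hx hy
      have hs1 : sf x y r = (r ^ 2 - ‖x‖ ^ 2) * (r ^ 2 - ‖y‖ ^ 2) / (r ^ 2 * d ^ 2) := by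
        unfold sf; rw [← hdd]; field_simp
      have hs2 : 1 + sf x y r = Lr r x y / (r ^ 2 * d ^ 2) := by
        rw [hs1, Lr, ← hdd]; field_simp
      have hs0 : 0 < sf x y r := by rw [hs1]; positivity
      have h4 : 0 < r ^ 4 - ‖x‖ ^ 2 * ‖y‖ ^ 2 := by nlinarith [sq_nonneg ‖x‖, sq_nonneg ‖y‖, sq_nonneg r]
      rw [lintegral_const_mul' _ _ ENNReal.ofReal_ne_top, lint_in hN hx hy, ← ENNReal.ofReal_mul (by positivity),
        ← ENNReal.ofReal_mul (by positivity), ← ENNReal.ofReal_mul (by positivity), ← ENNReal.ofReal_mul (by positivity)]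
      congr 1
      set A := r ^ 2 - ‖x‖ ^ 2
      set B := r ^ 2 - ‖y‖ ^ 2
      set E := r ^ 4 - ‖x‖ ^ 2 * ‖y‖ ^ 2
      set L := Lr r x y
      rw [hs2, hs1, div_rpow (by positivity) (by positivity), div_rpow hL.le (by positivity), mul_rpow h1.le h2.le,
        rpow_sub h1, rpow_sub h2, rpow_one, rpow_one, ← mul_pow, sq_rpow_half (by positivity),
        show α / 2 - 1 = (α - 2) / 2 by ring, sq_rpow_half (by positivity)]
      have e1 : (r * d) ^ (-(N:ℝ)) = r ^ (-(N:ℝ)) * d ^ (-(N:ℝ)) := mul_rpow hr.le hd.le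
      have e2 : (r * d) ^ (α - 2) = r ^ α / r ^ 2 * (d ^ α / d ^ 2) := by
        rw [mul_rpow hr.le hd.le, rpow_sub hr, rpow_sub hd, rpow_two, rpow_two]
      have e3 : r ^ (N - 1) = r ^ (N:ℝ) / r := by
        rw [← rpow_natCast, Nat.cast_sub hN, Nat.cast_one, rpow_sub hr, rpow_one]
      rw [e1, e2, e3, rpow_sub hd, rpow_neg hr.le, rpow_neg hr.le, rpow_neg hd.le]
      have := rpow_pos_of_pos hr α
      have := rpow_pos_of_pos hr (N:ℝ)
      have := rpow_pos_of_pos hd α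
      have := rpow_pos_of_pos hd (N:ℝ)
      field_simp
    · rw [indicator_of_notMem h]
      have : ∀ σ : Sph N, ({ζ : EN N | ‖ζ‖ ∈ T}).indicator (fun ζ => mE α x ζ * mE α y ζ * ENNReal.ofReal (‖ζ‖ ^ (-α))) (r • (σ : EN N)) = 0 := by
        intro σ
        by_cases hrT : r ∈ T
        · have hle : ¬ (‖x‖ < r ∧ ‖y‖ < r) := fun h' => h ⟨hrT, max_lt h'.1 h'.2⟩
          apply indicator_apply_eq_zero.2
          intro _
          simp only [mE]
          rw [norm_smul_sph hr]
          by_cases h3 : ‖x‖ < r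
          · rw [if_neg (fun h4 => hle ⟨h3, h4⟩)]; simp
          · rw [if_neg h3]; simp
        · rw [indicator_of_notMem]
          show ‖r • (σ : EN N)‖ ∉ T
          rwa [norm_smul_sph hr]
      simp [this]
  have hms : MeasurableSet (T ∩ Ioi ρ) := hT.inter measurableSet_Ioi
  rw [setLIntegral_congr_fun measurableSet_Ioi hpt, setLIntegral_indicator hms,
    inter_eq_left.2 (show T ∩ Ioi ρ ⊆ Ioi 0 from fun r hr => hρ.trans hr.2), lintegral_const_mul' _ _ ENNReal.ofReal_ne_top]
  congr 1
  symm
  apply lintegral_image_eq_lintegral_deriv_mul_of_monotoneOn hms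
  · intro r hr
    exact (hasDerivAt_sf (hρ.trans hr.2)).hasDerivWithinAt
  · exact (sf_strictMono hxy).monotoneOn.mono (fun r hr => (mem_Ioi.1 hr.2).le)



lemma om_pos {N : ℕ} (hN : 0 < N) : 0 < om N := by
  rw [om_eq hN]
  have : 0 < (N:ℝ) := by exact_mod_cast hN
  have := Gamma_pos_of_pos (show 0 < (N:ℝ) / 2 by positivity)
  positivity

lemma greenCoeff_pos {N : ℕ} (hN : 0 < N) {α : ℝ} (hα0 : 0 < α) : 0 < greenCoeff N α := by
  unfold greenCoeff
  have : 0 < (N:ℝ) := by exact_mod_cast hN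
  have := Gamma_pos_of_pos (show 0 < (N:ℝ) / 2 by positivity)
  have := Gamma_pos_of_pos (show 0 < α / 2 by positivity)
  positivity

/-- primitive of the Green integrand -/
def Phi (N : ℕ) (α : ℝ) (S : ℝ) : ENNReal :=
  ∫⁻ s in Ioo 0 S, ENNReal.ofReal (s ^ (α / 2 - 1) * (1 + s) ^ (-(N:ℝ) / 2))

lemma Phi_mono (N : ℕ) (α : ℝ) : Monotone (Phi N α) := by
  intro S T h
  exact lintegral_mono_set (Ioo_subset_Ioo_right h)

lemma measurable_Phi (N : ℕ) (α : ℝ) : Measurable (Phi N α) := (Phi_mono N α).measurable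

/-- total mass of the Green integrand -/
def bA (N : ℕ) (α : ℝ) : ℝ := Gamma (α / 2) * Gamma ((N:ℝ) / 2 - α / 2) / Gamma ((N:ℝ) / 2)

lemma bA_pos {N : ℕ} (hN : 3 ≤ N) {α : ℝ} (hα0 : 0 < α) (hα2 : α < 2) : 0 < bA N α := by
  unfold bA
  have : (3:ℝ) ≤ (N:ℝ) := by exact_mod_cast hN
  have := Gamma_pos_of_pos (show 0 < (N:ℝ) / 2 by positivity)
  have := Gamma_pos_of_pos (show 0 < α / 2 by positivity)
  have := Gamma_pos_of_pos (show 0 < (N:ℝ) / 2 - α / 2 by linarith)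
  positivity

lemma Phi_total {N : ℕ} (hN : 3 ≤ N) {α : ℝ} (hα0 : 0 < α) (hα2 : α < 2) :
    ∫⁻ s in Ioi 0, ENNReal.ofReal (s ^ (α / 2 - 1) * (1 + s) ^ (-(N:ℝ) / 2)) = ENNReal.ofReal (bA N α) := by
  have : (3:ℝ) ≤ (N:ℝ) := by exact_mod_cast hN
  have := lintegral_Beta (show 0 < α / 2 by positivity) (show 0 < (N:ℝ) / 2 - α / 2 by linarith)
  rw [show -(α / 2 + ((N:ℝ) / 2 - α / 2)) = -(N:ℝ) / 2 by ring, show (α / 2 + ((N:ℝ) / 2 - α / 2)) = (N:ℝ) / 2 by ring] at this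
  exact this

lemma Phi_le {N : ℕ} (hN : 3 ≤ N) {α : ℝ} (hα0 : 0 < α) (hα2 : α < 2) (S : ℝ) :
    Phi N α S ≤ ENNReal.ofReal (bA N α) := by
  rw [← Phi_total hN hα0 hα2]
  exact lintegral_mono_set Ioo_subset_Ioi_self

lemma Phi_toReal {N : ℕ} (hN : 3 ≤ N) {α : ℝ} (hα0 : 0 < α) (hα2 : α < 2) {S : ℝ} (hS : 0 ≤ S) :
    ∫ s in (0:ℝ)..S, s ^ (α / 2 - 1) * (1 + s) ^ (-(N : ℝ) / 2) = (Phi N α S).toReal := by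
  rw [intervalIntegral.integral_of_le hS, integral_Ioc_eq_integral_Ioo, Phi, integral_eq_lintegral_of_nonneg_ae]
  · filter_upwards [ae_restrict_mem measurableSet_Ioo] with s hs
    have := hs.1
    simp only [Pi.zero_apply]
    positivity
  · exact (by fun_prop : Measurable (fun s : ℝ => s ^ (α / 2 - 1) * (1 + s) ^ (-(N : ℝ) / 2))).aestronglyMeasurable

def GE {N : ℕ} (α : ℝ) (x y : EN N) : ENNReal :=
  if ‖x‖ < 1 ∧ ‖y‖ < 1 then
    ENNReal.ofReal (greenCoeff N α * ‖x - y‖ ^ (α - (N : ℝ))) *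
      Phi N α ((1 - ‖x‖ ^ 2) * (1 - ‖y‖ ^ 2) / ‖x - y‖ ^ 2)
  else 0

lemma measurable_GE {N : ℕ} (α : ℝ) : Measurable (fun p : EN N × EN N => GE α p.1 p.2) := by
  unfold GE
  apply Measurable.ite
  · have h1 : MeasurableSet {p : EN N × EN N | ‖p.1‖ < 1} := measurableSet_lt (by fun_prop) (by fun_prop)
    have h2 : MeasurableSet {p : EN N × EN N | ‖p.2‖ < 1} := measurableSet_lt (by fun_prop) (by fun_prop)
    exact h1.inter h2
  · apply Measurable.mul (by fun_prop)
    exact (measurable_Phi N α).comp (by fun_prop)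
  · fun_prop

lemma measurable_GE_right {N : ℕ} (α : ℝ) (x : EN N) : Measurable (fun y : EN N => GE α x y) := by
  unfold GE
  apply Measurable.ite
  · have h1 : MeasurableSet {p : EN N | ‖x‖ < 1} := measurableSet_lt (by fun_prop) (by fun_prop)
    have h2 : MeasurableSet {p : EN N | ‖p‖ < 1} := measurableSet_lt (by fun_prop) (by fun_prop)
    exact h1.inter h2
  · apply Measurable.mul (by fun_prop)
    exact (measurable_Phi N α).comp (by fun_prop)
  · fun_prop

def RK {N : ℕ} (α : ℝ) (x y : EN N) : ℝ := greenCoeff N α * bA N α * ‖x - y‖ ^ (α - (N : ℝ))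

def RE {N : ℕ} (α : ℝ) (x y : EN N) : ENNReal := ENNReal.ofReal (RK α x y)

lemma measurable_RE {N : ℕ} (α : ℝ) : Measurable (fun p : EN N × EN N => RE α p.1 p.2) := by
  unfold RE RK
  fun_prop

lemma RK_nonneg {N : ℕ} (hN : 3 ≤ N) {α : ℝ} (hα0 : 0 < α) (hα2 : α < 2) (x y : EN N) : 0 ≤ RK α x y := by
  have := bA_pos hN hα0 hα2
  have := greenCoeff_pos (show 0 < N by omega) hα0
  unfold RK; positivity

lemma RK_symm {N : ℕ} {α : ℝ} (x y : EN N) : RK α x y = RK α y x := by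
  unfold RK; rw [norm_sub_rev]

lemma GE_symm {N : ℕ} {α : ℝ} (x y : EN N) : GE α x y = GE α y x := by
  unfold GE; simp only [norm_sub_rev x y, mul_comm (1 - ‖x‖ ^ 2), and_comm (a := ‖x‖ < 1)]

lemma GE_le_RE {N : ℕ} (hN : 3 ≤ N) {α : ℝ} (hα0 : 0 < α) (hα2 : α < 2) (x y : EN N) :
    GE α x y ≤ RE α x y := by
  unfold GE RE RK
  have := bA_pos hN hα0 hα2
  have := greenCoeff_pos (show 0 < N by omega) hα0
  split_ifs
  · rw [mul_right_comm, ENNReal.ofReal_mul (q := bA N α) (by positivity)]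
    exact mul_le_mul_right (Phi_le hN hα0 hα2 _) _
  · exact zero_le

lemma greenB_eq {N : ℕ} (hN : 3 ≤ N) {α : ℝ} (hα0 : 0 < α) (hα2 : α < 2) (x y : EN N) :
    greenB N α x y = (GE α x y).toReal := by
  have := greenCoeff_pos (show 0 < N by omega) hα0
  unfold greenB GE
  split_ifs with h
  · have h1 : 0 ≤ 1 - ‖x‖ ^ 2 := by nlinarith [norm_nonneg x]
    have h2 : 0 ≤ 1 - ‖y‖ ^ 2 := by nlinarith [norm_nonneg y]
    rw [Phi_toReal hN hα0 hα2 (by positivity), ENNReal.toReal_mul, ENNReal.toReal_ofReal (by positivity)]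
  · simp

lemma GE_ne_top {N : ℕ} (hN : 3 ≤ N) {α : ℝ} (hα0 : 0 < α) (hα2 : α < 2) (x y : EN N) : GE α x y ≠ ⊤ :=
  ne_top_of_le_ne_top ENNReal.ofReal_ne_top (GE_le_RE hN hα0 hα2 x y)

lemma ofReal_greenB {N : ℕ} (hN : 3 ≤ N) {α : ℝ} (hα0 : 0 < α) (hα2 : α < 2) (x y : EN N) :
    ENNReal.ofReal (greenB N α x y) = GE α x y := by
  rw [greenB_eq hN hα0 hα2, ENNReal.ofReal_toReal (GE_ne_top hN hα0 hα2 x y)]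

def wE {N : ℕ} (α : ℝ) (x y ζ : EN N) : ENNReal := mE α x ζ * mE α y ζ * ENNReal.ofReal (‖ζ‖ ^ (-α))

lemma measurable_wE {N : ℕ} (α : ℝ) (x y : EN N) : Measurable (wE α x y) := by
  unfold wE
  exact ((measurable_mE_right α x).mul (measurable_mE_right α y)).mul (by fun_prop)

lemma RE_rep {N : ℕ} (hN : 3 ≤ N) {α : ℝ} (hα0 : 0 < α) (hα2 : α < 2) {x y : EN N} (hxy : x ≠ y) :
    RE α x y = ENNReal.ofReal (2 * greenCoeff N α / om N) * ∫⁻ ζ, wE α x y ζ := by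
  have hω := om_pos (show 0 < N by omega)
  have hκ := greenCoeff_pos (show 0 < N by omega) hα0
  have hb := bA_pos hN hα0 hα2
  have := lint_M (show 0 < N by omega) (α := α) hxy MeasurableSet.univ
  rw [univ_inter, sf_image_Ioi hxy, Phi_total hN hα0 hα2] at this
  simp only [mem_univ, Set.ofPred_true, Measure.restrict_univ] at this
  unfold wE
  rw [this, RE, RK, ← ENNReal.ofReal_mul (by positivity), ← ENNReal.ofReal_mul (by positivity)]
  congr 1
  field_simp

lemma GE_rep {N : ℕ} (hN : 3 ≤ N) {α : ℝ} (hα0 : 0 < α) {x y : EN N} (hxy : x ≠ y) :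
    (if ‖x‖ < 1 then GE α x y else 0) = ENNReal.ofReal (2 * greenCoeff N α / om N) * ∫⁻ ζ in {ζ : EN N | ‖ζ‖ ∈ Iio 1}, wE α x y ζ := by
  have hω := om_pos (show 0 < N by omega)
  have hκ := greenCoeff_pos (show 0 < N by omega) hα0
  by_cases h : ‖x‖ < 1 ∧ ‖y‖ < 1
  · rw [if_pos h.1, GE, if_pos h]
    have := lint_M (show 0 < N by omega) (α := α) hxy (measurableSet_Iio (a := (1:ℝ)))
    rw [Iio_inter_Ioi, sf_image_Ioo hxy (max_lt h.1 h.2)] at this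
    unfold wE
    rw [this, ← mul_assoc, ← ENNReal.ofReal_mul (by positivity)]
    congr 1
    · congr 1; field_simp
    · unfold Phi sf; simp
  · have h0 : (if ‖x‖ < 1 then GE α x y else 0) = 0 := by
      unfold GE; rw [if_neg h]; simp
    rw [h0, setLIntegral_congr_fun (g := fun _ => 0)]
    · simp
    · exact measurable_norm measurableSet_Iio
    · intro ζ hζ
      have hζ : ‖ζ‖ < 1 := hζ
      unfold wE mE
      by_cases h1 : ‖x‖ < ‖ζ‖
      · have : ¬ ‖y‖ < ‖ζ‖ := fun h2 => h ⟨h1.trans hζ, h2.trans hζ⟩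
        simp [this]
      · simp [h1]

lemma norm_one_ae (N : ℕ) (hN : 0 < N) : ∀ᵐ ζ : EN N, ‖ζ‖ ≠ 1 := by
  have : Nonempty (Fin N) := ⟨⟨0, hN⟩⟩
  have h : volume (sphere (0 : EN N) 1) = 0 := Measure.addHaar_sphere _ _ _
  rw [ae_iff]
  convert h using 2
  ext ζ; simp

/-- sweeping identity -/
lemma sweep {N : ℕ} (hN : 3 ≤ N) {α : ℝ} (hα0 : 0 < α) (hα2 : α < 2) {x z : EN N} (hx : ‖x‖ < 1) (hxz : x ≠ z) :
    RE α x z = GE α x z + ∫⁻ y, KE α x y * RE α y z := by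
  have hN0 : 0 < N := by omega
  have : Nonempty (Fin N) := ⟨⟨0, hN0⟩⟩
  set C := ENNReal.ofReal (2 * greenCoeff N α / om N) with hC
  have h1 : ∫⁻ y, KE α x y * RE α y z = C * ∫⁻ ζ in {ζ : EN N | ‖ζ‖ ∈ Iio 1}ᶜ, wE α x z ζ := by
    have e1 : ∫⁻ y, KE α x y * RE α y z = ∫⁻ y, C * ∫⁻ ζ, KE α x y * wE α y z ζ := by
      apply lintegral_congr_ae
      have : ∀ᵐ y : EN N, y ≠ z := by simp [ae_iff]
      filter_upwards [this] with y hy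
      rw [RE_rep hN hα0 hα2 hy, lintegral_const_mul _ (measurable_wE α y z), ← hC]
      ring
    rw [e1, lintegral_const_mul' _ _ ENNReal.ofReal_ne_top]
    congr 1
    rw [lintegral_lintegral_swap]
    · have hms : MeasurableSet {ζ : EN N | ‖ζ‖ ∈ Iio 1} := measurable_norm measurableSet_Iio
      rw [← lintegral_indicator hms.compl]
      apply lintegral_congr_ae
      filter_upwards [norm_one_ae N hN0] with ζ hζ
      have e2 : ∀ y, KE α x y * wE α y z ζ = (KE α x y * mE α y ζ) * (mE α z ζ * ENNReal.ofReal (‖ζ‖ ^ (-α))) := by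
        intro y; unfold wE; ring
      simp_rw [e2]
      have hme : Measurable (fun y => KE α x y * mE α y ζ) := (measurable_KE_right α x).mul (measurable_mE_left α ζ)
      rw [lintegral_mul_const _ hme]
      rcases lt_or_gt_of_ne hζ with h | h
      · rw [indicator_of_notMem (by simpa using h)]
        have : ∀ y, KE α x y * mE α y ζ = 0 := by
          intro y
          unfold KE mE
          by_cases hy : 1 < ‖y‖
          · rw [if_neg (show ¬ ‖y‖ < ‖ζ‖ by linarith)]; simp
          · rw [if_neg hy]; simp
        simp [this]
      · rw [lint_KE_mE hN0 hα0 hα2 hx h, indicator_of_mem (by simpa using h.le)]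
        unfold wE; ring
    · apply Measurable.aemeasurable
      unfold wE
      have a1 := measurable_KE_right (N := N) α x
      have a2 := measurable_mE (N := N) α
      have a3 := measurable_mE_right (N := N) α z
      unfold Function.uncurry
      exact (a1.comp measurable_fst).mul ((a2.mul (a3.comp measurable_snd)).mul (by fun_prop))
  have hms : MeasurableSet {ζ : EN N | ‖ζ‖ ∈ Iio 1} := measurable_norm measurableSet_Iio
  rw [h1, RE_rep hN hα0 hα2 hxz, ← lintegral_add_compl (wE α x z) hms, mul_add, ← GE_rep hN hα0 hxz, if_pos hx]



lemma lint_rpow {α R : ℝ} (hα : 0 < α) (hR : 0 ≤ R) :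
    ∫⁻ r in Ioo 0 R, ENNReal.ofReal (r ^ (α - 1)) = ENNReal.ofReal (R ^ α / α) := by
  have h := integral_rpow (a := 0) (b := R) (r := α - 1) (Or.inl (by linarith))
  have hi : IntervalIntegrable (fun r : ℝ => r ^ (α - 1)) volume 0 R :=
    intervalIntegral.intervalIntegrable_rpow' (by linarith)
  rw [intervalIntegrable_iff_integrableOn_Ioo_of_le hR] at hi
  rw [← ofReal_integral_eq_lintegral_ofReal hi, ← integral_Ioc_eq_integral_Ioo, ← intervalIntegral.integral_of_le hR, h]
  · simp [hα.ne']
  · filter_upwards [ae_restrict_mem measurableSet_Ioo] with s hs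
    have := hs.1
    simp only [Pi.zero_apply]
    positivity

lemma fracLapCoeff_pos {N : ℕ} (hN : 0 < N) {α : ℝ} (hα0 : 0 < α) (hα2 : α < 2) : 0 < fracLapCoeff N α := by
  unfold fracLapCoeff
  have h1 : 0 < Gamma (((N:ℝ) + α) / 2) := Gamma_pos_of_pos (by positivity)
  have h2 : Gamma (-α / 2) ≠ 0 := by
    apply Gamma_ne_zero
    intro m hm
    rcases Nat.eq_zero_or_pos m with h | h
    · simp [h] at hm; linarith
    · have : (1:ℝ) ≤ m := by exact_mod_cast h
      linarith
  have := abs_pos.2 h2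
  positivity

/-- expected exit time constant -/
def b0 (N : ℕ) (α : ℝ) : ℝ := fracLapCoeff N α / poissonCoeff N α

lemma b0_pos {N : ℕ} (hN : 0 < N) {α : ℝ} (hα0 : 0 < α) (hα2 : α < 2) : 0 < b0 N α :=
  div_pos (fracLapCoeff_pos hN hα0 hα2) (poissonCoeff_pos hN hα0 hα2)

lemma b0_inv {N : ℕ} (hN : 0 < N) {α : ℝ} (hα0 : 0 < α) (hα2 : α < 2) :
    greenCoeff N α * om N / α * (Gamma (α / 2) * Gamma ((N:ℝ) / 2) / Gamma (α / 2 + (N:ℝ) / 2)) = (b0 N α)⁻¹ := by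
  unfold b0
  have hN' : (0:ℝ) < N := by exact_mod_cast hN
  have g1 := Gamma_pos_of_pos (show 0 < (N:ℝ) / 2 by positivity)
  have g2 := Gamma_pos_of_pos (show 0 < α / 2 by positivity)
  have g3 := Gamma_pos_of_pos (show 0 < 1 - α / 2 by linarith)
  have g4 := Gamma_pos_of_pos (show 0 < α / 2 + (N:ℝ) / 2 by positivity)
  have hs : 0 < sin (π * α / 2) := sin_pos_of_pos_of_lt_pi (by positivity) (by nlinarith [pi_pos])
  have hr := Gamma_mul_Gamma_one_sub (α / 2)
  rw [show π * (α / 2) = π * α / 2 by ring] at hr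
  have hg : Gamma (1 - α / 2) = (-α / 2) * Gamma (-α / 2) := by
    rw [← Gamma_add_one (by linarith)]; congr 1; ring
  have habs : |Gamma (-α / 2)| = Gamma (1 - α / 2) * 2 / α := by
    have hneg : Gamma (-α / 2) < 0 := by
      by_contra h
      push Not at h
      nlinarith
    rw [abs_of_neg hneg, hg]; field_simp
  rw [fracLapCoeff, poissonCoeff, greenCoeff, om_eq hN, habs, show ((N:ℝ) + α) / 2 = α / 2 + N / 2 by ring,
    show -1 - (N:ℝ)/2 = -1 + -((N:ℝ)/2) by ring, show -(N:ℝ)/2 = -((N:ℝ)/2) by ring,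
    rpow_add pi_pos, rpow_neg_one, rpow_neg pi_pos.le]
  have := rpow_pos_of_pos pi_pos ((N:ℝ)/2)
  have := rpow_pos_of_pos (show (0:ℝ) < 2 by norm_num) α
  have hπ := pi_pos
  rw [eq_div_iff hs.ne'] at hr
  generalize Gamma (1 - α / 2) = A1 at *
  generalize sin (π * α / 2) = A2 at *
  generalize Gamma (α / 2) = A3 at *
  field_simp
  linear_combination -hr

lemma lint_G0 {N : ℕ} (hN : 3 ≤ N) {α : ℝ} (hα0 : 0 < α) (hα2 : α < 2) :
    ∫⁻ z : EN N, GE α 0 z = ENNReal.ofReal (b0 N α)⁻¹ := by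
  have hN0 : 0 < N := by omega
  have hκ := greenCoeff_pos hN0 hα0
  have hω := om_pos hN0
  set g : ℝ → ENNReal := fun s => ENNReal.ofReal (s ^ (α / 2 - 1) * (1 + s) ^ (-(N:ℝ) / 2)) with hg
  have hgm : Measurable g := by fun_prop
  rw [lintegral_polar hN0 (fun z => GE α 0 z) (measurable_GE_right α 0)]
  have h1 : ∀ r ∈ Ioi (0:ℝ), ENNReal.ofReal (r ^ (N - 1)) * ∫⁻ σ, GE α 0 (r • (σ : EN N)) ∂(sM N) =
      ∫⁻ s in Ioi 0, ENNReal.ofReal (greenCoeff N α * om N) * (ENNReal.ofReal (r ^ (α - 1)) * (if s < (1 - r ^ 2) / r ^ 2 then g s else 0)) := by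
    intro r hr
    have hr : 0 < r := hr
    have e1 : ∀ σ : Sph N, GE α 0 (r • (σ : EN N)) = ENNReal.ofReal (greenCoeff N α * r ^ (α - N)) * Phi N α ((1 - r ^ 2) / r ^ 2) := by
      intro σ
      unfold GE
      rw [norm_smul_sph hr, zero_sub, norm_neg, norm_smul_sph hr]
      split_ifs with h
      · simp
      · have : 1 ≤ r := by simpa using h
        have h0 : (1 - r ^ 2) / r ^ 2 ≤ 0 := div_nonpos_of_nonpos_of_nonneg (by nlinarith) (by positivity)
        rw [Phi, Ioo_eq_empty (by linarith)]; simp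
    simp_rw [e1]
    rw [lintegral_const, lintegral_const_mul' _ _ ENNReal.ofReal_ne_top, lintegral_const_mul' _ _ ENNReal.ofReal_ne_top]
    have e2 : Phi N α ((1 - r ^ 2) / r ^ 2) = ∫⁻ s in Ioi 0, (if s < (1 - r ^ 2) / r ^ 2 then g s else 0) := by
      have : (fun s => if s < (1 - r ^ 2) / r ^ 2 then g s else 0) = (Iio ((1 - r ^ 2) / r ^ 2)).indicator g := by
        ext s; simp [indicator]
      rw [this, setLIntegral_indicator measurableSet_Iio, Phi, Iio_inter_Ioi]
    rw [← e2]
    have e3 : (sM N) univ = ENNReal.ofReal (om N) := by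
      rw [om, ofReal_measureReal]
    rw [e3, ← pow_mul_rpow_aux hN0 hr, ENNReal.ofReal_mul hκ.le, ENNReal.ofReal_mul hκ.le, ENNReal.ofReal_mul (by positivity)]
    ring
  rw [setLIntegral_congr_fun measurableSet_Ioi h1, lintegral_lintegral_swap]
  · have h2 : ∀ s ∈ Ioi (0:ℝ), ∫⁻ r in Ioi 0, ENNReal.ofReal (greenCoeff N α * om N) * (ENNReal.ofReal (r ^ (α - 1)) * (if s < (1 - r ^ 2) / r ^ 2 then g s else 0)) =
        ENNReal.ofReal (greenCoeff N α * om N / α) * ENNReal.ofReal (s ^ (α / 2 - 1) * (1 + s) ^ (-(α / 2 + (N:ℝ) / 2))) := by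
      intro s hs
      have hs : 0 < s := hs
      rw [lintegral_const_mul' _ _ ENNReal.ofReal_ne_top]
      have e1 : ∀ r ∈ Ioi (0:ℝ), (ENNReal.ofReal (r ^ (α - 1)) * (if s < (1 - r ^ 2) / r ^ 2 then g s else 0)) =
          (Iio ((1 + s) ^ (-(1/2) : ℝ))).indicator (fun r => g s * ENNReal.ofReal (r ^ (α - 1))) r := by
        intro r hr
        have hr : 0 < r := hr
        have hiff : s < (1 - r ^ 2) / r ^ 2 ↔ r < (1 + s) ^ (-(1/2) : ℝ) := by
          have hp : 0 < (1 + s) ^ (-(1/2) : ℝ) := by positivity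
          have hq : ((1 + s) ^ (-(1/2) : ℝ)) ^ 2 = (1 + s)⁻¹ := by
            rw [← rpow_natCast, ← rpow_mul (by positivity)]; norm_num [rpow_neg_one]
          rw [lt_div_iff₀ (by positivity), ← pow_lt_pow_iff_left₀ hr.le hp.le two_ne_zero, hq, ← one_div, lt_div_iff₀ (by positivity)]
          constructor <;> intro h <;> linarith
        by_cases h : s < (1 - r ^ 2) / r ^ 2
        · rw [if_pos h, indicator_of_mem (mem_Iio.2 (hiff.1 h)), mul_comm]
        · rw [if_neg h, indicator_of_notMem (fun h' => h (hiff.2 (mem_Iio.1 h'))), mul_zero]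
      rw [setLIntegral_congr_fun measurableSet_Ioi e1, setLIntegral_indicator measurableSet_Iio, Iio_inter_Ioi,
        lintegral_const_mul' _ _ ENNReal.ofReal_ne_top, lint_rpow hα0 (by positivity)]
      rw [← ENNReal.ofReal_mul (by positivity), ← ENNReal.ofReal_mul (by positivity), ← ENNReal.ofReal_mul (by positivity)]
      congr 1
      rw [← rpow_mul (by positivity), show -(α / 2 + (N:ℝ) / 2) = -(N:ℝ) / 2 + -(1/2) * α by ring, rpow_add (by positivity)]
      ring
    rw [setLIntegral_congr_fun measurableSet_Ioi h2, lintegral_const_mul' _ _ ENNReal.ofReal_ne_top,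
      lintegral_Beta (by positivity) (by positivity), ← ENNReal.ofReal_mul (by positivity), b0_inv hN0 hα0 hα2]
  · apply Measurable.aemeasurable
    unfold Function.uncurry
    apply Measurable.const_mul
    apply Measurable.mul (by fun_prop)
    apply Measurable.ite
    · exact measurableSet_lt (by fun_prop) (by fun_prop)
    · exact hgm.comp measurable_snd
    · fun_prop



/-- symmetric second difference -/
def sd {N : ℕ} (φ : EN N → ℝ) (z h : EN N) : ℝ := φ (z + h) + φ (z - h) - 2 * φ z

structure TF {N : ℕ} (φ : EN N → ℝ) (C R : ℝ) : Prop where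
  hC : 0 < C
  hR : 1 ≤ R
  cont : Continuous φ
  bd : ∀ z, |φ z| ≤ C
  sd_le : ∀ z h, |sd φ z h| ≤ C * min (‖h‖ ^ 2) 1
  supp : ∀ z, R < ‖z‖ → φ z = 0

lemma exists_TF {N : ℕ} {φ : EN N → ℝ} (hφ : ContDiff ℝ (⊤ : ℕ∞) φ) (hc : HasCompactSupport φ) :
    ∃ C R, TF φ C R := by
  obtain ⟨M, hM⟩ := hc.exists_bound_of_continuous hφ.continuous
  obtain ⟨R, hR⟩ := hc.isBounded.subset_closedBall (0 : EN N)
  have hd : ContDiff ℝ 1 (fderiv ℝ φ) := (contDiff_infty.1 hφ 2).fderiv_right (by norm_num)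
  have hdc : HasCompactSupport (fderiv ℝ φ) := hc.fderiv (𝕜 := ℝ)
  obtain ⟨L, hL⟩ := hd.lipschitzWith_of_hasCompactSupport hdc one_ne_zero
  have hM0 : 0 ≤ M := (norm_nonneg _).trans (hM 0)
  refine ⟨4 * M + 2 * L + 1, max R 1, by positivity, le_max_right _ _, hφ.continuous, fun z => ?_, fun z h => ?_, fun z hz => ?_⟩
  · have := hM z
    rw [norm_eq_abs] at this
    have : 0 ≤ (L:ℝ) := L.2
    linarith
  · have b1 : |sd φ z h| ≤ 4 * M := by
      unfold sd
      have h1 := abs_le.1 ((norm_eq_abs (φ (z + h))) ▸ hM (z + h))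
      have h2 := abs_le.1 ((norm_eq_abs (φ (z - h))) ▸ hM (z - h))
      have h3 := abs_le.1 ((norm_eq_abs (φ z)) ▸ hM z)
      rw [abs_le]; constructor <;> linarith
    have b2 : |sd φ z h| ≤ 2 * L * ‖h‖ ^ 2 := by
      set g : ℝ → ℝ := fun t => φ (z + t • h) + φ (z - t • h) - 2 * φ z
      have hg : ∀ t, HasDerivAt g (fderiv ℝ φ (z + t • h) h + fderiv ℝ φ (z - t • h) (-h)) t := by
        intro t
        have hφd : ∀ w, HasFDerivAt φ (fderiv ℝ φ w) w := fun w => (hφ.differentiable (by simp) w).hasFDerivAt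
        have l1 : HasDerivAt (fun t : ℝ => z + t • h) h t := by
          simpa using ((hasDerivAt_id t).smul_const h).const_add z
        have l2 : HasDerivAt (fun t : ℝ => z - t • h) (-h) t := by
          simpa using ((hasDerivAt_id t).smul_const h).const_sub z
        have := ((hφd _).comp_hasDerivAt t l1).add ((hφd _).comp_hasDerivAt t l2)
        exact this.sub_const (2 * φ z)
      have hb : ∀ t ∈ Ico (0:ℝ) 1, ‖fderiv ℝ φ (z + t • h) h + fderiv ℝ φ (z - t • h) (-h)‖ ≤ 2 * L * ‖h‖ ^ 2 := by
        intro t ht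
        have : fderiv ℝ φ (z + t • h) h + fderiv ℝ φ (z - t • h) (-h) = (fderiv ℝ φ (z + t • h) - fderiv ℝ φ (z - t • h)) h := by
          simp [sub_eq_add_neg]
        rw [this]
        refine (ContinuousLinearMap.le_opNorm _ _).trans ?_
        have h1 := hL.dist_le_mul (z + t • h) (z - t • h)
        rw [dist_eq_norm, dist_eq_norm] at h1
        have h2 : ‖z + t • h - (z - t • h)‖ ≤ 2 * ‖h‖ := by
          have : z + t • h - (z - t • h) = (2 * t) • h := by rw [mul_smul, two_smul]; abel
          rw [this, norm_smul, Real.norm_of_nonneg (by linarith [ht.1])]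
          gcongr
          linarith [ht.2]
        calc _ ≤ (L * (2 * ‖h‖)) * ‖h‖ := by
              gcongr; exact h1.trans (by gcongr)
          _ = _ := by ring
      have := norm_image_sub_le_of_norm_deriv_le_segment_01' (f := g) (fun t _ => (hg t).hasDerivWithinAt) hb
      have e1 : g 1 - g 0 = sd φ z h := by simp [g, sd]; ring
      rwa [e1, norm_eq_abs] at this
    have : 0 ≤ (L:ℝ) := L.2
    rcases le_total (‖h‖ ^ 2) 1 with h1 | h1
    · rw [min_eq_left h1]
      refine b2.trans ?_
      gcongr; linarith
    · rw [min_eq_right h1]; linarith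
  · by_contra h
    have := hR (subset_tsupport _ h)
    rw [mem_closedBall, dist_zero_right] at this
    exact absurd hz (not_lt.2 (this.trans (le_max_left _ _)))

lemma TF.continuous_sd {N : ℕ} {φ : EN N → ℝ} {C R : ℝ} (h : TF φ C R) (z : EN N) : Continuous (sd φ z) := by
  unfold sd
  have := h.cont
  fun_prop

lemma integrable_Kw {N : ℕ} (hN : 0 < N) {α : ℝ} (hα0 : 0 < α) (hα2 : α < 2) :
    Integrable (fun h : EN N => ‖h‖ ^ (-((N:ℝ) + α)) * min (‖h‖ ^ 2) 1) := by
  have : Nonempty (Fin N) := ⟨⟨0, hN⟩⟩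
  have key : IntegrableOn (fun r : ℝ => r ^ (-1 - α) * min (r ^ 2) 1) (Ioi 0) := by
    rw [← Ioc_union_Ioi_eq_Ioi (zero_le_one (α := ℝ))]
    apply IntegrableOn.union
    · have hi : IntervalIntegrable (fun r : ℝ => r ^ (1 - α)) volume 0 1 :=
        intervalIntegral.intervalIntegrable_rpow' (by linarith)
      rw [intervalIntegrable_iff_integrableOn_Ioc_of_le zero_le_one] at hi
      apply hi.congr_fun _ measurableSet_Ioc
      intro r hr
      have h0 := hr.1
      simp only
      rw [min_eq_left (by nlinarith [hr.2]), ← rpow_natCast, ← rpow_add h0]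
      congr 1; push_cast; ring
    · have hi := integrableOn_Ioi_rpow_of_lt (show -1 - α < -1 by linarith) (zero_lt_one)
      apply hi.congr_fun _ measurableSet_Ioi
      intro r hr
      have h0 : 1 < r := hr
      simp only
      rw [min_eq_right (by nlinarith), mul_one]
  have := (integrable_fun_norm_addHaar (volume : Measure (EN N)) (f := fun r : ℝ => r ^ (-((N:ℝ) + α)) * min (r ^ 2) 1)).2
  apply this
  apply key.congr_fun _ measurableSet_Ioi
  intro r hr
  have h0 : 0 < r := hr
  simp only [finrank_euclideanSpace, Fintype.card_fin, smul_eq_mul]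
  rw [← mul_assoc, show -((N:ℝ) + α) = -α - N by ring, pow_mul_rpow_aux hN h0]
  ring_nf

lemma TF.integrable_sd {N : ℕ} (hN : 0 < N) {α : ℝ} (hα0 : 0 < α) (hα2 : α < 2) {φ : EN N → ℝ} {C R : ℝ} (h : TF φ C R) (z : EN N) :
    Integrable (fun k : EN N => ‖k‖ ^ (-((N:ℝ) + α)) * sd φ z k) := by
  apply ((integrable_Kw hN hα0 hα2).const_mul C).mono'
  · exact (Measurable.mul (by fun_prop) (h.continuous_sd z).measurable).aestronglyMeasurable
  · filter_upwards with k
    rw [norm_mul, Real.norm_of_nonneg (by positivity), norm_eq_abs]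
    have := h.sd_le z k
    calc _ ≤ ‖k‖ ^ (-((N:ℝ) + α)) * (C * min (‖k‖ ^ 2) 1) := by gcongr
      _ = _ := by ring

lemma TF.hasCompactSupport {N : ℕ} {φ : EN N → ℝ} {C R : ℝ} (h : TF φ C R) : HasCompactSupport φ :=
  HasCompactSupport.intro (isCompact_closedBall (0 : EN N) R) (fun x hx => h.supp x (by simpa using hx))

lemma TF.integrable {N : ℕ} {φ : EN N → ℝ} {C R : ℝ} (h : TF φ C R) : Integrable φ :=
  h.cont.integrable_of_hasCompactSupport h.hasCompactSupport

lemma TF.decay {N : ℕ} (hN : 0 < N) {α : ℝ} (hα0 : 0 < α) (hα2 : α < 2) {φ : EN N → ℝ} {C R : ℝ} (h : TF φ C R) :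
    ∃ D, 0 ≤ D ∧ ∀ z, ∫ k : EN N, ‖k‖ ^ (-((N:ℝ) + α)) * |sd φ z k| ≤ D * (1 + ‖z‖) ^ (-((N:ℝ) + α)) := by
  set p := (N:ℝ) + α with hp
  have hp0 : 0 < p := by positivity
  set I := ∫ h : EN N, ‖h‖ ^ (-p) * min (‖h‖ ^ 2) 1 with hI
  have hI0 : 0 ≤ I := integral_nonneg (fun k => by positivity)
  set J := ∫ k, |φ k| with hJ
  have hJ0 : 0 ≤ J := integral_nonneg (fun k => by positivity)
  have hC := h.hC
  have hR := h.hR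
  have hintg : ∀ z, Integrable (fun k : EN N => ‖k‖ ^ (-p) * |sd φ z k|) := by
    intro z
    apply (h.integrable_sd hN hα0 hα2 z).abs.congr
    filter_upwards with k
    rw [abs_mul, abs_of_nonneg (by positivity)]
  refine ⟨C * I * (1 + 2 * R) ^ p + 4 ^ p * (2 * J), by positivity, fun z => ?_⟩
  rw [add_mul]
  have t1 : 0 ≤ C * I * (1 + 2 * R) ^ p * (1 + ‖z‖) ^ (-p) := by positivity
  have t2 : 0 ≤ 4 ^ p * (2 * J) * (1 + ‖z‖) ^ (-p) := by positivity
  rcases le_or_gt ‖z‖ (2 * R) with hz | hz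
  · have : ∫ k : EN N, ‖k‖ ^ (-p) * |sd φ z k| ≤ C * I := by
      rw [hI, ← integral_const_mul]
      apply integral_mono (hintg z) ((integrable_Kw hN hα0 hα2).const_mul C)
      intro k
      have := h.sd_le z k
      calc _ ≤ ‖k‖ ^ (-p) * (C * min (‖k‖ ^ 2) 1) := by simp only; gcongr
        _ = _ := by simp only; ring
    have h3 : 1 ≤ (1 + 2 * R) ^ p * (1 + ‖z‖) ^ (-p) := by
      rw [rpow_neg (by positivity), ← div_eq_mul_inv, one_le_div (by positivity)]
      gcongr
    have : C * I ≤ C * I * ((1 + 2 * R) ^ p * (1 + ‖z‖) ^ (-p)) := le_mul_of_one_le_right (by positivity) h3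
    linarith
  · have hz0 : 0 < ‖z‖ := by linarith
    have hφz : φ z = 0 := h.supp z (by linarith)
    have i1 : Integrable (fun k => |φ (z + k)|) := h.integrable.abs.comp_add_left z
    have i2 : Integrable (fun k => |φ (z - k)|) := h.integrable.abs.comp_sub_left z
    have : ∫ k : EN N, ‖k‖ ^ (-p) * |sd φ z k| ≤ ∫ k, (‖z‖ / 2) ^ (-p) * (|φ (z + k)| + |φ (z - k)|) := by
      apply integral_mono (hintg z) ((i1.add i2).const_mul _)
      intro k
      simp only
      have e1 : |sd φ z k| ≤ |φ (z + k)| + |φ (z - k)| := by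
        unfold sd; rw [hφz, mul_zero, sub_zero]; exact abs_add_le _ _
      rcases lt_or_ge ‖k‖ (‖z‖ / 2) with hk | hk
      · have a1 : φ (z + k) = 0 := h.supp _ (by
          have := norm_sub_le (z + k) k
          rw [add_sub_cancel_right] at this; linarith)
        have a2 : φ (z - k) = 0 := h.supp _ (by
          have := norm_add_le (z - k) k
          rw [sub_add_cancel] at this; linarith)
        unfold sd
        simp [a1, a2, hφz]
      · calc _ ≤ (‖z‖ / 2) ^ (-p) * |sd φ z k| := by
              apply mul_le_mul_of_nonneg_right _ (abs_nonneg _)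
              exact rpow_le_rpow_of_nonpos (by positivity) hk (by linarith)
          _ ≤ _ := mul_le_mul_of_nonneg_left e1 (by positivity)
    rw [integral_const_mul, integral_add i1 i2, integral_add_left_eq_self (fun k => |φ k|) z,
      integral_sub_left_eq_self (fun k => |φ k|) _ z, ← hJ] at this
    have h4 : (‖z‖ / 2) ^ (-p) ≤ 4 ^ p * (1 + ‖z‖) ^ (-p) := by
      have : ((1 + ‖z‖) / 4) ^ (-p) = 4 ^ p * (1 + ‖z‖) ^ (-p) := by
        rw [div_rpow (by positivity) (by norm_num), rpow_neg (by norm_num : (0:ℝ) ≤ 4)]; field_simp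
      rw [← this]
      exact rpow_le_rpow_of_nonpos (by positivity) (by linarith) (by linarith)
    have : (‖z‖ / 2) ^ (-p) * (J + J) ≤ 4 ^ p * (1 + ‖z‖) ^ (-p) * (J + J) := by gcongr
    linarith



lemma lint_smul {N : ℕ} {ε : ℝ} (hε : 0 < ε) (F : EN N → ENNReal) (hF : Measurable F) :
    ∫⁻ y, F (ε • y) = ENNReal.ofReal (ε ^ (-(N:ℝ))) * ∫⁻ h, F h := by
  have h1 := Measure.map_addHaar_smul (volume : Measure (EN N)) hε.ne'
  have h2 : ∫⁻ y, F (ε • y) = ∫⁻ h, F h ∂(Measure.map (ε • ·) volume) :=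
    (lintegral_map hF (by fun_prop)).symm
  rw [h2, h1, lintegral_smul_measure, smul_eq_mul]
  congr 2
  rw [finrank_euclideanSpace, Fintype.card_fin, abs_of_pos (by positivity), rpow_neg hε.le, rpow_natCast]

def kap (N : ℕ) (α ε : ℝ) (h : EN N) : ℝ :=
  if ε < ‖h‖ then fracLapCoeff N α * ((‖h‖ ^ 2 - ε ^ 2) ^ (-(α / 2)) * ‖h‖ ^ (-(N:ℝ))) else 0

lemma measurable_kap (N : ℕ) (α ε : ℝ) : Measurable (kap N α ε) := by
  unfold kap
  apply Measurable.ite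
  · exact measurableSet_lt (by fun_prop) (by fun_prop)
  · fun_prop
  · fun_prop

lemma kap_nonneg {N : ℕ} (hN : 0 < N) {α ε : ℝ} (hα0 : 0 < α) (hα2 : α < 2) (hε : 0 ≤ ε) (h : EN N) : 0 ≤ kap N α ε h := by
  unfold kap
  have := fracLapCoeff_pos hN hα0 hα2
  split_ifs with h1
  · have : 0 ≤ ‖h‖ ^ 2 - ε ^ 2 := by nlinarith
    positivity
  · rfl

lemma kap_neg {N : ℕ} {α ε : ℝ} (h : EN N) : kap N α ε (-h) = kap N α ε h := by
  unfold kap; rw [norm_neg]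

lemma kap_scale {N : ℕ} (hN : 0 < N) {α ε : ℝ} (hα0 : 0 < α) (hα2 : α < 2) (hε : 0 < ε) (y : EN N) :
    ENNReal.ofReal (kap N α ε (ε • y)) = ENNReal.ofReal (b0 N α * ε ^ (-α - N)) * KE α 0 y := by
  have hb := b0_pos hN hα0 hα2
  have hc := poissonCoeff_pos hN hα0 hα2
  unfold kap KE
  rw [norm_smul, Real.norm_of_nonneg hε.le]
  by_cases h : 1 < ‖y‖
  · rw [if_pos h, if_pos (by nlinarith), ← ENNReal.ofReal_mul (by positivity), poissonBall_eq (by simp) h]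
    congr 1
    rw [norm_zero, zero_sub, norm_neg]
    have hy : 0 < ‖y‖ ^ 2 - 1 := by nlinarith
    rw [show (ε * ‖y‖) ^ 2 - ε ^ 2 = ε ^ 2 * (‖y‖ ^ 2 - 1) by ring, mul_rpow (by positivity) hy.le,
      mul_rpow hε.le (by positivity), show -(α / 2) = (-α) / 2 by ring, sq_rpow_half hε.le, sub_eq_add_neg (-α), rpow_add hε]
    unfold b0
    field_simp
    simp
  · rw [if_neg h, if_neg (by push Not at h ⊢; nlinarith)]; simp

lemma lint_kap {N : ℕ} (hN : 0 < N) {α ε : ℝ} (hα0 : 0 < α) (hα2 : α < 2) (hε : 0 < ε) (F : EN N → ENNReal) (hF : Measurable F) :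
    ∫⁻ h, ENNReal.ofReal (kap N α ε h) * F h = ENNReal.ofReal (b0 N α * ε ^ (-α)) * ∫⁻ y, KE α 0 y * F (ε • y) := by
  have hb := b0_pos hN hα0 hα2
  have h1 := lint_smul hε (fun h => ENNReal.ofReal (kap N α ε h) * F h) ((measurable_kap N α ε).ennreal_ofReal.mul hF)
  have h2 : ∫⁻ y, ENNReal.ofReal (kap N α ε (ε • y)) * F (ε • y) = ENNReal.ofReal (b0 N α * ε ^ (-α - N)) * ∫⁻ y, KE α 0 y * F (ε • y) := by
    rw [← lintegral_const_mul' _ _ ENNReal.ofReal_ne_top]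
    congr 1; ext y
    rw [kap_scale hN hα0 hα2 hε]; ring
  rw [h2] at h1
  have h3 : ∀ X : ENNReal, ENNReal.ofReal (ε ^ (N:ℝ)) * (ENNReal.ofReal (ε ^ (-(N:ℝ))) * X) = X := by
    intro X
    rw [← mul_assoc, ← ENNReal.ofReal_mul (by positivity), ← rpow_add hε]; simp
  rw [← h3 (∫⁻ h, ENNReal.ofReal (kap N α ε h) * F h), ← h1, ← mul_assoc, ← ENNReal.ofReal_mul (by positivity)]
  congr 2
  rw [show -α = N + (-α - N) by ring, rpow_add hε]
  ring_nf

lemma lint_kap_one {N : ℕ} (hN : 0 < N) {α ε : ℝ} (hα0 : 0 < α) (hα2 : α < 2) (hε : 0 < ε) :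
    ∫⁻ h, ENNReal.ofReal (kap N α ε h) = ENNReal.ofReal (b0 N α * ε ^ (-α)) := by
  have := lint_kap hN hα0 hα2 hε (fun _ => 1) measurable_const
  simp only [mul_one] at this
  rw [this, lint_KE hN hα0 hα2 (by simp), mul_one]

lemma integrable_kap {N : ℕ} (hN : 0 < N) {α ε : ℝ} (hα0 : 0 < α) (hα2 : α < 2) (hε : 0 < ε) :
    Integrable (kap N α ε) := by
  refine ⟨(measurable_kap N α ε).aestronglyMeasurable, ?_⟩
  rw [hasFiniteIntegral_iff_ofReal (ae_of_all _ (kap_nonneg hN hα0 hα2 hε.le)), lint_kap_one hN hα0 hα2 hε]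
  exact ENNReal.ofReal_lt_top

lemma int_kap {N : ℕ} (hN : 0 < N) {α ε : ℝ} (hα0 : 0 < α) (hα2 : α < 2) (hε : 0 < ε) :
    ∫ h, kap N α ε h = b0 N α * ε ^ (-α) := by
  have := b0_pos hN hα0 hα2
  rw [integral_eq_lintegral_of_nonneg_ae (ae_of_all _ (kap_nonneg hN hα0 hα2 hε.le)) (measurable_kap N α ε).aestronglyMeasurable,
    lint_kap_one hN hα0 hα2 hε, ENNReal.toReal_ofReal (by positivity)]

lemma TF.sym_int {N : ℕ} {φ : EN N → ℝ} {C R : ℝ} (h : TF φ C R) {w : EN N → ℝ} (hw : Integrable w) (hwn : ∀ k, w (-k) = w k) (z : EN N) :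
    ∫ k, w k * (φ (z + k) - φ z) = (1/2) * ∫ k, w k * sd φ z k := by
  have hc := h.cont
  have i1 : Integrable (fun k => w k * (φ (z + k) - φ z)) := by
    apply hw.mul_bdd (c := 2 * C) (by fun_prop)
    filter_upwards with k
    have h1 := abs_le.1 (h.bd (z + k))
    have h2 := abs_le.1 (h.bd z)
    rw [norm_eq_abs, abs_le]; constructor <;> linarith
  have e1 : ∫ k, w k * (φ (z + k) - φ z) = ∫ k, w k * (φ (z - k) - φ z) := by
    rw [← integral_neg_eq_self]
    simp [hwn, sub_eq_add_neg]
  have i2 : Integrable (fun k => w k * (φ (z - k) - φ z)) := by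
    apply hw.mul_bdd (c := 2 * C) (by fun_prop)
    filter_upwards with k
    have h1 := abs_le.1 (h.bd (z - k))
    have h2 := abs_le.1 (h.bd z)
    rw [norm_eq_abs, abs_le]; constructor <;> linarith
  have e2 : ∫ k, w k * sd φ z k = (∫ k, w k * (φ (z + k) - φ z)) + ∫ k, w k * (φ (z - k) - φ z) := by
    rw [← integral_add i1 i2]
    congr 1; ext k; unfold sd; ring
  rw [e2, ← e1]; ring

/-- approximate fractional Laplacian -/
def Dop (N : ℕ) (α ε : ℝ) (φ : EN N → ℝ) (z : EN N) : ℝ := ∫ h, kap N α ε h * (φ (z + h) - φ z)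

def LapS (N : ℕ) (α : ℝ) (φ : EN N → ℝ) (z : EN N) : ℝ :=
  fracLapCoeff N α / 2 * ∫ h, ‖h‖ ^ (-((N:ℝ) + α)) * sd φ z h

lemma TF.hasFracLap {N : ℕ} (hN : 0 < N) {α : ℝ} (hα0 : 0 < α) (hα2 : α < 2) {φ : EN N → ℝ} {C R : ℝ} (h : TF φ C R) (z : EN N) :
    HasFracLap N α φ z (LapS N α φ z) := by
  unfold HasFracLap LapS
  set p := (N:ℝ) + α with hp
  have e1 : ∀ ε : ℝ, 0 < ε → fracLapCoeff N α * ∫ y in {y : EN N | ε < dist y z}, (φ y - φ z) / dist y z ^ p =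
      fracLapCoeff N α / 2 * ∫ k : EN N, {k : EN N | ε < ‖k‖}.indicator (fun k => ‖k‖ ^ (-p)) k * sd φ z k := by
    intro ε hε
    have hm : MeasurableSet {k : EN N | ε < ‖k‖} := measurableSet_lt (by fun_prop) (by fun_prop)
    have hm2 : MeasurableSet {y : EN N | ε < dist y z} := measurableSet_lt (by fun_prop) (by fun_prop)
    have hw : Integrable ({k : EN N | ε < ‖k‖}.indicator (fun k => ‖k‖ ^ (-p))) := by
      apply ((integrable_Kw hN hα0 hα2).const_mul (min (ε ^ 2) 1)⁻¹).mono'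
      · exact (Measurable.indicator (by fun_prop) hm).aestronglyMeasurable
      · filter_upwards with k
        by_cases hk : ε < ‖k‖
        · rw [indicator_of_mem (show k ∈ {k : EN N | ε < ‖k‖} from hk), Real.norm_of_nonneg (by positivity)]
          have : min (ε ^ 2) 1 ≤ min (‖k‖ ^ 2) 1 := by gcongr
          have h0 : 0 < min (ε ^ 2) 1 := by positivity
          rw [inv_mul_eq_div, le_div_iff₀ h0]
          gcongr
        · rw [indicator_of_notMem (show k ∉ {k : EN N | ε < ‖k‖} from hk)]
          simp; positivity
    rw [← mul_div_right_comm, mul_div_assoc]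
    congr 1
    rw [div_eq_inv_mul, ← one_div, ← h.sym_int hw]
    · rw [← integral_indicator hm2, ← integral_add_left_eq_self _ z]
      congr 1; ext k
      by_cases hk : ε < ‖k‖
      · rw [indicator_of_mem, indicator_of_mem (show k ∈ {k : EN N | ε < ‖k‖} from hk)]
        · simp only [dist_self_add_left, rpow_neg (norm_nonneg k)]
          ring
        · show ε < dist (z + k) z
          simpa using hk
      · rw [indicator_of_notMem, indicator_of_notMem (show k ∉ {k : EN N | ε < ‖k‖} from hk), zero_mul]
        show ¬ ε < dist (z + k) z
        simpa using hk
    · intro k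
      simp only [indicator, mem_ofPred_eq, norm_neg]
  have e2 : Tendsto (fun ε : ℝ => fracLapCoeff N α / 2 * ∫ k : EN N, {k : EN N | ε < ‖k‖}.indicator (fun k => ‖k‖ ^ (-p)) k * sd φ z k) (𝓝[>] 0)
      (𝓝 (fracLapCoeff N α / 2 * ∫ h, ‖h‖ ^ (-p) * sd φ z h)) := by
    apply Tendsto.const_mul
    have hi := (h.integrable_sd hN hα0 hα2 z).norm
    apply tendsto_integral_filter_of_dominated_convergence _ _ _ hi
    · have : ∀ᵐ k : EN N, k ≠ 0 := by
        have : Nonempty (Fin N) := ⟨⟨0, hN⟩⟩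
        simp [ae_iff]
      filter_upwards [this] with k hk
      apply tendsto_const_nhds.congr'
      have : ∀ᶠ ε in 𝓝[>] (0:ℝ), ε < ‖k‖ := nhdsWithin_le_nhds (Iio_mem_nhds (norm_pos_iff.2 hk))
      filter_upwards [this] with ε hε
      rw [indicator_of_mem (show k ∈ {k : EN N | ε < ‖k‖} from hε)]
    · filter_upwards with ε
      have hm : MeasurableSet {k : EN N | ε < ‖k‖} := measurableSet_lt (by fun_prop) (by fun_prop)
      exact ((Measurable.indicator (by fun_prop) hm).mul (h.continuous_sd z).measurable).aestronglyMeasurable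
    · filter_upwards with ε
      filter_upwards with k
      rw [norm_mul, norm_mul]
      gcongr
      exact norm_indicator_le_norm_self _ _
  apply e2.congr'
  filter_upwards [self_mem_nhdsWithin] with ε hε
  exact (e1 ε hε).symm

lemma TF.fracLap_eq {N : ℕ} (hN : 0 < N) {α : ℝ} (hα0 : 0 < α) (hα2 : α < 2) {φ : EN N → ℝ} {C R : ℝ} (h : TF φ C R) :
    fracLap N α φ = LapS N α φ := by
  ext z
  have h1 := h.hasFracLap hN hα0 hα2 z
  have h2 : ∃ L, HasFracLap N α φ z L := ⟨_, h1⟩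
  unfold fracLap
  rw [dif_pos h2]
  exact tendsto_nhds_unique h2.choose_spec h1



lemma kap_le {N : ℕ} (hN : 0 < N) {α ε : ℝ} (hα0 : 0 < α) (hα2 : α < 2) (hε : 0 < ε) {h : EN N} (hh : 2 * ε ≤ ‖h‖) :
    kap N α ε h ≤ 2 * fracLapCoeff N α * ‖h‖ ^ (-((N:ℝ) + α)) := by
  have hc := fracLapCoeff_pos hN hα0 hα2
  have hn : 0 < ‖h‖ := by linarith
  unfold kap
  rw [if_pos (by linarith)]
  have h1 : ‖h‖ ^ 2 / 2 ≤ ‖h‖ ^ 2 - ε ^ 2 := by nlinarith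
  have h2 : (‖h‖ ^ 2 - ε ^ 2) ^ (-(α / 2)) ≤ (‖h‖ ^ 2 / 2) ^ (-(α / 2)) :=
    rpow_le_rpow_of_nonpos (by positivity) h1 (by linarith)
  have h3 : (‖h‖ ^ 2 / 2) ^ (-(α / 2)) ≤ 2 * ‖h‖ ^ (-α) := by
    rw [div_rpow (by positivity) (by norm_num), show -(α / 2) = -α / 2 by ring, sq_rpow_half hn.le, div_eq_mul_inv, ← rpow_neg (by norm_num), mul_comm]
    gcongr
    calc (2:ℝ) ^ (-(-α / 2)) ≤ 2 ^ (1:ℝ) := rpow_le_rpow_of_exponent_le (by norm_num) (by linarith)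
      _ = 2 := by simp
  calc _ ≤ fracLapCoeff N α * ((2 * ‖h‖ ^ (-α)) * ‖h‖ ^ (-(N:ℝ))) := by
        gcongr; exact h2.trans h3
    _ = _ := by
        rw [show -((N:ℝ) + α) = -α + -N by ring, rpow_add hn]; ring

lemma kap_tendsto {N : ℕ} {α : ℝ} {h : EN N} (hh : h ≠ 0) :
    Tendsto (fun ε => kap N α ε h) (𝓝[>] 0) (𝓝 (fracLapCoeff N α * ‖h‖ ^ (-((N:ℝ) + α)))) := by
  have hn : 0 < ‖h‖ := norm_pos_iff.2 hh
  have e : fracLapCoeff N α * ‖h‖ ^ (-((N:ℝ) + α)) = fracLapCoeff N α * ((‖h‖ ^ 2 - 0 ^ 2) ^ (-(α / 2)) * ‖h‖ ^ (-(N:ℝ))) := by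
    rw [show -((N:ℝ) + α) = -α + -N by ring, rpow_add hn, show -(α / 2) = -α / 2 by ring]
    simp only [ne_eq, OfNat.ofNat_ne_zero, not_false_eq_true, zero_pow, sub_zero]
    rw [sq_rpow_half hn.le]
  have : Tendsto (fun ε : ℝ => fracLapCoeff N α * ((‖h‖ ^ 2 - ε ^ 2) ^ (-(α / 2)) * ‖h‖ ^ (-(N:ℝ)))) (𝓝 0)
      (𝓝 (fracLapCoeff N α * ((‖h‖ ^ 2 - 0 ^ 2) ^ (-(α / 2)) * ‖h‖ ^ (-(N:ℝ))))) := by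
    apply Tendsto.const_mul
    apply Tendsto.mul_const
    apply Tendsto.rpow_const
    · exact (by fun_prop : Continuous (fun ε : ℝ => ‖h‖ ^ 2 - ε ^ 2)).tendsto 0
    · left; simp [hn.ne']
  rw [e]
  apply (this.mono_left nhdsWithin_le_nhds).congr'
  have : ∀ᶠ ε in 𝓝[>] (0:ℝ), ε < ‖h‖ := nhdsWithin_le_nhds (Iio_mem_nhds hn)
  filter_upwards [this] with ε hε
  unfold kap; rw [if_pos hε]

lemma TF.sd_bd {N : ℕ} {φ : EN N → ℝ} {C R : ℝ} (h : TF φ C R) (z k : EN N) : |sd φ z k| ≤ C :=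
  (h.sd_le z k).trans (by nlinarith [h.hC, min_le_right (‖k‖ ^ 2) 1])

/-- near and far parts -/
lemma TF.Dop_split {N : ℕ} (hN : 0 < N) {α ε : ℝ} (hα0 : 0 < α) (hα2 : α < 2) (hε : 0 < ε) {φ : EN N → ℝ} {C R : ℝ} (h : TF φ C R) (z : EN N) :
    Dop N α ε φ z = (1/2) * ((∫ k in {k : EN N | ‖k‖ < 2 * ε}, kap N α ε k * sd φ z k) +
      ∫ k in {k : EN N | ‖k‖ < 2 * ε}ᶜ, kap N α ε k * sd φ z k) := by
  have hm : MeasurableSet {k : EN N | ‖k‖ < 2 * ε} := measurableSet_lt (by fun_prop) (by fun_prop)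
  unfold Dop
  rw [h.sym_int (integrable_kap hN hα0 hα2 hε) (fun k => kap_neg k)]
  congr 1
  rw [integral_add_compl hm]
  apply (integrable_kap hN hα0 hα2 hε).mul_bdd (c := C) (h.continuous_sd z).aestronglyMeasurable
  filter_upwards with k
  exact h.sd_bd z k

lemma TF.near_le {N : ℕ} (hN : 0 < N) {α ε : ℝ} (hα0 : 0 < α) (hα2 : α < 2) (hε : 0 < ε) {φ : EN N → ℝ} {C R : ℝ} (h : TF φ C R) (z : EN N) :
    |∫ k in {k : EN N | ‖k‖ < 2 * ε}, kap N α ε k * sd φ z k| ≤ 4 * C * b0 N α * ε ^ (2 - α) := by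
  have hC := h.hC
  have hm : MeasurableSet {k : EN N | ‖k‖ < 2 * ε} := measurableSet_lt (by fun_prop) (by fun_prop)
  have hb : ∀ᵐ k ∂(volume.restrict {k : EN N | ‖k‖ < 2 * ε}), ‖kap N α ε k * sd φ z k‖ ≤ kap N α ε k * (C * (4 * ε ^ 2)) := by
    filter_upwards [ae_restrict_mem hm] with k hk
    have hk : ‖k‖ < 2 * ε := hk
    have hk0 := kap_nonneg hN hα0 hα2 hε.le k
    rw [norm_mul, Real.norm_of_nonneg hk0, norm_eq_abs]
    apply mul_le_mul_of_nonneg_left _ hk0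
    refine (h.sd_le z k).trans ?_
    gcongr
    refine (min_le_left _ _).trans ?_
    nlinarith [norm_nonneg k]
  have hki := (integrable_kap hN hα0 hα2 hε).mul_const (C * (4 * ε ^ 2))
  rw [← norm_eq_abs]
  refine (norm_integral_le_of_norm_le hki.integrableOn hb).trans ?_
  refine (setIntegral_le_integral hki (ae_of_all _ fun k => ?_)).trans ?_
  · have := kap_nonneg hN hα0 hα2 hε.le k
    simp only [Pi.zero_apply]; positivity
  · rw [integral_mul_const, int_kap hN hα0 hα2 hε]
    apply le_of_eq
    rw [show 2 - α = (2:ℕ) + -α by push_cast; ring, rpow_add hε, rpow_natCast]; ring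

lemma TF.Dop_tendsto {N : ℕ} (hN : 0 < N) {α : ℝ} (hα0 : 0 < α) (hα2 : α < 2) {φ : EN N → ℝ} {C R : ℝ} (h : TF φ C R) (z : EN N) :
    Tendsto (fun ε => Dop N α ε φ z) (𝓝[>] 0) (𝓝 (LapS N α φ z)) := by
  have hc := fracLapCoeff_pos hN hα0 hα2
  have hpos : ∀ᶠ ε in 𝓝[>] (0:ℝ), 0 < ε := self_mem_nhdsWithin
  have hA : Tendsto (fun ε => ∫ k in {k : EN N | ‖k‖ < 2 * ε}, kap N α ε k * sd φ z k) (𝓝[>] 0) (𝓝 0) := by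
    have hz : Tendsto (fun ε : ℝ => 4 * C * b0 N α * ε ^ (2 - α)) (𝓝[>] 0) (𝓝 0) := by
      have : Tendsto (fun ε : ℝ => 4 * C * b0 N α * ε ^ (2 - α)) (𝓝 0) (𝓝 (4 * C * b0 N α * 0 ^ (2 - α))) :=
        ((continuous_rpow_const (by linarith)).tendsto 0).const_mul _
      rw [zero_rpow (by linarith), mul_zero] at this
      exact this.mono_left nhdsWithin_le_nhds
    apply squeeze_zero_norm' _ hz
    filter_upwards [hpos] with ε hε
    exact h.near_le hN hα0 hα2 hε z
  have hB : Tendsto (fun ε => ∫ k in {k : EN N | ‖k‖ < 2 * ε}ᶜ, kap N α ε k * sd φ z k) (𝓝[>] 0)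
      (𝓝 (∫ k, fracLapCoeff N α * ‖k‖ ^ (-((N:ℝ) + α)) * sd φ z k)) := by
    have hm : ∀ ε, MeasurableSet {k : EN N | ‖k‖ < 2 * ε}ᶜ := fun ε => (measurableSet_lt (by fun_prop) (by fun_prop)).compl
    simp_rw [← integral_indicator (hm _)]
    have hi := ((h.integrable_sd hN hα0 hα2 z).norm.const_mul (2 * fracLapCoeff N α))
    apply tendsto_integral_filter_of_dominated_convergence _ _ _ hi
    · have : ∀ᵐ k : EN N, k ≠ 0 := by
        have : Nonempty (Fin N) := ⟨⟨0, hN⟩⟩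
        simp [ae_iff]
      filter_upwards [this] with k hk
      apply ((kap_tendsto hk).mul_const _).congr'
      have : ∀ᶠ ε in 𝓝[>] (0:ℝ), ε < ‖k‖ / 2 := nhdsWithin_le_nhds (Iio_mem_nhds (by have := norm_pos_iff.2 hk; positivity))
      filter_upwards [this] with ε hε
      rw [indicator_of_mem]
      show ¬ ‖k‖ < 2 * ε
      linarith
    · filter_upwards with ε
      exact (Measurable.indicator ((measurable_kap N α ε).mul (h.continuous_sd z).measurable) (hm ε)).aestronglyMeasurable
    · filter_upwards [hpos] with ε hε
      filter_upwards with k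
      by_cases hk : ‖k‖ < 2 * ε
      · rw [indicator_of_notMem (by simpa using hk)]
        simp; positivity
      · rw [indicator_of_mem (by simpa using hk)]
        push Not at hk
        rw [norm_mul, norm_mul, Real.norm_of_nonneg (kap_nonneg hN hα0 hα2 hε.le k), Real.norm_of_nonneg (show 0 ≤ ‖k‖ ^ (-((N:ℝ) + α)) by positivity), ← mul_assoc]
        gcongr
        exact kap_le hN hα0 hα2 hε hk
  have := (hA.add hB).const_mul (1/2)
  have e : LapS N α φ z = 1/2 * (0 + ∫ k, fracLapCoeff N α * ‖k‖ ^ (-((N:ℝ) + α)) * sd φ z k) := by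
    unfold LapS
    simp_rw [mul_assoc]
    rw [integral_const_mul]; ring
  rw [e]
  apply this.congr'
  filter_upwards [hpos] with ε hε
  rw [h.Dop_split hN hα0 hα2 hε]

lemma TF.Dop_bound {N : ℕ} (hN : 0 < N) {α : ℝ} (hα0 : 0 < α) (hα2 : α < 2) {φ : EN N → ℝ} {C R : ℝ} (h : TF φ C R) :
    ∃ D, 0 ≤ D ∧ ∀ ε, 0 < ε → ε ≤ 1/2 → ∀ z, |Dop N α ε φ z| ≤ D * (1 + ‖z‖) ^ (-((N:ℝ) + α)) := by
  obtain ⟨D, hD0, hD⟩ := h.decay hN hα0 hα2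
  have hc := fracLapCoeff_pos hN hα0 hα2
  have hb := b0_pos hN hα0 hα2
  have hC := h.hC
  have hR := h.hR
  set p := (N:ℝ) + α with hp
  have hp0 : 0 < p := by positivity
  refine ⟨4 * C * b0 N α * (2 + R) ^ p + 2 * fracLapCoeff N α * D, by positivity, fun ε hε hε1 z => ?_⟩
  rw [h.Dop_split hN hα0 hα2 hε, abs_mul, abs_of_pos (by norm_num : (0:ℝ) < 1/2)]
  have hA : |∫ k in {k : EN N | ‖k‖ < 2 * ε}, kap N α ε k * sd φ z k| ≤ 4 * C * b0 N α * (2 + R) ^ p * (1 + ‖z‖) ^ (-p) := by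
    rcases le_or_gt ‖z‖ (R + 1) with hz | hz
    · refine (h.near_le hN hα0 hα2 hε z).trans ?_
      rw [mul_assoc _ ((2 + R) ^ p)]
      gcongr
      have h1 : ε ^ (2 - α) ≤ 1 := rpow_le_one hε.le (by linarith) (by linarith)
      refine h1.trans ?_
      rw [rpow_neg (by positivity), ← div_eq_mul_inv, one_le_div (by positivity)]
      gcongr ?_ ^ p
      linarith
    · have hm : MeasurableSet {k : EN N | ‖k‖ < 2 * ε} := measurableSet_lt (by fun_prop) (by fun_prop)
      rw [setIntegral_eq_zero_of_forall_eq_zero]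
      · rw [abs_zero]; positivity
      · intro k hk
        have hk : ‖k‖ < 2 * ε := hk
        have a1 : φ (z + k) = 0 := h.supp _ (by
          have := norm_sub_le (z + k) k
          rw [add_sub_cancel_right] at this; linarith)
        have a2 : φ (z - k) = 0 := h.supp _ (by
          have := norm_add_le (z - k) k
          rw [sub_add_cancel] at this; linarith)
        have a3 : φ z = 0 := h.supp _ (by linarith)
        unfold sd
        simp [a1, a2, a3]
  have hB : |∫ k in {k : EN N | ‖k‖ < 2 * ε}ᶜ, kap N α ε k * sd φ z k| ≤ 2 * fracLapCoeff N α * D * (1 + ‖z‖) ^ (-p) := by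
    have hm : MeasurableSet {k : EN N | ‖k‖ < 2 * ε}ᶜ := (measurableSet_lt (by fun_prop) (by fun_prop)).compl
    have hi := ((h.integrable_sd hN hα0 hα2 z).norm.const_mul (2 * fracLapCoeff N α))
    rw [← norm_eq_abs]
    refine (norm_integral_le_of_norm_le hi.integrableOn (g := fun k => 2 * fracLapCoeff N α * ‖‖k‖ ^ (-((N:ℝ) + α)) * sd φ z k‖) ?_).trans ?_
    · filter_upwards [ae_restrict_mem hm] with k hk
      have hk : ¬ ‖k‖ < 2 * ε := hk
      push Not at hk
      rw [norm_mul, norm_mul, Real.norm_of_nonneg (kap_nonneg hN hα0 hα2 hε.le k), Real.norm_of_nonneg (show 0 ≤ ‖k‖ ^ (-((N:ℝ) + α)) by positivity), ← mul_assoc]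
      gcongr
      exact kap_le hN hα0 hα2 hε hk
    · refine (setIntegral_le_integral hi (ae_of_all _ fun k => ?_)).trans ?_
      · simp only [Pi.zero_apply]; positivity
      · rw [integral_const_mul, mul_assoc _ D]
        gcongr
        refine le_trans (le_of_eq ?_) (hD z)
        congr 1; ext k
        rw [norm_mul, Real.norm_of_nonneg (show 0 ≤ ‖k‖ ^ (-((N:ℝ) + α)) by positivity), norm_eq_abs]
  have := abs_add_le (∫ k in {k : EN N | ‖k‖ < 2 * ε}, kap N α ε k * sd φ z k) (∫ k in {k : EN N | ‖k‖ < 2 * ε}ᶜ, kap N α ε k * sd φ z k)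
  have h0 := abs_nonneg ((∫ k in {k : EN N | ‖k‖ < 2 * ε}, kap N α ε k * sd φ z k) + (∫ k in {k : EN N | ‖k‖ < 2 * ε}ᶜ, kap N α ε k * sd φ z k))
  rw [add_mul]
  linarith

lemma TF.LapS_bound {N : ℕ} (hN : 0 < N) {α : ℝ} (hα0 : 0 < α) (hα2 : α < 2) {φ : EN N → ℝ} {C R : ℝ} (h : TF φ C R) :
    ∃ D, 0 ≤ D ∧ ∀ z, |LapS N α φ z| ≤ D * (1 + ‖z‖) ^ (-((N:ℝ) + α)) := by
  obtain ⟨D, hD0, hD⟩ := h.Dop_bound hN hα0 hα2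
  refine ⟨D, hD0, fun z => ?_⟩
  apply le_of_tendsto (h.Dop_tendsto hN hα0 hα2 z).abs
  have h1 : ∀ᶠ ε in 𝓝[>] (0:ℝ), 0 < ε := self_mem_nhdsWithin
  have h2 : ∀ᶠ ε in 𝓝[>] (0:ℝ), ε < 1/2 := nhdsWithin_le_nhds (Iio_mem_nhds (by norm_num))
  filter_upwards [h1, h2] with ε a b
  exact hD ε a b.le z

lemma TF.measurable_Dop {N : ℕ} {α ε : ℝ} {φ : EN N → ℝ} {C R : ℝ} (h : TF φ C R) : Measurable (Dop N α ε φ) := by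
  have hc := h.cont
  have h1 := measurable_kap N α ε
  have : Measurable (fun p : EN N × EN N => kap N α ε p.2 * (φ (p.1 + p.2) - φ p.1)) :=
    (h1.comp measurable_snd).mul (by fun_prop)
  exact (this.stronglyMeasurable.integral_prod_right' (ν := volume)).measurable

lemma TF.measurable_LapS {N : ℕ} {α : ℝ} {φ : EN N → ℝ} {C R : ℝ} (h : TF φ C R) : Measurable (LapS N α φ) := by
  have hc := h.cont
  have : Measurable (fun p : EN N × EN N => ‖p.2‖ ^ (-((N:ℝ) + α)) * sd φ p.1 p.2) := by
    unfold sd; fun_prop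
  exact (this.stronglyMeasurable.integral_prod_right' (ν := volume)).measurable.const_mul _



lemma memL_aesm {N : ℕ} {α : ℝ} {v : EN N → ℝ} (hv : memLalpha N α v) : AEStronglyMeasurable v volume := by
  have h1 : AEStronglyMeasurable (fun y : EN N => (v y * (1 + ‖y‖) ^ (-((N : ℝ) + α))) * (1 + ‖y‖) ^ ((N : ℝ) + α)) volume :=
    hv.aestronglyMeasurable.mul (by fun_prop : Measurable (fun y : EN N => (1 + ‖y‖) ^ ((N : ℝ) + α))).aestronglyMeasurable
  apply h1.congr
  filter_upwards with y
  rw [mul_assoc, ← rpow_add (by positivity)]; simp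

lemma memL_mul {N : ℕ} {α : ℝ} {v g : EN N → ℝ} (hv : memLalpha N α v) (hg : AEStronglyMeasurable g volume) {D : ℝ}
    (hD : ∀ z, |g z| ≤ D * (1 + ‖z‖) ^ (-((N:ℝ) + α))) : Integrable (fun z => v z * g z) := by
  apply (hv.norm.const_mul D).mono' ((memL_aesm hv).mul hg)
  filter_upwards with z
  show ‖v z * g z‖ ≤ D * ‖v z * (1 + ‖z‖) ^ (-((N:ℝ) + α))‖
  rw [norm_mul, norm_mul, Real.norm_of_nonneg (show 0 ≤ (1 + ‖z‖) ^ (-((N:ℝ) + α)) by positivity)]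
  have := hD z
  rw [← norm_eq_abs] at this
  nlinarith [norm_nonneg (v z)]

lemma TF.kap_phi_bound {N : ℕ} (hN : 0 < N) {α ε : ℝ} (hα0 : 0 < α) (hα2 : α < 2) (hε : 0 < ε) (hε1 : ε ≤ 1/2) {φ : EN N → ℝ} {C R : ℝ} (h : TF φ C R) :
    ∃ D, 0 ≤ D ∧ ∀ z, ∫ k : EN N, kap N α ε k * |φ (z + k)| ≤ D * (1 + ‖z‖) ^ (-((N:ℝ) + α)) := by
  set p := (N:ℝ) + α with hp
  have hp0 : 0 < p := by positivity
  have hc := fracLapCoeff_pos hN hα0 hα2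
  have hb := b0_pos hN hα0 hα2
  set J := ∫ k, |φ k| with hJ
  have hJ0 : 0 ≤ J := integral_nonneg (fun k => by positivity)
  have hC := h.hC
  have hR := h.hR
  have hcont := h.cont
  have hintg : ∀ z, Integrable (fun k : EN N => kap N α ε k * |φ (z + k)|) := by
    intro z
    apply (integrable_kap hN hα0 hα2 hε).mul_bdd (c := C) (by fun_prop)
    filter_upwards with k
    rw [norm_eq_abs, abs_abs]; exact h.bd _
  set m := b0 N α * ε ^ (-α) with hm
  refine ⟨m * C * (1 + 2 * R) ^ p + 2 * fracLapCoeff N α * 4 ^ p * J, by positivity, fun z => ?_⟩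
  rw [add_mul]
  have t1 : 0 ≤ m * C * (1 + 2 * R) ^ p * (1 + ‖z‖) ^ (-p) := by positivity
  have t2 : 0 ≤ 2 * fracLapCoeff N α * 4 ^ p * J * (1 + ‖z‖) ^ (-p) := by positivity
  rcases le_or_gt ‖z‖ (2 * R) with hz | hz
  · have : ∫ k : EN N, kap N α ε k * |φ (z + k)| ≤ m * C := by
      rw [hm, ← int_kap hN hα0 hα2 hε, ← integral_mul_const]
      apply integral_mono (hintg z) ((integrable_kap hN hα0 hα2 hε).mul_const C)
      intro k
      exact mul_le_mul_of_nonneg_left (h.bd _) (kap_nonneg hN hα0 hα2 hε.le k)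
    have h3 : 1 ≤ (1 + 2 * R) ^ p * (1 + ‖z‖) ^ (-p) := by
      rw [rpow_neg (by positivity), ← div_eq_mul_inv, one_le_div (by positivity)]
      gcongr
    have : m * C ≤ m * C * ((1 + 2 * R) ^ p * (1 + ‖z‖) ^ (-p)) := le_mul_of_one_le_right (by positivity) h3
    linarith
  · have hz0 : 0 < ‖z‖ := by linarith
    have i1 : Integrable (fun k => |φ (z + k)|) := h.integrable.abs.comp_add_left z
    have : ∫ k : EN N, kap N α ε k * |φ (z + k)| ≤ ∫ k, (2 * fracLapCoeff N α * (‖z‖ / 2) ^ (-p)) * (|φ (z + k)|) := by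
      apply integral_mono (hintg z) (i1.const_mul _)
      intro k
      simp only
      rcases lt_or_ge ‖k‖ (‖z‖ / 2) with hk | hk
      · have a1 : φ (z + k) = 0 := h.supp _ (by
          have := norm_sub_le (z + k) k
          rw [add_sub_cancel_right] at this; linarith)
        simp [a1]
      · apply mul_le_mul_of_nonneg_right _ (abs_nonneg _)
        refine (kap_le hN hα0 hα2 hε (by linarith)).trans ?_
        apply mul_le_mul_of_nonneg_left _ (by positivity)
        exact rpow_le_rpow_of_nonpos (by positivity) hk (by linarith)
    rw [integral_const_mul, integral_add_left_eq_self (fun k => |φ k|) z, ← hJ] at this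
    have h4 : (‖z‖ / 2) ^ (-p) ≤ 4 ^ p * (1 + ‖z‖) ^ (-p) := by
      have : ((1 + ‖z‖) / 4) ^ (-p) = 4 ^ p * (1 + ‖z‖) ^ (-p) := by
        rw [div_rpow (by positivity) (by norm_num), rpow_neg (by norm_num : (0:ℝ) ≤ 4)]; field_simp
      rw [← this]
      exact rpow_le_rpow_of_nonpos (by positivity) (by linarith) (by linarith)
    have : 2 * fracLapCoeff N α * (‖z‖ / 2) ^ (-p) * J ≤ 2 * fracLapCoeff N α * (4 ^ p * (1 + ‖z‖) ^ (-p)) * J := by gcongr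
    linarith

lemma TF.phi_bound {N : ℕ} {α : ℝ} (hα0 : 0 < α) {φ : EN N → ℝ} {C R : ℝ} (h : TF φ C R) :
    ∀ z, |φ z| ≤ C * (1 + R) ^ ((N:ℝ) + α) * (1 + ‖z‖) ^ (-((N:ℝ) + α)) := by
  intro z
  have hC := h.hC
  have hR := h.hR
  rcases le_or_gt ‖z‖ R with hz | hz
  · refine (h.bd z).trans ?_
    rw [mul_assoc]
    apply le_mul_of_one_le_right hC.le
    rw [rpow_neg (by positivity), ← div_eq_mul_inv, one_le_div (by positivity)]
    gcongr
  · rw [h.supp z hz, abs_zero]; positivity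

/-- product integrability -/
lemma TF.integrable_prod {N : ℕ} (hN : 0 < N) {α ε : ℝ} (hα0 : 0 < α) (hα2 : α < 2) (hε : 0 < ε) (hε1 : ε ≤ 1/2) {φ : EN N → ℝ} {C R : ℝ} (h : TF φ C R)
    {v : EN N → ℝ} (hv : memLalpha N α v) :
    Integrable (fun q : EN N × EN N => kap N α ε q.1 * (v q.2 * φ (q.2 + q.1))) (volume.prod volume) := by
  have hcont := h.cont
  have hsm : AEStronglyMeasurable (fun q : EN N × EN N => kap N α ε q.1 * (v q.2 * φ (q.2 + q.1))) (volume.prod volume) := by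
    apply AEStronglyMeasurable.mul
    · exact ((measurable_kap N α ε).comp measurable_fst).aestronglyMeasurable
    · exact (memL_aesm hv).comp_snd.mul (by fun_prop)
  rw [integrable_prod_iff' hsm]
  have hi : ∀ z, Integrable (fun k => kap N α ε k * φ (z + k)) := by
    intro z
    apply (integrable_kap hN hα0 hα2 hε).mul_bdd (c := C) (by fun_prop)
    filter_upwards with k
    exact h.bd _
  constructor
  · filter_upwards with z
    apply ((hi z).const_mul (v z)).congr
    filter_upwards with k
    ring
  · obtain ⟨D, hD0, hD⟩ := h.kap_phi_bound hN hα0 hα2 hε hε1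
    have e : ∀ z, ∫ k, ‖kap N α ε k * (v z * φ (z + k))‖ = |v z| * ∫ k, kap N α ε k * |φ (z + k)| := by
      intro z
      rw [← integral_const_mul]
      congr 1; ext k
      rw [norm_mul, norm_mul, Real.norm_of_nonneg (kap_nonneg hN hα0 hα2 hε.le k), norm_eq_abs, norm_eq_abs]; ring
    simp_rw [e]
    have hv' : memLalpha N α (fun z => |v z|) := by
      unfold memLalpha
      apply hv.norm.congr
      filter_upwards with z
      rw [norm_mul, Real.norm_of_nonneg (show 0 ≤ (1 + ‖z‖) ^ (-((N:ℝ) + α)) by positivity), norm_eq_abs]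
    apply memL_mul hv' _ (D := D)
    · intro z
      rw [abs_of_nonneg]
      · exact hD z
      · exact integral_nonneg (fun k => mul_nonneg (kap_nonneg hN hα0 hα2 hε.le k) (abs_nonneg _))
    · have : Measurable (fun p : EN N × EN N => kap N α ε p.2 * |φ (p.1 + p.2)|) :=
        ((measurable_kap N α ε).comp measurable_snd).mul (by fun_prop)
      exact (this.stronglyMeasurable.integral_prod_right' (ν := volume)).aestronglyMeasurable

lemma TF.Dop_pair {N : ℕ} (hN : 0 < N) {α ε : ℝ} (hα0 : 0 < α) (hα2 : α < 2) (hε : 0 < ε) (hε1 : ε ≤ 1/2) {φ : EN N → ℝ} {C R : ℝ} (h : TF φ C R)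
    {v : EN N → ℝ} (hv : memLalpha N α v) :
    ∫ z, v z * Dop N α ε φ z = (∫ k, kap N α ε k * ∫ z, v z * φ (z + k)) - b0 N α * ε ^ (-α) * ∫ z, v z * φ z := by
  have hcont := h.cont
  have hp := h.integrable_prod hN hα0 hα2 hε hε1 hv
  have hi : ∀ z, Integrable (fun k => kap N α ε k * φ (z + k)) := by
    intro z
    apply (integrable_kap hN hα0 hα2 hε).mul_bdd (c := C) (by fun_prop)
    filter_upwards with k
    exact h.bd _
  have e1 : ∀ z, v z * Dop N α ε φ z = (∫ k, kap N α ε k * (v z * φ (z + k))) - b0 N α * ε ^ (-α) * (v z * φ z) := by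
    intro z
    have : Dop N α ε φ z = (∫ k, kap N α ε k * φ (z + k)) - ∫ k, kap N α ε k * φ z := by
      rw [← integral_sub (hi z) ((integrable_kap hN hα0 hα2 hε).mul_const _)]
      unfold Dop
      congr 1; ext k; ring
    rw [this, integral_mul_const, int_kap hN hα0 hα2 hε, mul_sub, ← integral_const_mul]
    congr 1
    · congr 1; ext k; ring
    · ring
  simp_rw [e1]
  rw [integral_sub hp.integral_prod_right ((memL_mul hv h.cont.aestronglyMeasurable (h.phi_bound hα0)).const_mul _), integral_const_mul]
  congr 1
  rw [← integral_integral_swap hp]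
  simp_rw [integral_const_mul]



/-- truncated Riesz kernel -/
def nr (N : ℕ) (α R : ℝ) (h : EN N) : ℝ := if ‖h‖ < R then ‖h‖ ^ (α - (N:ℝ)) else 0

lemma measurable_nr (N : ℕ) (α R : ℝ) : Measurable (nr N α R) := by
  unfold nr
  exact Measurable.ite (measurableSet_lt (by fun_prop) (by fun_prop)) (by fun_prop) (by fun_prop)

lemma nr_nonneg (N : ℕ) (α R : ℝ) (h : EN N) : 0 ≤ nr N α R h := by
  unfold nr; split_ifs <;> positivity

lemma integrable_nr {N : ℕ} (hN : 0 < N) {α : ℝ} (hα0 : 0 < α) {R : ℝ} (hR : 0 < R) : Integrable (nr N α R) := by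
  have : Nonempty (Fin N) := ⟨⟨0, hN⟩⟩
  have key : IntegrableOn (fun r : ℝ => if r < R then r ^ (α - 1) else 0) (Ioi 0) := by
    rw [← Ioo_union_Ici_eq_Ioi hR]
    apply IntegrableOn.union
    · have hi : IntervalIntegrable (fun r : ℝ => r ^ (α - 1)) volume 0 R :=
        intervalIntegral.intervalIntegrable_rpow' (by linarith)
      rw [intervalIntegrable_iff_integrableOn_Ioo_of_le hR.le] at hi
      apply hi.congr_fun _ measurableSet_Ioo
      intro r hr
      simp only
      rw [if_pos hr.2]
    · apply integrableOn_zero.congr_fun _ measurableSet_Ici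
      intro r hr
      simp only
      rw [if_neg (not_lt.2 hr)]
  have := (integrable_fun_norm_addHaar (volume : Measure (EN N)) (f := fun r : ℝ => if r < R then r ^ (α - (N:ℝ)) else 0)).2
  apply this
  apply key.congr_fun _ measurableSet_Ioi
  intro r hr
  have h0 : 0 < r := hr
  simp only [finrank_euclideanSpace, Fintype.card_fin, smul_eq_mul]
  split_ifs
  · rw [pow_mul_rpow_aux hN h0]
  · simp

lemma rk_le_nr {N : ℕ} {α : ℝ} (hαN : α ≤ N) (h : EN N) {R : ℝ} (hR : 0 < R) : ‖h‖ ^ (α - (N:ℝ)) ≤ nr N α R h + R ^ (α - (N:ℝ)) := by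
  unfold nr
  split_ifs with h1
  · have : 0 ≤ R ^ (α - (N:ℝ)) := by positivity
    linarith
  · rw [zero_add]
    exact rpow_le_rpow_of_nonpos hR (not_lt.1 h1) (by linarith)

lemma measurable_RK_right {N : ℕ} (α : ℝ) (x : EN N) : Measurable (fun z => RK α x z) := by
  unfold RK; fun_prop

lemma memL_bdd {N : ℕ} {α : ℝ} (hα0 : 0 < α) : Integrable (fun y : EN N => (1 + ‖y‖) ^ (-((N : ℝ) + α))) := by
  apply integrable_one_add_norm
  simp [hα0]

lemma memL_RK {N : ℕ} (hN : 3 ≤ N) {α : ℝ} (hα0 : 0 < α) (hα2 : α < 2) (x : EN N) : memLalpha N α (fun z => RK α x z) := by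
  unfold memLalpha
  have hNr : (3:ℝ) ≤ N := by exact_mod_cast hN
  have hc : 0 ≤ greenCoeff N α * bA N α := by
    have := greenCoeff_pos (show 0 < N by omega) hα0
    have := bA_pos hN hα0 hα2
    positivity
  have i1 : Integrable (fun z => nr N α 1 (x - z)) := (integrable_nr (by omega) hα0 one_pos).comp_sub_left x
  have i2 := memL_bdd (N := N) hα0
  apply ((i1.add i2).const_mul (greenCoeff N α * bA N α)).mono' ((measurable_RK_right α x).mul (by fun_prop)).aestronglyMeasurable
  filter_upwards with z
  have h1 := rk_le_nr (α := α) (by linarith : α ≤ N) (x - z) one_pos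
  rw [one_rpow] at h1
  have h2 : (1 + ‖z‖) ^ (-((N : ℝ) + α)) ≤ 1 := rpow_le_one_of_one_le_of_nonpos (by linarith [norm_nonneg z]) (by linarith)
  have h3 : 0 ≤ (1 + ‖z‖) ^ (-((N : ℝ) + α)) := by positivity
  show ‖RK α x z * (1 + ‖z‖) ^ (-((N : ℝ) + α))‖ ≤ _
  rw [Real.norm_of_nonneg (mul_nonneg (RK_nonneg hN hα0 hα2 x z) h3)]
  unfold RK
  rw [mul_assoc]
  apply mul_le_mul_of_nonneg_left _ hc
  simp only [Pi.add_apply]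
  have h4 := nr_nonneg N α 1 (x - z)
  calc _ ≤ (nr N α 1 (x - z) + 1) * (1 + ‖z‖) ^ (-((N : ℝ) + α)) := by gcongr
    _ = nr N α 1 (x - z) * (1 + ‖z‖) ^ (-((N : ℝ) + α)) + (1 + ‖z‖) ^ (-((N : ℝ) + α)) := by ring
    _ ≤ _ := by
      gcongr
      exact mul_le_of_le_one_right h4 h2

lemma TF.integrable_prod' {N : ℕ} (hN : 0 < N) {α ε : ℝ} (hα0 : 0 < α) (hα2 : α < 2) (hε : 0 < ε) (hε1 : ε ≤ 1/2) {φ : EN N → ℝ} {C R : ℝ} (h : TF φ C R)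
    {v : EN N → ℝ} (hv : memLalpha N α v) :
    Integrable (fun q : EN N × EN N => kap N α ε q.1 * (v (-q.1 + q.2) * φ q.2)) (volume.prod volume) := by
  have h1 := h.integrable_prod hN hα0 hα2 hε hε1 hv
  have h2 := measurePreserving_prod_neg_add (volume : Measure (EN N)) (volume : Measure (EN N))
  have h3 := h2.integrable_comp_of_integrable h1
  convert h3 using 2 with q
  simp

lemma TF.Dop_pair' {N : ℕ} (hN : 0 < N) {α ε : ℝ} (hα0 : 0 < α) (hα2 : α < 2) (hε : 0 < ε) (hε1 : ε ≤ 1/2) {φ : EN N → ℝ} {C R : ℝ} (h : TF φ C R)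
    {v : EN N → ℝ} (hv : memLalpha N α v) :
    ∫ z, v z * Dop N α ε φ z = ∫ w, φ w * ((∫ k, kap N α ε k * v (-k + w)) - b0 N α * ε ^ (-α) * v w) := by
  rw [h.Dop_pair hN hα0 hα2 hε hε1 hv]
  have hp := h.integrable_prod' hN hα0 hα2 hε hε1 hv
  have e1 : ∀ k : EN N, kap N α ε k * ∫ z, v z * φ (z + k) = ∫ w, kap N α ε k * (v (-k + w) * φ w) := by
    intro k
    rw [integral_const_mul, ← integral_add_left_eq_self (fun w => v (-k + w) * φ w) k]
    congr 2; ext z; simp [add_comm]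
  simp_rw [e1]
  rw [integral_integral_swap hp, ← integral_const_mul, ← integral_sub hp.integral_prod_right ((memL_mul hv h.cont.aestronglyMeasurable (h.phi_bound hα0)).const_mul _)]
  congr 1; ext w
  rw [mul_sub, ← integral_const_mul]
  congr 1
  · congr 1; ext k; ring
  · ring

lemma RE_scale {N : ℕ} (hN : 3 ≤ N) {α ε : ℝ} (hα0 : 0 < α) (hα2 : α < 2) (hε : 0 < ε) (x w y : EN N) :
    RE α x (-(ε • y) + w) = ENNReal.ofReal (ε ^ (α - (N:ℝ))) * RE α y (ε⁻¹ • (w - x)) := by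
  unfold RE
  rw [← ENNReal.ofReal_mul (by positivity)]
  congr 1
  unfold RK
  have : x - (-(ε • y) + w) = ε • (y - ε⁻¹ • (w - x)) := by
    rw [smul_sub, smul_inv_smul₀ hε.ne']; abel
  rw [this, norm_smul, norm_of_nonneg hε.le, mul_rpow hε.le (norm_nonneg _)]
  ring

lemma sweep_kap {N : ℕ} (hN : 3 ≤ N) {α ε : ℝ} (hα0 : 0 < α) (hα2 : α < 2) (hε : 0 < ε) {x w : EN N} (hxw : w ≠ x) :
    (∫ k, kap N α ε k * RK α x (-k + w)) - b0 N α * ε ^ (-α) * RK α x w = - (b0 N α * ε ^ (-(N:ℝ)) * greenB N α 0 (ε⁻¹ • (w - x))) := by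
  have hN0 : 0 < N := by omega
  have hb := b0_pos hN0 hα0 hα2
  have hg0 : ∀ y, 0 ≤ greenB N α (0 : EN N) y := fun y => by rw [greenB_eq hN hα0 hα2]; exact ENNReal.toReal_nonneg
  have hm : Measurable (fun k => RE α x (-k + w)) := by
    unfold RE RK; fun_prop
  have h1 := lint_kap hN0 hα0 hα2 hε (fun k => RE α x (-k + w)) hm
  have h2 := sweep hN hα0 hα2 (x := (0 : EN N)) (z := ε⁻¹ • (w - x)) (by simp) (by
    intro h
    have := smul_eq_zero.1 h.symm
    rcases this with h | h
    · exact (inv_ne_zero hε.ne') h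
    · exact hxw (sub_eq_zero.1 h))
  simp only [RE_scale hN hα0 hα2 hε] at h1
  have h3 : ∫⁻ y, KE α 0 y * (ENNReal.ofReal (ε ^ (α - (N:ℝ))) * RE α y (ε⁻¹ • (w - x))) = ENNReal.ofReal (ε ^ (α - (N:ℝ))) * ∫⁻ y, KE α 0 y * RE α y (ε⁻¹ • (w - x)) := by
    rw [← lintegral_const_mul' _ _ ENNReal.ofReal_ne_top]
    congr 1; ext y; ring
  rw [h3] at h1
  have h4 : RE α x w = ENNReal.ofReal (ε ^ (α - (N:ℝ))) * RE α 0 (ε⁻¹ • (w - x)) := by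
    have := RE_scale hN hα0 hα2 hε x w 0
    simpa using this
  have h5 : (∫⁻ k, ENNReal.ofReal (kap N α ε k) * RE α x (-k + w)) + ENNReal.ofReal (b0 N α * ε ^ (-(N:ℝ)) * greenB N α 0 (ε⁻¹ • (w - x))) = ENNReal.ofReal (b0 N α * ε ^ (-α)) * RE α x w := by
    rw [h1, h4, h2, ENNReal.ofReal_mul (p := b0 N α * ε ^ (-(N:ℝ))) (by positivity), ofReal_greenB hN hα0 hα2]
    rw [show b0 N α * ε ^ (-(N:ℝ)) = b0 N α * ε ^ (-α) * ε ^ (α - (N:ℝ)) by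
      rw [mul_assoc, ← rpow_add hε]; congr 2; ring]
    rw [ENNReal.ofReal_mul (p := b0 N α * ε ^ (-α)) (by positivity)]
    ring
  have h6 : ∫ k, kap N α ε k * RK α x (-k + w) = (∫⁻ k, ENNReal.ofReal (kap N α ε k) * RE α x (-k + w)).toReal := by
    rw [integral_eq_lintegral_of_nonneg_ae]
    · congr 1; congr 1; ext k
      rw [ENNReal.ofReal_mul (kap_nonneg hN0 hα0 hα2 hε.le k)]; rfl
    · filter_upwards with k
      exact mul_nonneg (kap_nonneg hN0 hα0 hα2 hε.le k) (RK_nonneg hN hα0 hα2 _ _)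
    · apply Measurable.aestronglyMeasurable
      apply (measurable_kap N α ε).mul
      unfold RK; fun_prop
  have hfin : (∫⁻ k, ENNReal.ofReal (kap N α ε k) * RE α x (-k + w)) ≠ ⊤ := by
    intro h
    rw [h, top_add] at h5
    exact ENNReal.mul_ne_top ENNReal.ofReal_ne_top ENNReal.ofReal_ne_top h5.symm
  rw [h6]
  have h7 := congrArg ENNReal.toReal h5
  have h8 := hg0 (ε⁻¹ • (w - x))
  rw [ENNReal.toReal_add hfin ENNReal.ofReal_ne_top, ENNReal.toReal_mul, ENNReal.toReal_ofReal (by positivity), ENNReal.toReal_ofReal (by positivity), RE, ENNReal.toReal_ofReal (RK_nonneg hN hα0 hα2 _ _)] at h7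
  linarith

lemma integrable_greenB0 {N : ℕ} (hN : 3 ≤ N) {α : ℝ} (hα0 : 0 < α) (hα2 : α < 2) :
    Integrable (fun z : EN N => greenB N α 0 z) ∧ ∫ z : EN N, greenB N α 0 z = (b0 N α)⁻¹ := by
  have hb := b0_pos (show 0 < N by omega) hα0 hα2
  have h := lint_G0 hN hα0 hα2
  simp_rw [greenB_eq hN hα0 hα2]
  have h1 : ∫⁻ z : EN N, GE α 0 z ≠ ⊤ := by rw [h]; exact ENNReal.ofReal_ne_top
  refine ⟨integrable_toReal_of_lintegral_ne_top (measurable_GE_right α 0).aemeasurable h1, ?_⟩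
  rw [integral_toReal (measurable_GE_right α 0).aemeasurable, h, ENNReal.toReal_ofReal (by positivity)]
  filter_upwards with z
  exact (GE_ne_top hN hα0 hα2 _ _).lt_top

lemma TF.riesz_eps {N : ℕ} (hN : 3 ≤ N) {α ε : ℝ} (hα0 : 0 < α) (hα2 : α < 2) (hε : 0 < ε) (hε1 : ε ≤ 1/2) {φ : EN N → ℝ} {C R : ℝ} (h : TF φ C R) (x : EN N) :
    ∫ z, RK α x z * Dop N α ε φ z = - (b0 N α * ∫ v, φ (x + ε • v) * greenB N α 0 v) := by
  have hN0 : 0 < N := by omega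
  have : Nonempty (Fin N) := ⟨⟨0, hN0⟩⟩
  rw [h.Dop_pair' hN0 hα0 hα2 hε hε1 (memL_RK hN hα0 hα2 x)]
  have e1 : ∫ w, φ w * ((∫ k, kap N α ε k * RK α x (-k + w)) - b0 N α * ε ^ (-α) * RK α x w)
      = ∫ w, -(b0 N α * ε ^ (-(N:ℝ))) * (φ w * greenB N α 0 (ε⁻¹ • (w - x))) := by
    apply integral_congr_ae
    filter_upwards [compl_mem_ae_iff.2 (measure_singleton x)] with w hw
    rw [sweep_kap hN hα0 hα2 hε hw]; ring
  rw [e1, integral_const_mul, ← integral_add_left_eq_self (fun w => φ w * greenB N α 0 (ε⁻¹ • (w - x))) x]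
  have e2 := Measure.integral_comp_smul (volume : Measure (EN N)) (fun w => φ (x + w) * greenB N α 0 (ε⁻¹ • (x + w - x))) ε
  have e3 : ∀ v : EN N, φ (x + ε • v) * greenB N α 0 (ε⁻¹ • (x + ε • v - x)) = φ (x + ε • v) * greenB N α 0 v := by
    intro v
    rw [add_sub_cancel_left, inv_smul_smul₀ hε.ne']
  simp_rw [e3] at e2
  rw [e2, finrank_euclideanSpace, Fintype.card_fin, smul_eq_mul, abs_of_pos (by positivity), rpow_neg hε.le, rpow_natCast]
  ring

theorem TF.riesz {N : ℕ} (hN : 3 ≤ N) {α : ℝ} (hα0 : 0 < α) (hα2 : α < 2) {φ : EN N → ℝ} {C R : ℝ} (h : TF φ C R) (x : EN N) :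
    ∫ z, RK α x z * LapS N α φ z = - φ x := by
  have hN0 : 0 < N := by omega
  have hb := b0_pos hN0 hα0 hα2
  obtain ⟨hg1, hg2⟩ := integrable_greenB0 hN hα0 hα2
  have hcont := h.cont
  have hev : ∀ᶠ ε in 𝓝[>] (0:ℝ), 0 < ε ∧ ε ≤ 1/2 := by
    have : Ioc (0:ℝ) (1/2) ∈ 𝓝[>] (0:ℝ) := Ioc_mem_nhdsGT (by norm_num)
    filter_upwards [this] with ε hε using hε
  obtain ⟨D, hD0, hD⟩ := h.Dop_bound hN0 hα0 hα2
  have t1 : Tendsto (fun ε => ∫ z, RK α x z * Dop N α ε φ z) (𝓝[>] 0) (𝓝 (∫ z, RK α x z * LapS N α φ z)) := by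
    apply tendsto_integral_filter_of_dominated_convergence (fun z => RK α x z * (D * (1 + ‖z‖) ^ (-((N:ℝ) + α))))
    · filter_upwards with ε
      exact ((measurable_RK_right α x).mul h.measurable_Dop).aestronglyMeasurable
    · filter_upwards [hev] with ε hε
      filter_upwards with z
      rw [norm_mul, Real.norm_of_nonneg (RK_nonneg hN hα0 hα2 x z)]
      exact mul_le_mul_of_nonneg_left (hD ε hε.1 hε.2 z) (RK_nonneg hN hα0 hα2 x z)
    · convert (memL_RK hN hα0 hα2 x).const_mul D using 2
      ring
    · filter_upwards with z
      exact (h.Dop_tendsto hN0 hα0 hα2 z).const_mul _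
  have t2 : Tendsto (fun ε : ℝ => - (b0 N α * ∫ v, φ (x + ε • v) * greenB N α 0 v)) (𝓝[>] 0) (𝓝 (- (b0 N α * ∫ v, φ x * greenB N α 0 v))) := by
    apply Tendsto.neg
    apply Tendsto.const_mul
    apply tendsto_integral_filter_of_dominated_convergence (fun v => C * |greenB N α 0 v|)
    · filter_upwards with ε
      exact (Continuous.aestronglyMeasurable (by fun_prop)).mul hg1.aestronglyMeasurable
    · filter_upwards with ε
      filter_upwards with v
      rw [norm_mul, norm_eq_abs, norm_eq_abs]
      exact mul_le_mul_of_nonneg_right (h.bd _) (abs_nonneg _)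
    · exact hg1.abs.const_mul C
    · filter_upwards with v
      apply Tendsto.mul_const
      have : Continuous (fun ε : ℝ => φ (x + ε • v)) := by fun_prop
      have := this.tendsto 0
      simp only [zero_smul, add_zero] at this
      exact this.mono_left nhdsWithin_le_nhds
  have t3 := t1.congr' (f₂ := fun ε : ℝ => - (b0 N α * ∫ v, φ (x + ε • v) * greenB N α 0 v)) (by
    filter_upwards [hev] with ε hε
    exact h.riesz_eps hN hα0 hα2 hε.1 hε.2 x)
  rw [tendsto_nhds_unique t3 t2, integral_const_mul, hg2]
  field_simp



def PK {N : ℕ} (α : ℝ) (x y : EN N) : ℝ := (KE α x y).toReal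

lemma KE_ne_top {N : ℕ} (α : ℝ) (x y : EN N) : KE α x y ≠ ⊤ := by
  unfold KE; split_ifs <;> simp

lemma ofReal_PK {N : ℕ} (α : ℝ) (x y : EN N) : ENNReal.ofReal (PK α x y) = KE α x y :=
  ENNReal.ofReal_toReal (KE_ne_top α x y)

lemma PK_nonneg {N : ℕ} (α : ℝ) (x y : EN N) : 0 ≤ PK α x y := ENNReal.toReal_nonneg

lemma measurable_PK {N : ℕ} (α : ℝ) : Measurable (fun p : EN N × EN N => PK α p.1 p.2) :=
  (measurable_KE α).ennreal_toReal

lemma measurable_PK_right {N : ℕ} (α : ℝ) (x : EN N) : Measurable (fun y => PK α x y) :=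
  (measurable_KE_right α x).ennreal_toReal

lemma measurable_PK_left {N : ℕ} (α : ℝ) (y : EN N) : Measurable (fun x : EN N => PK α x y) :=
  (measurable_PK (N := N) α).of_uncurry_right (f := fun x y : EN N => PK α x y)

lemma PK_zero {N : ℕ} {α : ℝ} {x y : EN N} (hy : ‖y‖ ≤ 1) : PK α x y = 0 := by
  unfold PK KE; rw [if_neg (not_lt.2 hy)]; rfl

lemma PK_eq {N : ℕ} (hN : 0 < N) {α : ℝ} (hα0 : 0 < α) (hα2 : α < 2) {x y : EN N} (hx : ‖x‖ < 1) (hy : 1 < ‖y‖) :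
    PK α x y = poissonCoeff N α * (1 - ‖x‖ ^ 2) ^ (α / 2) * (‖y‖ ^ 2 - 1) ^ (-(α / 2)) * ‖x - y‖ ^ (-(N:ℝ)) := by
  have hc := poissonCoeff_pos hN hα0 hα2
  unfold PK KE
  rw [if_pos hy, poissonBall_eq hx hy, ENNReal.toReal_ofReal]
  have : 0 < 1 - ‖x‖ ^ 2 := by nlinarith [norm_nonneg x]
  have : 0 < ‖y‖ ^ 2 - 1 := by nlinarith
  positivity

lemma PK_eq_poisson {N : ℕ} (hN : 0 < N) {α : ℝ} (hα0 : 0 < α) (hα2 : α < 2) {x y : EN N} (hx : ‖x‖ < 1) (hy : 1 < ‖y‖) :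
    PK α x y = poissonBall N α 0 1 x y := by
  rw [PK_eq hN hα0 hα2 hx hy, poissonBall_eq hx hy]

lemma integrable_PK {N : ℕ} (hN : 3 ≤ N) {α : ℝ} (hα0 : 0 < α) (hα2 : α < 2) {x : EN N} (hx : ‖x‖ < 1) :
    Integrable (fun y => PK α x y) := by
  apply integrable_toReal_of_lintegral_ne_top (measurable_KE_right α x).aemeasurable
  rw [lint_KE (by omega) hα0 hα2 hx]; simp

lemma int_PK {N : ℕ} (hN : 3 ≤ N) {α : ℝ} (hα0 : 0 < α) (hα2 : α < 2) {x : EN N} (hx : ‖x‖ < 1) :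
    ∫ y, PK α x y = 1 := by
  unfold PK
  rw [integral_toReal (measurable_KE_right α x).aemeasurable, lint_KE (by omega) hα0 hα2 hx]; simp
  filter_upwards with z
  exact (KE_ne_top _ _ _).lt_top

lemma greenB_nonneg {N : ℕ} (hN : 3 ≤ N) {α : ℝ} (hα0 : 0 < α) (hα2 : α < 2) (x y : EN N) : 0 ≤ greenB N α x y := by
  rw [greenB_eq hN hα0 hα2]; exact ENNReal.toReal_nonneg

lemma greenB_le_RK {N : ℕ} (hN : 3 ≤ N) {α : ℝ} (hα0 : 0 < α) (hα2 : α < 2) (x y : EN N) : greenB N α x y ≤ RK α x y := by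
  rw [greenB_eq hN hα0 hα2]
  apply ENNReal.toReal_le_of_le_ofReal (RK_nonneg hN hα0 hα2 x y)
  exact GE_le_RE hN hα0 hα2 x y

lemma greenB_symm {N : ℕ} (hN : 3 ≤ N) {α : ℝ} (hα0 : 0 < α) (hα2 : α < 2) (x y : EN N) : greenB N α x y = greenB N α y x := by
  rw [greenB_eq hN hα0 hα2, greenB_eq hN hα0 hα2, GE_symm]

lemma measurable_greenB_right {N : ℕ} (hN : 3 ≤ N) {α : ℝ} (hα0 : 0 < α) (hα2 : α < 2) (x : EN N) : Measurable (fun y => greenB N α x y) := by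
  simp_rw [greenB_eq hN hα0 hα2]
  exact (measurable_GE_right α x).ennreal_toReal

/-- real form of sweep, with a bound -/
lemma sweep_real {N : ℕ} (hN : 3 ≤ N) {α : ℝ} (hα0 : 0 < α) (hα2 : α < 2) {x z : EN N} (hx : ‖x‖ < 1) (hxz : x ≠ z) :
    Integrable (fun y => PK α x y * RK α y z) ∧ RK α x z = greenB N α x z + ∫ y, PK α x y * RK α y z := by
  have h := sweep hN hα0 hα2 hx hxz
  have e : ∀ y, ENNReal.ofReal (PK α x y * RK α y z) = KE α x y * RE α y z := by
    intro y; rw [ENNReal.ofReal_mul (PK_nonneg _ _ _), ofReal_PK]; rfl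
  have hm : Measurable (fun y => PK α x y * RK α y z) := (measurable_PK_right α x).mul (by unfold RK; fun_prop)
  have hn : ∀ y, 0 ≤ PK α x y * RK α y z := fun y => mul_nonneg (PK_nonneg _ _ _) (RK_nonneg hN hα0 hα2 _ _)
  have hfin : ∫⁻ y, KE α x y * RE α y z ≠ ⊤ := by
    intro h'
    rw [h', add_top] at h
    exact ENNReal.ofReal_ne_top h
  constructor
  · rw [← lintegral_ofReal_ne_top_iff_integrable hm.aestronglyMeasurable (ae_of_all _ hn)]
    simp_rw [e]; exact hfin
  · rw [integral_eq_lintegral_of_nonneg_ae (ae_of_all _ hn) hm.aestronglyMeasurable]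
    simp_rw [e]
    have := congrArg ENNReal.toReal h
    rw [ENNReal.toReal_add (GE_ne_top hN hα0 hα2 _ _) hfin, RE, ENNReal.toReal_ofReal (RK_nonneg hN hα0 hα2 _ _)] at this
    rw [this, greenB_eq hN hα0 hα2]

lemma sweep_le {N : ℕ} (hN : 3 ≤ N) {α : ℝ} (hα0 : 0 < α) (hα2 : α < 2) {x z : EN N} (hx : ‖x‖ < 1) (hxz : x ≠ z) :
    ∫ y, PK α x y * RK α y z ≤ RK α x z := by
  have h1 := (sweep_real hN hα0 hα2 hx hxz).2
  have h2 := greenB_nonneg hN hα0 hα2 x z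
  linarith

lemma measurable_RK {N : ℕ} (α : ℝ) : Measurable (fun p : EN N × EN N => RK α p.1 p.2) := by
  unfold RK; fun_prop

lemma integrable_green_mul {N : ℕ} (hN : 3 ≤ N) {α : ℝ} (hα0 : 0 < α) (hα2 : α < 2) {x : EN N} {ψ : EN N → ℝ} 
    (hi : Integrable (fun z => RK α x z * ψ z)) (hψ : AEStronglyMeasurable ψ volume) : Integrable (fun z => greenB N α x z * ψ z) := by
  apply hi.mono ((measurable_greenB_right hN hα0 hα2 x).aestronglyMeasurable.mul hψ)
  filter_upwards with z
  show ‖greenB N α x z * ψ z‖ ≤ _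
  rw [norm_mul, norm_mul, Real.norm_of_nonneg (greenB_nonneg hN hα0 hα2 _ _), Real.norm_of_nonneg (RK_nonneg hN hα0 hα2 _ _)]
  exact mul_le_mul_of_nonneg_right (greenB_le_RK hN hα0 hα2 _ _) (norm_nonneg _)

lemma ae_ne {N : ℕ} (hN : 0 < N) (x : EN N) : ∀ᵐ z : EN N, x ≠ z := by
  have : Nonempty (Fin N) := ⟨⟨0, hN⟩⟩
  filter_upwards [compl_mem_ae_iff.2 (measure_singleton x)] with w hw
  exact fun h => hw h.symm

lemma sweep_pair {N : ℕ} (hN : 3 ≤ N) {α : ℝ} (hα0 : 0 < α) (hα2 : α < 2) {x : EN N} (hx : ‖x‖ < 1) {ψ : EN N → ℝ} (hψ : AEStronglyMeasurable ψ volume)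
    (hi : Integrable (fun z => RK α x z * ψ z)) :
    ∫ z, RK α x z * ψ z = (∫ z, greenB N α x z * ψ z) + ∫ y, PK α x y * ∫ z, RK α y z * ψ z := by
  have hN0 : 0 < N := by omega
  have hg := integrable_green_mul hN hα0 hα2 hi hψ
  have hp : Integrable (fun q : EN N × EN N => PK α x q.2 * (RK α q.2 q.1 * ψ q.1)) (volume.prod volume) := by
    have hsm : AEStronglyMeasurable (fun q : EN N × EN N => PK α x q.2 * (RK α q.2 q.1 * ψ q.1)) (volume.prod volume) := by
      apply AEStronglyMeasurable.mul
      · exact ((measurable_PK_right α x).comp measurable_snd).aestronglyMeasurable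
      · apply AEStronglyMeasurable.mul
        · exact ((measurable_RK α).comp measurable_swap).aestronglyMeasurable
        · exact hψ.comp_fst
    rw [integrable_prod_iff hsm]
    constructor
    · filter_upwards [ae_ne hN0 x] with z hz
      convert (sweep_real hN hα0 hα2 hx hz).1.mul_const (ψ z) using 2
      ring
    · apply hi.norm.mono' hsm.norm.integral_prod_right'
      filter_upwards [ae_ne hN0 x] with z hz
      have : ∀ y, ‖PK α x y * (RK α y z * ψ z)‖ = PK α x y * RK α y z * ‖ψ z‖ := by
        intro y
        rw [norm_mul, norm_mul, Real.norm_of_nonneg (PK_nonneg _ _ _), Real.norm_of_nonneg (RK_nonneg hN hα0 hα2 _ _)]; ring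
      simp only [this]
      rw [integral_mul_const, norm_mul, norm_norm, norm_mul, Real.norm_of_nonneg (RK_nonneg hN hα0 hα2 x z),
        Real.norm_of_nonneg (integral_nonneg (fun y => mul_nonneg (PK_nonneg _ _ _) (RK_nonneg hN hα0 hα2 _ _)))]
      exact mul_le_mul_of_nonneg_right (sweep_le hN hα0 hα2 hx hz) (norm_nonneg _)
  have e1 : ∫ y, PK α x y * ∫ z, RK α y z * ψ z = ∫ z, ∫ y, PK α x y * (RK α y z * ψ z) := by
    rw [integral_integral_swap hp]
    simp_rw [integral_const_mul]
  rw [e1, ← integral_add hg hp.integral_prod_left]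
  apply integral_congr_ae
  filter_upwards [ae_ne hN0 x] with z hz
  rw [(sweep_real hN hα0 hα2 hx hz).2, add_mul, ← integral_mul_const]
  congr 2; ext y; ring

lemma integrable_RK_LapS {N : ℕ} (hN : 3 ≤ N) {α : ℝ} (hα0 : 0 < α) (hα2 : α < 2) {φ : EN N → ℝ} {C R : ℝ} (h : TF φ C R) (x : EN N) :
    Integrable (fun z => RK α x z * LapS N α φ z) := by
  obtain ⟨D, hD0, hD⟩ := h.LapS_bound (by omega) hα0 hα2
  exact memL_mul (memL_RK hN hα0 hα2 x) h.measurable_LapS.aestronglyMeasurable hD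

theorem green_pair {N : ℕ} (hN : 3 ≤ N) {α : ℝ} (hα0 : 0 < α) (hα2 : α < 2) {φ : EN N → ℝ} {C R : ℝ} (h : TF φ C R) 
    (hs : ∀ z, 1 ≤ ‖z‖ → φ z = 0) (x : EN N) : 
    ∫ z, greenB N α x z * LapS N α φ z = - φ x := by
  by_cases hx : ‖x‖ < 1
  · have h1 := sweep_pair hN hα0 hα2 hx h.measurable_LapS.aestronglyMeasurable (integrable_RK_LapS hN hα0 hα2 h x)
    simp_rw [h.riesz hN hα0 hα2] at h1
    have h2 : ∫ y, PK α x y * - φ y = 0 := by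
      rw [integral_eq_zero_of_ae]
      filter_upwards with y
      by_cases hy : ‖y‖ ≤ 1
      · rw [PK_zero hy]; simp
      · rw [hs y (by linarith)]; simp
    rw [h2] at h1
    linarith
  · rw [hs x (not_lt.1 hx)]
    unfold greenB
    simp [hx]

/-- potentials of bounded integrable functions are bounded -/
lemma RK_le_nr {N : ℕ} (hN : 3 ≤ N) {α : ℝ} (hα0 : 0 < α) (hα2 : α < 2) {R : ℝ} (hR : 0 < R) (x z : EN N) : RK α x z ≤ greenCoeff N α * bA N α * (nr N α R (x - z) + R ^ (α - (N:ℝ))) := by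
  have hNr : (3:ℝ) ≤ N := by exact_mod_cast hN
  have hc : 0 ≤ greenCoeff N α * bA N α := by
    have := greenCoeff_pos (show 0 < N by omega) hα0
    have := bA_pos hN hα0 hα2
    positivity
  unfold RK
  exact mul_le_mul_of_nonneg_left (rk_le_nr (by linarith) _ hR) hc

lemma pot_bound {N : ℕ} (hN : 3 ≤ N) {α : ℝ} (hα0 : 0 < α) (hα2 : α < 2) {ψ : EN N → ℝ} (hψ : Integrable ψ) {D : ℝ} (hD : ∀ z, |ψ z| ≤ D) :
    ∃ M, 0 ≤ M ∧ ∀ x, Integrable (fun z => RK α x z * ψ z) ∧ ∫ z, RK α x z * |ψ z| ≤ M := by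
  have hN0 : 0 < N := by omega
  have hc : 0 ≤ greenCoeff N α * bA N α := by
    have := greenCoeff_pos hN0 hα0
    have := bA_pos hN hα0 hα2
    positivity
  have hD0 : 0 ≤ D := (abs_nonneg _).trans (hD 0)
  have i0 := integrable_nr hN0 hα0 one_pos
  set I := ∫ z, nr N α 1 z
  have hI : 0 ≤ I := integral_nonneg (nr_nonneg N α 1)
  have hJ : 0 ≤ ∫ z, |ψ z| := integral_nonneg (fun z => abs_nonneg _)
  refine ⟨greenCoeff N α * bA N α * (I * D + ∫ z, |ψ z|), by positivity, fun x => ?_⟩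
  have i1 : Integrable (fun z => nr N α 1 (x - z)) := i0.comp_sub_left x
  have key : ∀ z, RK α x z * |ψ z| ≤ greenCoeff N α * bA N α * (nr N α 1 (x - z) * D + |ψ z|) := by
    intro z
    have h1 := RK_le_nr hN hα0 hα2 one_pos x z
    rw [one_rpow] at h1
    have h2 := mul_le_mul_of_nonneg_right h1 (abs_nonneg (ψ z))
    have h3 := mul_le_mul_of_nonneg_left (hD z) (mul_nonneg hc (nr_nonneg N α 1 (x - z)))
    nlinarith
  have ib := ((i1.mul_const D).add hψ.abs).const_mul (greenCoeff N α * bA N α)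
  have i2 : Integrable (fun z => RK α x z * ψ z) := by
    apply ib.mono' ((measurable_RK_right α x).aestronglyMeasurable.mul hψ.aestronglyMeasurable)
    filter_upwards with z
    show ‖RK α x z * ψ z‖ ≤ _
    rw [norm_mul, Real.norm_of_nonneg (RK_nonneg hN hα0 hα2 _ _)]
    exact key z
  refine ⟨i2, ?_⟩
  have i3 : Integrable (fun z => RK α x z * |ψ z|) := by
    convert i2.norm using 2 with z
    rw [norm_mul, Real.norm_of_nonneg (RK_nonneg hN hα0 hα2 _ _), norm_eq_abs]
  calc _ ≤ ∫ z, greenCoeff N α * bA N α * (nr N α 1 (x - z) * D + |ψ z|) := integral_mono i3 ib key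
    _ = _ := by
      rw [integral_const_mul, integral_add (i1.mul_const D) hψ.abs, integral_mul_const, integral_sub_left_eq_self (nr N α 1)]



lemma TF.integrable_LapS {N : ℕ} (hN : 3 ≤ N) {α : ℝ} (hα0 : 0 < α) (hα2 : α < 2) {φ : EN N → ℝ} {C R : ℝ} (h : TF φ C R) :
    Integrable (LapS N α φ) := by
  obtain ⟨D, hD0, hD⟩ := h.LapS_bound (by omega) hα0 hα2
  apply ((memL_bdd (N := N) hα0).const_mul D).mono' h.measurable_LapS.aestronglyMeasurable
  filter_upwards with z
  exact hD z

lemma TF.LapS_bdd {N : ℕ} (hN : 3 ≤ N) {α : ℝ} (hα0 : 0 < α) (hα2 : α < 2) {φ : EN N → ℝ} {C R : ℝ} (h : TF φ C R) :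
    ∃ D, 0 ≤ D ∧ ∀ z, |LapS N α φ z| ≤ D := by
  obtain ⟨D, hD0, hD⟩ := h.LapS_bound (by omega) hα0 hα2
  refine ⟨D, hD0, fun z => (hD z).trans ?_⟩
  apply mul_le_of_le_one_right hD0
  apply rpow_le_one_of_one_le_of_nonpos (by linarith [norm_nonneg z])
  have : (0:ℝ) ≤ N := by positivity
  linarith

/-- LapS cut to the ball -/
def LB (N : ℕ) (α : ℝ) (φ : EN N → ℝ) (x : EN N) : ℝ := (ball (0 : EN N) 1).indicator (LapS N α φ) x

lemma LB_in {N : ℕ} {α : ℝ} {φ : EN N → ℝ} {x : EN N} (hx : ‖x‖ < 1) : LB N α φ x = LapS N α φ x := by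
  unfold LB; rw [indicator_of_mem]; simpa using hx

lemma LB_out {N : ℕ} {α : ℝ} {φ : EN N → ℝ} {x : EN N} (hx : ¬ ‖x‖ < 1) : LB N α φ x = 0 := by
  unfold LB; rw [indicator_of_notMem]; simpa using hx

lemma TF.measurable_LB {N : ℕ} {α : ℝ} {φ : EN N → ℝ} {C R : ℝ} (h : TF φ C R) : Measurable (LB N α φ) :=
  h.measurable_LapS.indicator measurableSet_ball

lemma abs_LB_le {N : ℕ} {α : ℝ} {φ : EN N → ℝ} (x : EN N) : |LB N α φ x| ≤ |LapS N α φ x| := by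
  by_cases hx : ‖x‖ < 1
  · rw [LB_in hx]
  · rw [LB_out hx]; simp

lemma TF.integrable_LB {N : ℕ} (hN : 3 ≤ N) {α : ℝ} (hα0 : 0 < α) (hα2 : α < 2) {φ : EN N → ℝ} {C R : ℝ} (h : TF φ C R) :
    Integrable (LB N α φ) :=
  (h.integrable_LapS hN hα0 hα2).indicator measurableSet_ball

def nuB (N : ℕ) (α : ℝ) (φ : EN N → ℝ) (y : EN N) : ℝ := ∫ x, LB N α φ x * PK α x y

lemma TF.nu_prod {N : ℕ} (hN : 3 ≤ N) {α : ℝ} (hα0 : 0 < α) (hα2 : α < 2) {φ : EN N → ℝ} {C R : ℝ} (h : TF φ C R) :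
    Integrable (fun q : EN N × EN N => LB N α φ q.1 * PK α q.1 q.2) (volume.prod volume) := by
  have hsm : AEStronglyMeasurable (fun q : EN N × EN N => LB N α φ q.1 * PK α q.1 q.2) (volume.prod volume) :=
    ((h.measurable_LB.comp measurable_fst).mul (measurable_PK α)).aestronglyMeasurable
  rw [integrable_prod_iff hsm]
  constructor
  · filter_upwards with x
    by_cases hx : ‖x‖ < 1
    · exact (integrable_PK hN hα0 hα2 hx).const_mul _
    · simp only [LB_out hx, zero_mul]; exact integrable_zero _ _ _
  · apply (h.integrable_LB hN hα0 hα2).norm.congr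
    filter_upwards with x
    by_cases hx : ‖x‖ < 1
    · have : ∀ y, ‖LB N α φ x * PK α x y‖ = ‖LB N α φ x‖ * PK α x y := by
        intro y; rw [norm_mul, Real.norm_of_nonneg (PK_nonneg _ _ _)]
      simp only [this]
      rw [integral_const_mul, int_PK hN hα0 hα2 hx, mul_one]
    · simp [LB_out hx]

lemma TF.nu_pot {N : ℕ} (hN : 3 ≤ N) {α : ℝ} (hα0 : 0 < α) (hα2 : α < 2) {φ : EN N → ℝ} {C R : ℝ} (h : TF φ C R) 
    (hs : ∀ z, 1 ≤ ‖z‖ → φ z = 0) (z : EN N) : 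
    Integrable (fun y => RK α z y * nuB N α φ y) ∧ Integrable (fun y => RK α z y * LB N α φ y) ∧ 
    ∫ y, RK α z y * nuB N α φ y = (∫ x, RK α z x * LB N α φ x) + φ z := by
  have hN0 : 0 < N := by omega
  obtain ⟨D, hD0, hD⟩ := h.LapS_bdd hN hα0 hα2
  obtain ⟨M, hM0, hM⟩ := pot_bound hN hα0 hα2 (h.integrable_LB hN hα0 hα2) (fun z => (abs_LB_le z).trans (hD z))
  have hi := (hM z).1
  have hp : Integrable (fun q : EN N × EN N => LB N α φ q.1 * (PK α q.1 q.2 * RK α q.2 z)) (volume.prod volume) := by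
    have hsm : AEStronglyMeasurable (fun q : EN N × EN N => LB N α φ q.1 * (PK α q.1 q.2 * RK α q.2 z)) (volume.prod volume) := by
      apply Measurable.aestronglyMeasurable
      apply (h.measurable_LB.comp measurable_fst).mul
      apply (measurable_PK α).mul
      unfold RK; fun_prop
    rw [integrable_prod_iff hsm]
    constructor
    · filter_upwards [ae_ne hN0 z] with x hx
      by_cases hx1 : ‖x‖ < 1
      · exact (sweep_real hN hα0 hα2 hx1 hx.symm).1.const_mul _
      · simp only [LB_out hx1, zero_mul]; exact integrable_zero _ _ _
    · apply hi.norm.mono' hsm.norm.integral_prod_right'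
      filter_upwards [ae_ne hN0 z] with x hx
      by_cases hx1 : ‖x‖ < 1
      · have : ∀ y, ‖LB N α φ x * (PK α x y * RK α y z)‖ = ‖LB N α φ x‖ * (PK α x y * RK α y z) := by
          intro y; rw [norm_mul, Real.norm_of_nonneg (mul_nonneg (PK_nonneg _ _ _) (RK_nonneg hN hα0 hα2 _ _))]
        simp only [this]
        rw [integral_const_mul, norm_mul, norm_norm, norm_mul, mul_comm, Real.norm_of_nonneg (RK_nonneg hN hα0 hα2 z x),
          Real.norm_of_nonneg (integral_nonneg (fun y => mul_nonneg (PK_nonneg _ _ _) (RK_nonneg hN hα0 hα2 _ _))), RK_symm z x]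
        exact mul_le_mul_of_nonneg_right (sweep_le hN hα0 hα2 hx1 hx.symm) (norm_nonneg _)
      · simp [LB_out hx1]
  have e0 : ∀ y, RK α z y * nuB N α φ y = ∫ x, LB N α φ x * (PK α x y * RK α y z) := by
    intro y
    unfold nuB
    rw [← integral_const_mul]
    congr 1; ext x; rw [RK_symm z y]; ring
  refine ⟨?_, hi, ?_⟩
  · simp_rw [e0]; exact hp.integral_prod_right
  simp_rw [e0]
  rw [← integral_integral_swap hp]
  have e1 : ∀ᵐ x, ∫ y, LB N α φ x * (PK α x y * RK α y z) = RK α z x * LB N α φ x - greenB N α z x * LapS N α φ x := by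
    filter_upwards [ae_ne hN0 z] with x hx
    by_cases hx1 : ‖x‖ < 1
    · rw [integral_const_mul, LB_in hx1, RK_symm z x, (sweep_real hN hα0 hα2 hx1 hx.symm).2, greenB_symm hN hα0 hα2 x z]
      ring
    · have : greenB N α z x = 0 := by unfold greenB; simp [hx1]
      simp [LB_out hx1, this]
  rw [integral_congr_ae e1, integral_sub hi, green_pair hN hα0 hα2 h hs]
  · ring
  · exact integrable_green_mul hN hα0 hα2 (integrable_RK_LapS hN hα0 hα2 h z) h.measurable_LapS.aestronglyMeasurable

theorem TF.nu_eq {N : ℕ} (hN : 3 ≤ N) {α : ℝ} (hα0 : 0 < α) (hα2 : α < 2) {φ : EN N → ℝ} {C R : ℝ} (h : TF φ C R) 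
    (hs : ∀ z, 1 ≤ ‖z‖ → φ z = 0) : ∀ᵐ y, nuB N α φ y = LB N α φ y - LapS N α φ y := by
  have hN0 : 0 < N := by omega
  set μ : EN N → ℝ := fun y => nuB N α φ y + (LapS N α φ y - LB N α φ y) with hμ
  have iν : Integrable (nuB N α φ) := (h.nu_prod hN hα0 hα2).integral_prod_right
  have iμ : Integrable μ := iν.add ((h.integrable_LapS hN hα0 hα2).sub (h.integrable_LB hN hα0 hα2))
  have pot0 : ∀ z, ∫ y, RK α z y * μ y = 0 := by
    intro z
    obtain ⟨i1, i2, e⟩ := h.nu_pot hN hα0 hα2 hs z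
    have i3 := integrable_RK_LapS hN hα0 hα2 h z
    simp only [hμ, mul_add, mul_sub]
    have i4 : Integrable (fun y => RK α z y * LapS N α φ y - RK α z y * LB N α φ y) := i3.sub i2
    rw [integral_add i1 i4, integral_sub i3 i2, e, h.riesz hN hα0 hα2]
    ring
  have key : ∀ᵐ y, μ y = 0 := by
    apply ae_eq_zero_of_integral_contDiff_smul_eq_zero iμ.locallyIntegrable
    intro η hη hηc
    obtain ⟨C', R', h'⟩ := exists_TF hη hηc
    obtain ⟨D, hD0, hD⟩ := h'.LapS_bdd hN hα0 hα2
    obtain ⟨M, hM0, hM⟩ := pot_bound hN hα0 hα2 (h'.integrable_LapS hN hα0 hα2) hD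
    have hp : Integrable (fun q : EN N × EN N => μ q.1 * (RK α q.1 q.2 * LapS N α η q.2)) (volume.prod volume) := by
      have hsm : AEStronglyMeasurable (fun q : EN N × EN N => μ q.1 * (RK α q.1 q.2 * LapS N α η q.2)) (volume.prod volume) := by
        apply iμ.aestronglyMeasurable.comp_fst.mul
        exact ((measurable_RK α).mul (h'.measurable_LapS.comp measurable_snd)).aestronglyMeasurable
      rw [integrable_prod_iff hsm]
      constructor
      · filter_upwards with y
        exact (hM y).1.const_mul _
      · apply (iμ.norm.mul_const M).mono' hsm.norm.integral_prod_right'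
        filter_upwards with y
        have : ∀ z, ‖μ y * (RK α y z * LapS N α η z)‖ = ‖μ y‖ * (RK α y z * |LapS N α η z|) := by
          intro z; rw [norm_mul, norm_mul, Real.norm_of_nonneg (RK_nonneg hN hα0 hα2 _ _), norm_eq_abs (LapS _ _ _ _)]
        simp only [this]
        rw [integral_const_mul, norm_mul, norm_norm, Real.norm_of_nonneg (integral_nonneg (fun z => mul_nonneg (RK_nonneg hN hα0 hα2 _ _) (abs_nonneg _)))]
        exact mul_le_mul_of_nonneg_left (hM y).2 (norm_nonneg _)
    have e1 := integral_integral_swap (f := fun y z => μ y * (RK α y z * LapS N α η z)) hp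
    simp_rw [integral_const_mul, h'.riesz hN hα0 hα2] at e1
    have e2 : ∀ z, ∫ y, μ y * (RK α y z * LapS N α η z) = 0 := by
      intro z
      have : ∀ y, μ y * (RK α y z * LapS N α η z) = RK α z y * μ y * LapS N α η z := by
        intro y; rw [RK_symm y z]; ring
      simp_rw [this]
      rw [integral_mul_const, pot0, zero_mul]
    simp_rw [e2] at e1
    simp only [mul_neg, integral_neg, integral_zero, neg_eq_zero] at e1
    simp_rw [smul_eq_mul, mul_comm (η _)]
    exact e1
  filter_upwards [key] with y hy
  simp only [hμ] at hy
  linarith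

/-- harmonicity of the Poisson integral -/
theorem TF.Hf_pair {N : ℕ} (hN : 3 ≤ N) {α : ℝ} (hα0 : 0 < α) (hα2 : α < 2) {φ : EN N → ℝ} {C R : ℝ} (h : TF φ C R) 
    (hs : ∀ z, 1 ≤ ‖z‖ → φ z = 0) {f : EN N → ℝ} (hf : Measurable f) (hf0 : ∀ x, 0 ≤ f x) {M : ℝ}
    (hfi : ∀ x, ‖x‖ < 1 → Integrable (fun y => PK α x y * f y)) (hM : ∀ x, ‖x‖ < 1 → ∫ y, PK α x y * f y ≤ M) :
    ∫ x, LB N α φ x * ∫ y, PK α x y * f y = - ∫ y in {y : EN N | 1 < ‖y‖}, f y * LapS N α φ y := by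
  have hN0 : 0 < N := by omega
  have hp : Integrable (fun q : EN N × EN N => LB N α φ q.1 * (PK α q.1 q.2 * f q.2)) (volume.prod volume) := by
    have hsm : AEStronglyMeasurable (fun q : EN N × EN N => LB N α φ q.1 * (PK α q.1 q.2 * f q.2)) (volume.prod volume) := by
      apply Measurable.aestronglyMeasurable
      exact (h.measurable_LB.comp measurable_fst).mul ((measurable_PK α).mul (hf.comp measurable_snd))
    rw [integrable_prod_iff hsm]
    constructor
    · filter_upwards with x
      by_cases hx1 : ‖x‖ < 1
      · exact (hfi x hx1).const_mul _
      · simp only [LB_out hx1, zero_mul]; exact integrable_zero _ _ _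
    · apply ((h.integrable_LB hN hα0 hα2).norm.mul_const M).mono' hsm.norm.integral_prod_right'
      filter_upwards with x
      by_cases hx1 : ‖x‖ < 1
      · have : ∀ y, ‖LB N α φ x * (PK α x y * f y)‖ = ‖LB N α φ x‖ * (PK α x y * f y) := by
          intro y; rw [norm_mul, Real.norm_of_nonneg (mul_nonneg (PK_nonneg _ _ _) (hf0 _))]
        simp only [this]
        rw [integral_const_mul, norm_mul, norm_norm, 
          Real.norm_of_nonneg (integral_nonneg (fun y => mul_nonneg (PK_nonneg _ _ _) (hf0 _)))]
        exact mul_le_mul_of_nonneg_left (hM x hx1) (norm_nonneg _)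
      · simp [LB_out hx1]
  simp_rw [← integral_const_mul]
  rw [integral_integral_swap hp, ← integral_neg, ← integral_indicator (measurableSet_lt (by fun_prop) (by fun_prop))]
  apply integral_congr_ae
  filter_upwards [h.nu_eq hN hα0 hα2 hs] with y hy
  have e : ∫ x, LB N α φ x * (PK α x y * f y) = nuB N α φ y * f y := by
    unfold nuB; rw [← integral_mul_const]; congr 1; ext x; ring
  rw [e]
  by_cases hy1 : 1 < ‖y‖
  · rw [indicator_of_mem (by exact hy1), hy, LB_out (by linarith)]; ring
  · rw [indicator_of_notMem (by exact hy1)]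
    unfold nuB
    simp [PK_zero (not_lt.1 hy1)]



lemma near_bdd {N : ℕ} {f : EN N → ℝ} (hfc : ∀ z : EN N, ‖z‖ = 1 → ContinuousAt f z) :
    ∃ ρ M, 1 < ρ ∧ 0 ≤ M ∧ ∀ y, 1 ≤ ‖y‖ → ‖y‖ < ρ → |f y| ≤ M := by
  have hc : IsCompact (sphere (0 : EN N) 1) := isCompact_sphere _ _
  have : ∃ M : ℝ, ∀ᶠ y in 𝓝ˢ (sphere (0 : EN N) 1), |f y| ≤ M := by
    refine hc.induction_on (p := fun s => ∃ M : ℝ, ∀ᶠ y in 𝓝ˢ s, |f y| ≤ M) ⟨0, by simp⟩ ?_ ?_ ?_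
    · rintro s t hst ⟨M, hM⟩
      exact ⟨M, hM.filter_mono (nhdsSet_mono hst)⟩
    · rintro s t ⟨M, hM⟩ ⟨M', hM'⟩
      refine ⟨max M M', ?_⟩
      rw [nhdsSet_union, eventually_sup]
      exact ⟨hM.mono fun y hy => hy.trans (le_max_left _ _), hM'.mono fun y hy => hy.trans (le_max_right _ _)⟩
    · intro z hz
      have h1 : ∀ᶠ y in 𝓝 z, |f y| < |f z| + 1 := (hfc z (by simpa using hz)).abs.eventually_lt continuousAt_const (by linarith)
      obtain ⟨U, hU, hUo, hzU⟩ := _root_.eventually_nhds_iff.1 h1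
      refine ⟨U, mem_nhdsWithin_of_mem_nhds (hUo.mem_nhds hzU), |f z| + 1, ?_⟩
      rw [hUo.nhdsSet_eq]
      exact fun y hy => (hU y hy).le
  obtain ⟨M, hM⟩ := this
  obtain ⟨δ, hδ, hsub⟩ := (hasBasis_nhdsSet_thickening hc).eventually_iff.1 hM
  refine ⟨1 + δ, max M 0, by linarith, le_max_right _ _, fun y h1 h2 => (hsub ?_).trans (le_max_left _ _)⟩
  rw [mem_thickening_iff]
  have h0 : 0 < ‖y‖ := by linarith
  refine ⟨‖y‖⁻¹ • y, ?_, ?_⟩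
  · simp [norm_smul, h0.ne']
  · rw [dist_eq_norm]
    have : y - ‖y‖⁻¹ • y = (1 - ‖y‖⁻¹) • y := by rw [sub_smul, one_smul]
    rw [this, norm_smul, Real.norm_of_nonneg (by rw [sub_nonneg]; exact inv_le_one_of_one_le₀ h1), sub_mul, inv_mul_cancel₀ h0.ne']
    linarith

lemma PK0_eq {N : ℕ} (hN : 0 < N) {α : ℝ} (hα0 : 0 < α) (hα2 : α < 2) {y : EN N} (hy : 1 < ‖y‖) :
    PK α 0 y = poissonCoeff N α * (‖y‖ ^ 2 - 1) ^ (-(α / 2)) * ‖y‖ ^ (-(N:ℝ)) := by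
  rw [PK_eq hN hα0 hα2 (by simp) hy]
  simp only [norm_zero, zero_sub, norm_neg]
  rw [show (1:ℝ) - 0 ^ 2 = 1 by norm_num, one_rpow, mul_one]

lemma PK0_le {N : ℕ} (hN : 0 < N) {α : ℝ} (hα0 : 0 < α) (hα2 : α < 2) {ρ : ℝ} (hρ : 1 < ρ) {y : EN N} (hy : ρ ≤ ‖y‖) :
    PK α 0 y ≤ poissonCoeff N α * ((ρ - 1) / (ρ + 1)) ^ (-(N + α)) * (1 + ‖y‖) ^ (-((N:ℝ) + α)) := by
  have hc := poissonCoeff_pos hN hα0 hα2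
  rw [PK0_eq hN hα0 hα2 (by linarith)]
  set s := (ρ - 1) / (ρ + 1) with hs
  have hs0 : 0 < s := div_pos (by linarith) (by linarith)
  have h1 : s * (1 + ‖y‖) ≤ ‖y‖ - 1 := by
    rw [hs, div_mul_eq_mul_div, div_le_iff₀ (by linarith)]
    nlinarith
  have h2 : 0 < s * (1 + ‖y‖) := by positivity
  have h3 : (s * (1 + ‖y‖)) ^ 2 ≤ ‖y‖ ^ 2 - 1 := by nlinarith
  have h4 : (‖y‖ ^ 2 - 1) ^ (-(α / 2)) ≤ (s * (1 + ‖y‖)) ^ (-α) := by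
    calc _ ≤ ((s * (1 + ‖y‖)) ^ 2) ^ (-(α / 2)) := rpow_le_rpow_of_nonpos (by positivity) h3 (by linarith)
      _ = _ := by rw [← neg_div, sq_rpow_half h2.le]
  have h5 : ‖y‖ ^ (-(N:ℝ)) ≤ (s * (1 + ‖y‖)) ^ (-(N:ℝ)) := 
    rpow_le_rpow_of_nonpos h2 (by linarith) (by simp)
  have h6 : (s * (1 + ‖y‖)) ^ (-α) * (s * (1 + ‖y‖)) ^ (-(N:ℝ)) = s ^ (-(N + α)) * (1 + ‖y‖) ^ (-((N:ℝ) + α)) := by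
    rw [← rpow_add h2, ← mul_rpow hs0.le (by positivity)]; congr 1; ring
  rw [mul_assoc, mul_assoc, ← h6]
  gcongr

lemma PK_compare {N : ℕ} (hN : 0 < N) {α : ℝ} (hα0 : 0 < α) (hα2 : α < 2) {x y : EN N} (hx : ‖x‖ < 1) {A : ℝ} (hA : 0 < A) (hy : ‖y‖ ≤ A * ‖x - y‖) :
    PK α x y ≤ A ^ (N:ℝ) * (1 - ‖x‖ ^ 2) ^ (α / 2) * PK α 0 y := by
  have hc := poissonCoeff_pos hN hα0 hα2
  by_cases h1 : 1 < ‖y‖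
  · rw [PK_eq hN hα0 hα2 hx h1, PK0_eq hN hα0 hα2 h1]
    have h2 : 0 < ‖x - y‖ := by
      by_contra h
      have : ‖x - y‖ = 0 := le_antisymm (not_lt.1 h) (norm_nonneg _)
      rw [this] at hy; linarith
    have h3 : ‖x - y‖ ^ (-(N:ℝ)) ≤ A ^ (N:ℝ) * ‖y‖ ^ (-(N:ℝ)) := by
      have : (A * ‖x - y‖) ^ (-(N:ℝ)) ≤ ‖y‖ ^ (-(N:ℝ)) := rpow_le_rpow_of_nonpos (by linarith) hy (by simp)
      rw [mul_rpow hA.le h2.le] at this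
      have h4 := mul_le_mul_of_nonneg_left this (show 0 ≤ A ^ (N:ℝ) by positivity)
      rwa [← mul_assoc, ← rpow_add hA, add_neg_cancel, rpow_zero, one_mul] at h4
    have hx2 : 0 < 1 - ‖x‖ ^ 2 := by nlinarith [norm_nonneg x]
    have hy2 : 0 < ‖y‖ ^ 2 - 1 := by nlinarith
    calc _ ≤ poissonCoeff N α * (1 - ‖x‖ ^ 2) ^ (α / 2) * (‖y‖ ^ 2 - 1) ^ (-(α / 2)) * (A ^ (N:ℝ) * ‖y‖ ^ (-(N:ℝ))) := by gcongr
      _ = _ := by ring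
  · rw [PK_zero (not_lt.1 h1), PK_zero (not_lt.1 h1), mul_zero]

lemma PK_compare' {N : ℕ} (hN : 0 < N) {α : ℝ} (hα0 : 0 < α) (hα2 : α < 2) {x y : EN N} {r : ℝ} (hr : r < 1) (hx : ‖x‖ ≤ r) :
    PK α x y ≤ ((1 - r)⁻¹) ^ (N:ℝ) * PK α 0 y := by
  have hr' : 0 < 1 - r := by linarith
  by_cases h1 : 1 < ‖y‖
  · have := PK_compare hN hα0 hα2 (x := x) (y := y) (by linarith) (A := (1 - r)⁻¹) (by positivity) (by
      rw [inv_mul_eq_div, le_div_iff₀ hr']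
      have := norm_sub_norm_le y x
      rw [norm_sub_rev] at this
      nlinarith [norm_nonneg x])
    refine this.trans ?_
    gcongr
    · exact PK_nonneg _ _ _
    · apply mul_le_of_le_one_right (by positivity)
      apply rpow_le_one
      · nlinarith [norm_nonneg x]
      · nlinarith [norm_nonneg x]
      · linarith
  · rw [PK_zero (not_lt.1 h1), PK_zero (not_lt.1 h1), mul_zero]

lemma integrable_PK0_mul {N : ℕ} (hN : 3 ≤ N) {α : ℝ} (hα0 : 0 < α) (hα2 : α < 2) {f : EN N → ℝ} (hf : Measurable f) 
    (hL : memLalpha N α f) (hfc : ∀ z : EN N, ‖z‖ = 1 → ContinuousAt f z) : Integrable (fun y => PK α 0 y * f y) := by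
  obtain ⟨ρ, M, hρ, hM0, hM⟩ := near_bdd hfc
  have hc := poissonCoeff_pos (show 0 < N by omega) hα0 hα2
  set A := poissonCoeff N α * ((ρ - 1) / (ρ + 1)) ^ (-(N + α)) with hA
  have hA0 : 0 ≤ A := by
    have : 0 < (ρ - 1) / (ρ + 1) := div_pos (by linarith) (by linarith)
    positivity
  have i1 := (integrable_PK hN hα0 hα2 (x := (0 : EN N)) (by simp)).const_mul M
  apply (i1.add (hL.norm.const_mul A)).mono' ((measurable_PK_right α 0).mul hf).aestronglyMeasurable
  filter_upwards with y
  show ‖PK α 0 y * f y‖ ≤ M * PK α 0 y + A * ‖f y * (1 + ‖y‖) ^ (-((N:ℝ) + α))‖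
  have hP := PK_nonneg α 0 y
  rw [norm_mul, Real.norm_of_nonneg hP]
  have h2 : 0 ≤ A * ‖f y * (1 + ‖y‖) ^ (-((N:ℝ) + α))‖ := by positivity
  by_cases h1 : 1 < ‖y‖
  · by_cases h3 : ‖y‖ < ρ
    · have := hM y h1.le h3
      rw [norm_eq_abs]
      have := mul_le_mul_of_nonneg_left this hP
      linarith
    · have := PK0_le (show 0 < N by omega) hα0 hα2 hρ (not_lt.1 h3)
      rw [norm_mul, Real.norm_of_nonneg (show 0 ≤ (1 + ‖y‖) ^ (-((N:ℝ) + α)) by positivity)]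
      have h5 := mul_le_mul_of_nonneg_right this (norm_nonneg (f y))
      have h6 : 0 ≤ M * PK α 0 y := by positivity
      rw [← hA] at h5
      linarith
  · rw [PK_zero (not_lt.1 h1)]; linarith

lemma integrable_PK_mul {N : ℕ} (hN : 3 ≤ N) {α : ℝ} (hα0 : 0 < α) (hα2 : α < 2) {f : EN N → ℝ} (hf : Measurable f) 
    (hi : Integrable (fun y => PK α 0 y * f y)) {x : EN N} (hx : ‖x‖ < 1) : Integrable (fun y => PK α x y * f y) := by
  apply (hi.norm.const_mul (((1 - ‖x‖)⁻¹) ^ (N:ℝ))).mono' ((measurable_PK_right α x).mul hf).aestronglyMeasurable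
  filter_upwards with y
  show ‖PK α x y * f y‖ ≤ _
  have := PK_compare' (show 0 < N by omega) hα0 hα2 (y := y) hx le_rfl
  rw [norm_mul, Real.norm_of_nonneg (PK_nonneg _ _ _), norm_mul, Real.norm_of_nonneg (PK_nonneg _ _ _), ← mul_assoc]
  exact mul_le_mul_of_nonneg_right this (norm_nonneg _)

def Hext {N : ℕ} (α : ℝ) (f : EN N → ℝ) (x : EN N) : ℝ := if ‖x‖ < 1 then ∫ y, PK α x y * f y else f x

lemma Hext_in {N : ℕ} {α : ℝ} {f : EN N → ℝ} {x : EN N} (hx : ‖x‖ < 1) : Hext α f x = ∫ y, PK α x y * f y := if_pos hx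
lemma Hext_out {N : ℕ} {α : ℝ} {f : EN N → ℝ} {x : EN N} (hx : ¬ ‖x‖ < 1) : Hext α f x = f x := if_neg hx

lemma PK_contAt {N : ℕ} (hN : 0 < N) {α : ℝ} (hα0 : 0 < α) (hα2 : α < 2) {x : EN N} (hx : ‖x‖ < 1) (y : EN N) : 
    ContinuousAt (fun x => PK α x y) x := by
  by_cases h1 : 1 < ‖y‖
  · have : (fun x => PK α x y) =ᶠ[𝓝 x] fun x => poissonCoeff N α * (1 - ‖x‖ ^ 2) ^ (α / 2) * (‖y‖ ^ 2 - 1) ^ (-(α / 2)) * ‖x - y‖ ^ (-(N:ℝ)) := by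
      have : ∀ᶠ x' : EN N in 𝓝 x, ‖x'‖ < 1 := continuous_norm.continuousAt.eventually_lt continuousAt_const hx
      filter_upwards [this] with x' hx'
      exact PK_eq hN hα0 hα2 hx' h1
    apply ContinuousAt.congr _ this.symm
    apply ContinuousAt.mul
    · apply ContinuousAt.mul _ continuousAt_const
      apply continuousAt_const.mul
      apply ContinuousAt.rpow_const (by fun_prop)
      right; linarith
    · apply ContinuousAt.rpow_const (by fun_prop)
      left
      rw [norm_ne_zero_iff, sub_ne_zero]
      rintro rfl; linarith
  · simp only [PK_zero (not_lt.1 h1)]; exact continuousAt_const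

lemma HF_contAt {N : ℕ} (hN : 3 ≤ N) {α : ℝ} (hα0 : 0 < α) (hα2 : α < 2) {f : EN N → ℝ} (hf : Measurable f) 
    (hi : Integrable (fun y => PK α 0 y * f y)) {x : EN N} (hx : ‖x‖ < 1) : ContinuousAt (fun x => ∫ y, PK α x y * f y) x := by
  have hN0 : 0 < N := by omega
  set r := (1 + ‖x‖) / 2 with hr
  have : ∀ᶠ x' : EN N in 𝓝 x, ‖x'‖ < r := continuous_norm.continuousAt.eventually_lt continuousAt_const (by linarith)
  apply continuousAt_of_dominated (bound := fun y => ((1 - r)⁻¹) ^ (N:ℝ) * ‖PK α 0 y * f y‖)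
  · filter_upwards with x'
    exact ((measurable_PK_right α x').mul hf).aestronglyMeasurable
  · filter_upwards [this] with x' hx'
    filter_upwards with y
    have := PK_compare' hN0 hα0 hα2 (y := y) (by linarith : r < 1) hx'.le
    rw [norm_mul, Real.norm_of_nonneg (PK_nonneg _ _ _), norm_mul, Real.norm_of_nonneg (PK_nonneg _ _ _), ← mul_assoc]
    exact mul_le_mul_of_nonneg_right this (norm_nonneg _)
  · exact hi.norm.const_mul _
  · filter_upwards with y
    exact (PK_contAt hN0 hα0 hα2 hx y).mul continuousAt_const

lemma HF_bdry {N : ℕ} (hN : 3 ≤ N) {α : ℝ} (hα0 : 0 < α) (hα2 : α < 2) {f : EN N → ℝ} (hf : Measurable f) 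
    (hi : Integrable (fun y => PK α 0 y * f y)) {z : EN N} (hz : ‖z‖ = 1) (hfz : ContinuousAt f z) {ε : ℝ} (hε : 0 < ε) :
    ∀ᶠ x in 𝓝 z, ‖x‖ < 1 → |(∫ y, PK α x y * f y) - f z| ≤ ε := by
  have hN0 : 0 < N := by omega
  obtain ⟨δ, hδ, hfδ⟩ := Metric.continuousAt_iff.1 hfz (ε / 2) (by linarith)
  have i0 : Integrable (fun y => PK α 0 y * |f y - f z|) := by
    have := (hi.sub ((integrable_PK hN hα0 hα2 (x := (0 : EN N)) (by simp)).mul_const (f z))).norm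
    convert this using 2 with y
    simp only [Pi.sub_apply]
    rw [← mul_sub, norm_mul, Real.norm_of_nonneg (PK_nonneg _ _ _), norm_eq_abs]
  set I := ∫ y, PK α 0 y * |f y - f z| with hI
  have ht : Tendsto (fun x : EN N => (1 + 2/δ) ^ (N:ℝ) * (1 - ‖x‖ ^ 2) ^ (α / 2) * I) (𝓝 z) (𝓝 0) := by
    have : ContinuousAt (fun x : EN N => (1 + 2/δ) ^ (N:ℝ) * (1 - ‖x‖ ^ 2) ^ (α / 2) * I) z := by
      apply ContinuousAt.mul _ continuousAt_const
      apply continuousAt_const.mul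
      apply ContinuousAt.rpow_const (by fun_prop)
      right; linarith
    have h := this.tendsto
    rw [hz] at h
    rwa [show (1:ℝ) - 1 ^ 2 = 0 by norm_num, zero_rpow (by positivity), mul_zero, zero_mul] at h
  filter_upwards [ht.eventually (gt_mem_nhds (show (0:ℝ) < ε / 2 by linarith)), ball_mem_nhds z (show 0 < δ / 2 by linarith)] with x hx1 hx2 hx
  have ix := integrable_PK_mul hN hα0 hα2 hf hi hx
  have ip := integrable_PK hN hα0 hα2 hx
  have e1 : (∫ y, PK α x y * f y) - f z = ∫ y, PK α x y * (f y - f z) := by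
    have : ∫ y, PK α x y * f z = f z := by rw [integral_mul_const, int_PK hN hα0 hα2 hx, one_mul]
    rw [← this, ← integral_sub ix (ip.mul_const _), this]
    congr 1; ext y; ring
  rw [e1, ← norm_eq_abs]
  have hx2' : ‖x - z‖ < δ / 2 := by rw [← dist_eq_norm]; exact hx2
  calc ‖∫ y, PK α x y * (f y - f z)‖ ≤ ∫ y, (PK α x y * (ε / 2) + (1 + 2/δ) ^ (N:ℝ) * (1 - ‖x‖ ^ 2) ^ (α / 2) * (PK α 0 y * |f y - f z|)) := by
        apply norm_integral_le_of_norm_le ((ip.mul_const _).add (i0.const_mul _))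
        filter_upwards with y
        have hx3 : 0 < 1 - ‖x‖ ^ 2 := by nlinarith [norm_nonneg x]
        have hP := PK_nonneg α x y
        have hP0 := PK_nonneg α 0 y
        rw [norm_mul, Real.norm_of_nonneg hP, norm_eq_abs]
        show PK α x y * |f y - f z| ≤ PK α x y * (ε / 2) + (1 + 2/δ) ^ (N:ℝ) * (1 - ‖x‖ ^ 2) ^ (α / 2) * (PK α 0 y * |f y - f z|)
        by_cases hy : dist y z < δ
        · have h1 := hfδ hy
          rw [Real.dist_eq] at h1
          have h2 := mul_le_mul_of_nonneg_left h1.le hP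
          have : 0 ≤ (1 + 2/δ) ^ (N:ℝ) * (1 - ‖x‖ ^ 2) ^ (α / 2) * (PK α 0 y * |f y - f z|) := by positivity
          linarith
        · have hy1 : δ / 2 ≤ ‖x - y‖ := by
            have := dist_triangle y x z
            rw [dist_eq_norm y x, dist_eq_norm x z, norm_sub_rev y x] at this
            linarith
          have hy2 : ‖y‖ ≤ (1 + 2/δ) * ‖x - y‖ := by
            have h3 : ‖y‖ ≤ ‖x - y‖ + ‖x‖ := by
              have := norm_sub_norm_le y x
              rw [norm_sub_rev] at this; linarith
            have h4 : 1 ≤ 2 / δ * ‖x - y‖ := by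
              rw [div_mul_eq_mul_div, le_div_iff₀ hδ]; linarith
            linarith
          have h5 := PK_compare hN0 hα0 hα2 hx (show 0 < 1 + 2/δ by positivity) hy2
          have h6 := mul_le_mul_of_nonneg_right h5 (abs_nonneg (f y - f z))
          have : 0 ≤ PK α x y * (ε / 2) := by positivity
          linarith
    _ = ε / 2 + (1 + 2/δ) ^ (N:ℝ) * (1 - ‖x‖ ^ 2) ^ (α / 2) * I := by
        rw [integral_add (ip.mul_const _) (i0.const_mul _), integral_mul_const, integral_const_mul, int_PK hN hα0 hα2 hx, one_mul]
    _ ≤ ε := by linarith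

theorem Hext_cont {N : ℕ} (hN : 3 ≤ N) {α : ℝ} (hα0 : 0 < α) (hα2 : α < 2) {f : EN N → ℝ} (hf : Measurable f) 
    (hi : Integrable (fun y => PK α 0 y * f y)) (hfc : ∀ z : EN N, ‖z‖ = 1 → ContinuousAt f z) :
    ContinuousOn (Hext α f) (closedBall 0 1) := by
  intro z hz
  rw [mem_closedBall_zero_iff] at hz
  rcases hz.lt_or_eq with h1 | h1
  · have : ∀ᶠ x' : EN N in 𝓝 z, ‖x'‖ < 1 := continuous_norm.continuousAt.eventually_lt continuousAt_const h1
    apply ContinuousAt.continuousWithinAt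
    apply (HF_contAt hN hα0 hα2 hf hi h1).congr
    filter_upwards [this] with x hx
    rw [Hext_in hx]
  · unfold ContinuousWithinAt
    rw [Hext_out (by linarith), Metric.tendsto_nhds]
    intro ε hε
    have h2 := HF_bdry hN hα0 hα2 hf hi h1 (hfc z h1) (show 0 < ε / 2 by linarith)
    have h3 := Metric.tendsto_nhds.1 (hfc z h1) ε hε
    filter_upwards [nhdsWithin_le_nhds h2, nhdsWithin_le_nhds h3] with x hx2 hx3
    by_cases hx : ‖x‖ < 1
    · rw [Hext_in hx, Real.dist_eq]; linarith [hx2 hx]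
    · rw [Hext_out hx]; exact hx3



lemma int_nr_tendsto {N : ℕ} (hN : 0 < N) {α : ℝ} (hα0 : 0 < α) :
    Tendsto (fun n : ℕ => ∫ h, nr N α (1 / ((n:ℝ) + 1)) h) atTop (𝓝 0) := by
  have : Tendsto (fun n : ℕ => ∫ h, nr N α (1 / ((n:ℝ) + 1)) h) atTop (𝓝 (∫ h : EN N, (0:ℝ))) := by
    apply tendsto_integral_of_dominated_convergence (nr N α 1)
    · intro n; exact (measurable_nr _ _ _).aestronglyMeasurable
    · exact integrable_nr hN hα0 one_pos
    · intro n
      filter_upwards with h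
      rw [Real.norm_of_nonneg (nr_nonneg _ _ _ _)]
      unfold nr
      have : 1 / ((n:ℝ) + 1) ≤ 1 := by rw [div_le_one (by positivity)]; linarith [n.cast_nonneg (α := ℝ)]
      split_ifs
      · exact le_rfl
      · linarith
      · positivity
      · exact le_rfl
    · filter_upwards [ae_ne hN 0] with h hh
      have hp : 0 < ‖h‖ := norm_pos_iff.2 hh.symm
      have h1 := tendsto_one_div_add_atTop_nhds_zero_nat.eventually (gt_mem_nhds hp)
      apply tendsto_const_nhds.congr'
      filter_upwards [h1] with n hn
      unfold nr
      rw [if_neg (by linarith)]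
  simpa using this

/-- Riesz potential -/
def Pot {N : ℕ} (α : ℝ) (g : EN N → ℝ) (x : EN N) : ℝ := ∫ z, RK α x z * g z

lemma Pot_cont {N : ℕ} (hN : 3 ≤ N) {α : ℝ} (hα0 : 0 < α) (hα2 : α < 2) {g : EN N → ℝ} (hg : Integrable g) {D : ℝ} (hD : ∀ z, |g z| ≤ D) :
    Continuous (Pot α g) := by
  have hN0 : 0 < N := by omega
  have hNr : (3:ℝ) ≤ N := by exact_mod_cast hN
  have hc : 0 ≤ greenCoeff N α * bA N α := by
    have := greenCoeff_pos hN0 hα0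
    have := bA_pos hN hα0 hα2
    positivity
  have hD0 : 0 ≤ D := (abs_nonneg _).trans (hD 0)
  set cc := greenCoeff N α * bA N α with hcc
  obtain ⟨M, hM0, hM⟩ := pot_bound hN hα0 hα2 hg hD
  set F : ℕ → EN N → ℝ := fun n x => ∫ z, cc * (max ‖x - z‖ (1 / ((n:ℝ) + 1))) ^ (α - (N:ℝ)) * g z with hF
  have hR : ∀ n : ℕ, 0 < 1 / ((n:ℝ) + 1) := fun n => by positivity
  have bd : ∀ (n : ℕ) (x z : EN N), (max ‖x - z‖ (1 / ((n:ℝ) + 1))) ^ (α - (N:ℝ)) ≤ (1 / ((n:ℝ) + 1)) ^ (α - (N:ℝ)) := fun n x z =>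
    rpow_le_rpow_of_nonpos (hR n) (le_max_right _ _) (by linarith)
  have bd2 : ∀ (n : ℕ) (x z : EN N), ‖cc * (max ‖x - z‖ (1 / ((n:ℝ) + 1))) ^ (α - (N:ℝ)) * g z‖ ≤ cc * (1 / ((n:ℝ) + 1)) ^ (α - (N:ℝ)) * ‖g z‖ := by
    intro n x z
    rw [norm_mul, Real.norm_of_nonneg (by positivity)]
    have := bd n x z
    gcongr
  have hmeas : ∀ (n : ℕ) (x : EN N), AEStronglyMeasurable (fun z => cc * (max ‖x - z‖ (1 / ((n:ℝ) + 1))) ^ (α - (N:ℝ)) * g z) volume := by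
    intro n x
    exact (Measurable.aestronglyMeasurable (by fun_prop)).mul hg.aestronglyMeasurable
  have hFi : ∀ (n : ℕ) (x : EN N), Integrable (fun z => cc * (max ‖x - z‖ (1 / ((n:ℝ) + 1))) ^ (α - (N:ℝ)) * g z) := by
    intro n x
    apply (hg.norm.const_mul (cc * (1 / ((n:ℝ) + 1)) ^ (α - (N:ℝ)))).mono' (hmeas n x)
    filter_upwards with z
    exact bd2 n x z
  have hFc : ∀ n, Continuous (F n) := by
    intro n
    apply continuous_of_dominated (bound := fun z => cc * (1 / ((n:ℝ) + 1)) ^ (α - (N:ℝ)) * ‖g z‖) (hmeas n)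
    · intro x
      filter_upwards with z
      exact bd2 n x z
    · exact hg.norm.const_mul _
    · filter_upwards with z
      apply Continuous.mul _ continuous_const
      apply continuous_const.mul
      apply Continuous.rpow_const (by fun_prop)
      intro x; left
      have := lt_of_lt_of_le (hR n) (le_max_right ‖x - z‖ (1 / ((n:ℝ) + 1)))
      exact this.ne'
  have key : ∀ n x, |Pot α g x - F n x| ≤ cc * D * ∫ h, nr N α (1 / ((n:ℝ) + 1)) h := by
    intro n x
    unfold Pot
    simp only [hF]
    rw [← integral_sub (hM x).1 (hFi n x), ← norm_eq_abs]
    have i1 : Integrable (fun z => nr N α (1 / ((n:ℝ) + 1)) (x - z)) := (integrable_nr hN0 hα0 (hR n)).comp_sub_left x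
    calc _ ≤ ∫ z, cc * D * nr N α (1 / ((n:ℝ) + 1)) (x - z) := by
          apply norm_integral_le_of_norm_le (i1.const_mul _)
          filter_upwards [ae_ne hN0 x] with z hz
          have hp : 0 < ‖x - z‖ := norm_pos_iff.2 (sub_ne_zero.2 hz)
          unfold RK
          rw [← hcc, ← sub_mul, ← mul_sub, norm_mul, norm_mul, Real.norm_of_nonneg hc, norm_eq_abs (g z)]
          have h1 : ‖‖x - z‖ ^ (α - (N:ℝ)) - (max ‖x - z‖ (1 / ((n:ℝ) + 1))) ^ (α - (N:ℝ))‖ ≤ nr N α (1 / ((n:ℝ) + 1)) (x - z) := by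
            unfold nr
            split_ifs with h2
            · rw [max_eq_right h2.le]
              have h3 : (1 / ((n:ℝ) + 1)) ^ (α - (N:ℝ)) ≤ ‖x - z‖ ^ (α - (N:ℝ)) := rpow_le_rpow_of_nonpos hp h2.le (by linarith)
              rw [Real.norm_of_nonneg (by linarith)]
              have : 0 ≤ (1 / ((n:ℝ) + 1)) ^ (α - (N:ℝ)) := by positivity
              linarith
            · rw [max_eq_left (not_lt.1 h2), sub_self, norm_zero]
          have h4 := hD z
          have h5 := nr_nonneg N α (1 / ((n:ℝ) + 1)) (x - z)
          calc _ ≤ cc * nr N α (1 / ((n:ℝ) + 1)) (x - z) * D := by gcongr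
            _ = _ := by ring
      _ = _ := by rw [integral_const_mul, integral_sub_left_eq_self (nr N α (1 / ((n:ℝ) + 1)))]
  have hunif : TendstoUniformly F (Pot α g) atTop := by
    rw [Metric.tendstoUniformly_iff]
    intro ε hε
    have h1 := (int_nr_tendsto hN0 hα0).const_mul (cc * D)
    rw [mul_zero] at h1
    filter_upwards [h1.eventually (gt_mem_nhds hε)] with n hn x
    rw [Real.dist_eq]
    exact (key n x).trans_lt hn
  exact hunif.continuous (Frequently.of_forall hFc)

lemma Pot_bdd {N : ℕ} (hN : 3 ≤ N) {α : ℝ} (hα0 : 0 < α) (hα2 : α < 2) {g : EN N → ℝ} (hg : Integrable g) {D : ℝ} (hD : ∀ z, |g z| ≤ D) :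
    ∃ M, 0 ≤ M ∧ ∀ x, |Pot α g x| ≤ M := by
  obtain ⟨M, hM0, hM⟩ := pot_bound hN hα0 hα2 hg hD
  refine ⟨M, hM0, fun x => ?_⟩
  unfold Pot
  refine (abs_integral_le_integral_abs).trans (le_trans (le_of_eq ?_) (hM x).2)
  congr 1; ext z
  rw [abs_mul, abs_of_nonneg (RK_nonneg hN hα0 hα2 _ _)]

/-- Green potential -/
def Gop {N : ℕ} (α : ℝ) (g : EN N → ℝ) (x : EN N) : ℝ := ∫ z, greenB N α x z * g z

lemma greenB_out {N : ℕ} {α : ℝ} {x z : EN N} (hz : ¬ ‖z‖ < 1) : greenB N α x z = 0 := by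
  unfold greenB; simp [hz]

lemma greenB_out' {N : ℕ} {α : ℝ} {x z : EN N} (hx : ¬ ‖x‖ < 1) : greenB N α x z = 0 := by
  unfold greenB; simp [hx]

lemma Gop_out {N : ℕ} {α : ℝ} {g : EN N → ℝ} {x : EN N} (hx : ¬ ‖x‖ < 1) : Gop α g x = 0 := by
  unfold Gop; simp [greenB_out' hx]

lemma Gop_eq {N : ℕ} (hN : 3 ≤ N) {α : ℝ} (hα0 : 0 < α) (hα2 : α < 2) {g : EN N → ℝ} (hg : Integrable g) {D : ℝ} (hD : ∀ z, |g z| ≤ D) (x : EN N) :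
    Gop α g x = Pot α g x - Hext α (Pot α g) x := by
  by_cases hx : ‖x‖ < 1
  · obtain ⟨M, hM0, hM⟩ := pot_bound hN hα0 hα2 hg hD
    have := sweep_pair hN hα0 hα2 hx hg.aestronglyMeasurable (hM x).1
    rw [Hext_in hx]
    unfold Gop Pot
    linarith
  · rw [Gop_out hx, Hext_out hx, sub_self]

lemma Gop_cont {N : ℕ} (hN : 3 ≤ N) {α : ℝ} (hα0 : 0 < α) (hα2 : α < 2) {g : EN N → ℝ} (hg : Integrable g) {D : ℝ} (hD : ∀ z, |g z| ≤ D) :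
    ContinuousOn (Gop α g) (closedBall 0 1) := by
  have hp := Pot_cont hN hα0 hα2 hg hD
  obtain ⟨M, hM0, hM⟩ := Pot_bdd hN hα0 hα2 hg hD
  have hi : Integrable (fun y => PK α 0 y * Pot α g y) := by
    apply (integrable_PK hN hα0 hα2 (by simp)).mul_bdd (c := M) hp.aestronglyMeasurable
    filter_upwards with y
    exact hM y
  have h2 := Hext_cont hN hα0 hα2 hp.measurable hi (fun z _ => hp.continuousAt)
  exact (hp.continuousOn.sub h2).congr (fun x _ => Gop_eq hN hα0 hα2 hg hD x)

lemma Gop_unit {N : ℕ} (hN : 3 ≤ N) {α : ℝ} (hα0 : 0 < α) (hα2 : α < 2) :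
    ∃ κ0, 0 < κ0 ∧ ∀ x : EN N, Integrable (fun z => greenB N α x z) ∧ ∫ z, greenB N α x z ≤ κ0 := by
  have i0 : Integrable ((ball (0 : EN N) 1).indicator (fun _ => (1:ℝ))) := 
    (integrable_indicator_iff measurableSet_ball).2 (integrableOn_const (measure_ball_lt_top.ne))
  have hb : ∀ z : EN N, |(ball (0 : EN N) 1).indicator (fun _ => (1:ℝ)) z| ≤ 1 := by
    intro z
    by_cases h : z ∈ ball (0 : EN N) 1
    · rw [indicator_of_mem h]; simp
    · rw [indicator_of_notMem h]; simp
  obtain ⟨M, hM0, hM⟩ := pot_bound hN hα0 hα2 i0 hb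
  have e : ∀ x z : EN N, greenB N α x z = greenB N α x z * (ball (0 : EN N) 1).indicator (fun _ => (1:ℝ)) z := by
    intro x z
    by_cases h : ‖z‖ < 1
    · rw [indicator_of_mem (by simpa using h), mul_one]
    · rw [greenB_out h, zero_mul]
  refine ⟨M + 1, by linarith, fun x => ?_⟩
  have i1 := integrable_green_mul hN hα0 hα2 (hM x).1 i0.aestronglyMeasurable
  have i2 : Integrable (fun z => greenB N α x z) := i1.congr (ae_of_all _ fun z => (e x z).symm)
  refine ⟨i2, ?_⟩
  have i3 : Integrable (fun z => RK α x z * |(ball (0 : EN N) 1).indicator (fun _ => (1:ℝ)) z|) := by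
    have := (hM x).1.norm
    simp_rw [norm_mul, Real.norm_of_nonneg (RK_nonneg hN hα0 hα2 _ _), norm_eq_abs] at this
    exact this
  have : ∫ z, greenB N α x z ≤ ∫ z, RK α x z * |(ball (0 : EN N) 1).indicator (fun _ => (1:ℝ)) z| := by
    apply integral_mono i2 i3
    intro z
    simp only
    rw [e x z]
    exact mul_le_mul (greenB_le_RK hN hα0 hα2 _ _) (le_abs_self _) (indicator_nonneg (by simp) _) (RK_nonneg hN hα0 hα2 _ _)
  linarith [(hM x).2]

/-- duality -/
lemma Gop_pair {N : ℕ} (hN : 3 ≤ N) {α : ℝ} (hα0 : 0 < α) (hα2 : α < 2) {g : EN N → ℝ} (hg : Integrable g) {D : ℝ} (hD : ∀ z, |g z| ≤ D)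
    {φ : EN N → ℝ} {C R : ℝ} (h : TF φ C R) (hs : ∀ z, 1 ≤ ‖z‖ → φ z = 0) :
    ∫ x, Gop α g x * LapS N α φ x = - ∫ x, g x * φ x := by
  have hN0 : 0 < N := by omega
  obtain ⟨E, hE0, hE⟩ := h.LapS_bdd hN hα0 hα2
  obtain ⟨M, hM0, hM⟩ := pot_bound hN hα0 hα2 (h.integrable_LapS hN hα0 hα2) hE
  have hp : Integrable (fun q : EN N × EN N => g q.1 * (greenB N α q.1 q.2 * LapS N α φ q.2)) (volume.prod volume) := by
    have hsm : AEStronglyMeasurable (fun q : EN N × EN N => g q.1 * (greenB N α q.1 q.2 * LapS N α φ q.2)) (volume.prod volume) := by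
      apply hg.aestronglyMeasurable.comp_fst.mul
      simp_rw [greenB_eq hN hα0 hα2]
      exact ((measurable_GE α).ennreal_toReal.mul (h.measurable_LapS.comp measurable_snd)).aestronglyMeasurable
    rw [integrable_prod_iff hsm]
    have hi : ∀ y, Integrable (fun z => greenB N α y z * LapS N α φ z) := fun y => 
      integrable_green_mul hN hα0 hα2 (hM y).1 h.measurable_LapS.aestronglyMeasurable
    constructor
    · filter_upwards with y
      exact (hi y).const_mul _
    · apply (hg.norm.mul_const M).mono' hsm.norm.integral_prod_right'
      filter_upwards with y
      have : ∀ z, ‖g y * (greenB N α y z * LapS N α φ z)‖ = ‖g y‖ * (‖greenB N α y z * LapS N α φ z‖) := by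
        intro z; rw [norm_mul]
      simp only [this]
      rw [integral_const_mul, norm_mul, norm_norm, Real.norm_of_nonneg (integral_nonneg (fun z => norm_nonneg _))]
      apply mul_le_mul_of_nonneg_left _ (norm_nonneg _)
      refine le_trans ?_ (hM y).2
      have i3 := (hM y).1.norm
      simp_rw [norm_mul, Real.norm_of_nonneg (RK_nonneg hN hα0 hα2 _ _), norm_eq_abs (LapS _ _ _ _)] at i3
      apply integral_mono (hi y).norm i3
      intro z
      simp only
      rw [norm_mul, Real.norm_of_nonneg (greenB_nonneg hN hα0 hα2 _ _), norm_eq_abs]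
      exact mul_le_mul_of_nonneg_right (greenB_le_RK hN hα0 hα2 _ _) (abs_nonneg _)
  have e1 := integral_integral_swap (f := fun y z => g y * (greenB N α y z * LapS N α φ z)) hp
  simp_rw [integral_const_mul, green_pair hN hα0 hα2 h hs] at e1
  rw [← integral_neg]
  simp only [mul_neg] at e1
  rw [e1]
  congr 1; ext x
  unfold Gop
  rw [← integral_mul_const]
  congr 1; ext z
  rw [greenB_symm hN hα0 hα2 x z]; ring



lemma memL_locInt {N : ℕ} {α : ℝ} {v : EN N → ℝ} (hv : memLalpha N α v) : LocallyIntegrable v volume := by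
  rw [locallyIntegrable_iff]
  intro K hK
  have h0 : IntegrableOn (fun y : EN N => v y * (1 + ‖y‖) ^ (-((N : ℝ) + α))) K := Integrable.integrableOn hv
  have hc : Continuous (fun y : EN N => (1 + ‖y‖) ^ ((N : ℝ) + α)) := by
    apply Continuous.rpow_const (by fun_prop)
    intro x; left; positivity
  have := IntegrableOn.continuousOn_mul hc.continuousOn h0 hK
  apply this.congr
  filter_upwards with y
  have : (1 + ‖y‖) ^ ((N : ℝ) + α) * (1 + ‖y‖) ^ (-((N : ℝ) + α)) = 1 := by
    rw [← rpow_add (by positivity)]; simp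
  calc _ = v y * ((1 + ‖y‖) ^ ((N : ℝ) + α) * (1 + ‖y‖) ^ (-((N : ℝ) + α))) := by ring
    _ = v y := by rw [this, mul_one]

/-- mollification -/
def moll {N : ℕ} (v ρ : EN N → ℝ) (x : EN N) : ℝ := ∫ y, v y * ρ (y - x)

lemma moll_cont {N : ℕ} {α : ℝ} {v ρ : EN N → ℝ} (hv : memLalpha N α v) (hρ : Continuous ρ) (hc : HasCompactSupport ρ) :
    Continuous (moll v ρ) := by
  have h1 : HasCompactSupport (fun z => ρ (-z)) := hc.comp_homeomorph (Homeomorph.neg (EN N))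
  have := h1.continuous_convolution_right (ContinuousLinearMap.mul ℝ ℝ) (memL_locInt hv) (hρ.comp continuous_neg)
  convert this using 1
  ext x
  unfold moll convolution
  simp [Function.comp_def]

lemma moll_int {N : ℕ} {α : ℝ} {v ρ : EN N → ℝ} (hv : memLalpha N α v) (hρ : Continuous ρ) (hc : HasCompactSupport ρ) (x : EN N) :
    Integrable (fun y => v y * ρ (y - x)) := by
  have h1 : HasCompactSupport (fun z => ρ (z - x)) := hc.comp_homeomorph (Homeomorph.subRight x)
  have := (memL_locInt hv).integrable_smul_right_of_hasCompactSupport (g := fun z => ρ (z - x)) (by fun_prop) h1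
  simpa [mul_comm] using this

lemma moll_le {N : ℕ} {α : ℝ} {v ρ : EN N → ℝ} (hv : memLalpha N α v) (hρ : Continuous ρ) (hc : HasCompactSupport ρ)
    (h0 : ∀ x, 0 ≤ ρ x) (h1 : ∫ x, ρ x = 1) {d : ℝ} (hd : ∀ x, d ≤ ‖x‖ → ρ x = 0) {x : EN N} {c : ℝ}
    (hx : ∀ y, ‖y - x‖ < d → v y ≤ c) : moll v ρ x ≤ c := by
  have hi : Integrable ρ := hρ.integrable_of_hasCompactSupport hc
  have e : ∫ y, c * ρ (y - x) = c := by
    rw [integral_const_mul, integral_sub_right_eq_self, h1, mul_one]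
  rw [← e]
  apply integral_mono (moll_int hv hρ hc x) ((hi.comp_sub_right x).const_mul c)
  intro y
  simp only
  by_cases h : ‖y - x‖ < d
  · exact mul_le_mul_of_nonneg_right (hx y h) (h0 _)
  · rw [hd _ (not_lt.1 h)]; simp

lemma le_moll {N : ℕ} {α : ℝ} {v ρ : EN N → ℝ} (hv : memLalpha N α v) (hρ : Continuous ρ) (hc : HasCompactSupport ρ)
    (h0 : ∀ x, 0 ≤ ρ x) (h1 : ∫ x, ρ x = 1) {d : ℝ} (hd : ∀ x, d ≤ ‖x‖ → ρ x = 0) {x : EN N} {c : ℝ}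
    (hx : ∀ y, ‖y - x‖ < d → c ≤ v y) : c ≤ moll v ρ x := by
  have hi : Integrable ρ := hρ.integrable_of_hasCompactSupport hc
  have e : ∫ y, c * ρ (y - x) = c := by
    rw [integral_const_mul, integral_sub_right_eq_self, h1, mul_one]
  rw [← e]
  apply integral_mono ((hi.comp_sub_right x).const_mul c) (moll_int hv hρ hc x)
  intro y
  simp only
  by_cases h : ‖y - x‖ < d
  · exact mul_le_mul_of_nonneg_right (hx y h) (h0 _)
  · rw [hd _ (not_lt.1 h)]; simp

/-- strict negativity at a global maximum of the mollification -/
lemma moll_max {N : ℕ} (hN : 0 < N) {α : ℝ} (hα0 : 0 < α) (hα2 : α < 2) {v ρ : EN N → ℝ} (hv : memLalpha N α v)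
    {xs : EN N} {C R : ℝ} (h : TF (fun z => ρ (z - xs)) C R) (hmax : ∀ x, moll v ρ x ≤ moll v ρ xs) (hpos : 0 < moll v ρ xs)
    (hfar : ∀ k : EN N, 3 < ‖k‖ → moll v ρ (xs - k) ≤ 0) :
    ∫ z, v z * LapS N α (fun z => ρ (z - xs)) z < 0 := by
  set φ := fun z => ρ (z - xs) with hφ
  set m := moll v ρ xs with hm
  have hcf := fracLapCoeff_pos hN hα0 hα2
  set A : Set (EN N) := {k | 3 < ‖k‖ ∧ ‖k‖ < 4} with hA
  have hAo : IsOpen A := (isOpen_lt continuous_const continuous_norm).inter (isOpen_lt continuous_norm continuous_const)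
  have hAf : volume A < ⊤ := lt_of_le_of_lt (measure_mono (fun k hk => by simpa using hk.2)) (measure_ball_lt_top (x := (0 : EN N)) (r := 4))
  have hAp : 0 < volume.real A := by
    rw [measureReal_def]
    apply ENNReal.toReal_pos _ hAf.ne
    apply (hAo.measure_pos volume _).ne'
    refine ⟨EuclideanSpace.single ⟨0, hN⟩ (7/2), ?_, ?_⟩
    · rw [PiLp.norm_single]; norm_num
    · rw [PiLp.norm_single]; norm_num
  set c1 := fracLapCoeff N α * ((16:ℝ) ^ (-(α / 2)) * (4:ℝ) ^ (-(N:ℝ))) with hc1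
  have hc1p : 0 < c1 := by positivity
  have hb : ∀ ε, 0 < ε → ε ≤ 1/2 → ∫ z, v z * Dop N α ε φ z ≤ - (m * c1 * volume.real A) := by
    intro ε hε hε1
    have e1 : ∀ k, ∫ z, v z * φ (z + k) = moll v ρ (xs - k) := by
      intro k
      unfold moll
      simp only [hφ]
      congr 1
      ext z
      rw [sub_sub_eq_add_sub]
    have e2 : ∫ z, v z * φ z = m := rfl
    have i1 : Integrable (fun k => kap N α ε k * moll v ρ (xs - k)) := by
      have := (h.integrable_prod hN hα0 hα2 hε hε1 hv).integral_prod_left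
      simp only [integral_const_mul, e1] at this
      exact this
    have i2 : Integrable (fun k => kap N α ε k * m) := (integrable_kap hN hα0 hα2 hε).mul_const m
    rw [h.Dop_pair hN hα0 hα2 hε hε1 hv, e2]
    simp_rw [e1]
    rw [← int_kap hN hα0 hα2 hε, ← integral_mul_const, ← integral_sub i1 i2]
    have e3 : ∫ k, A.indicator (fun _ => -(m * c1)) k = - (m * c1 * volume.real A) := by
      rw [integral_indicator_const _ hAo.measurableSet, smul_eq_mul]; ring
    rw [← e3]
    apply integral_mono (i1.sub i2) ((integrable_indicator_iff hAo.measurableSet).2 (integrableOn_const hAf.ne))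
    intro k
    have hk0 := kap_nonneg hN hα0 hα2 hε.le k
    simp only [Pi.sub_apply]
    by_cases hk : k ∈ A
    · rw [indicator_of_mem hk]
      have h1 := hfar k hk.1
      have h2 : c1 ≤ kap N α ε k := by
        unfold kap
        rw [if_pos (by linarith [hk.1])]
        have hk1 := hk.1
        have hk2 := hk.2
        apply mul_le_mul_of_nonneg_left _ hcf.le
        apply mul_le_mul _ _ (by positivity) _
        · apply rpow_le_rpow_of_nonpos (by nlinarith) (by nlinarith) (by linarith)
        · apply rpow_le_rpow_of_nonpos (by linarith) hk2.le (by simp)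
        · apply rpow_nonneg; nlinarith
      nlinarith [mul_nonpos_of_nonneg_of_nonpos hk0 h1]
    · rw [indicator_of_notMem hk]
      nlinarith [mul_le_mul_of_nonneg_left (hmax (xs - k)) hk0]
  obtain ⟨D, hD0, hD⟩ := h.Dop_bound hN hα0 hα2
  have hev : ∀ᶠ ε : ℝ in 𝓝[>] 0, 0 < ε ∧ ε ≤ 1/2 := by
    filter_upwards [Ioc_mem_nhdsGT (show (0:ℝ) < 1/2 by norm_num)] with ε hε using hε
  have ht : Tendsto (fun ε => ∫ z, v z * Dop N α ε φ z) (𝓝[>] 0) (𝓝 (∫ z, v z * LapS N α φ z)) := by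
    apply tendsto_integral_filter_of_dominated_convergence (fun z => D * ‖v z * (1 + ‖z‖) ^ (-((N:ℝ) + α))‖)
    · filter_upwards with ε
      exact (memL_aesm hv).mul (h.measurable_Dop).aestronglyMeasurable
    · filter_upwards [hev] with ε hε
      filter_upwards with z
      rw [norm_mul, norm_mul, Real.norm_of_nonneg (show 0 ≤ (1 + ‖z‖) ^ (-((N:ℝ) + α)) by positivity)]
      have := hD ε hε.1 hε.2 z
      rw [← norm_eq_abs] at this
      nlinarith [norm_nonneg (v z)]
    · exact hv.norm.const_mul D
    · filter_upwards with z
      exact (h.Dop_tendsto hN hα0 hα2 z).const_mul (v z)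
  have := le_of_tendsto ht (by filter_upwards [hev] with ε hε using hb ε hε.1 hε.2)
  have hp : 0 < m * c1 * volume.real A := by positivity
  linarith

/-- maximum principle -/
lemma max_principle {N : ℕ} (hN : 0 < N) {α : ℝ} (hα0 : 0 < α) (hα2 : α < 2) {v : EN N → ℝ} (hv : memLalpha N α v)
    (hc : ContinuousOn v (closedBall 0 1)) (hout : ∀ x, ¬ ‖x‖ < 1 → v x ≤ 0)
    (hsub : ∀ φ : EN N → ℝ, ContDiff ℝ (⊤ : ℕ∞) φ → HasCompactSupport φ → tsupport φ ⊆ {x | ‖x‖ < 1 ∧ 0 < v x} → (∀ x, 0 ≤ φ x) →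
      0 ≤ ∫ z, v z * LapS N α φ z) : ∀ x, v x ≤ 0 := by
  by_contra hcon
  push Not at hcon
  obtain ⟨x0, hx0⟩ := hcon
  have hx01 : ‖x0‖ < 1 := by
    by_contra h
    linarith [hout x0 h]
  obtain ⟨xm, hxm, hmm⟩ := (isCompact_closedBall (0 : EN N) 1).exists_isMaxOn ⟨x0, by simpa using hx01.le⟩ hc
  set M := v xm with hM
  have hMp : 0 < M := lt_of_lt_of_le hx0 (hmm (by simpa using hx01.le))
  have hxm1 : ‖xm‖ < 1 := by
    by_contra h
    linarith [hout xm h]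
  set K : Set (EN N) := closedBall 0 1 ∩ v ⁻¹' (Ici (M/2)) with hK
  have hKc : IsCompact K := (isCompact_closedBall (0 : EN N) 1).of_isClosed_subset (hc.preimage_isClosed_of_isClosed isClosed_closedBall isClosed_Ici) inter_subset_left
  set U : Set (EN N) := {x | ‖x‖ < 1 ∧ 0 < v x} with hU
  have hUo : IsOpen U := by
    have := (hc.mono ball_subset_closedBall).isOpen_inter_preimage isOpen_ball (isOpen_Ioi (a := (0:ℝ)))
    convert this using 1
    ext x; simp [hU]
  have hKU : K ⊆ U := by
    intro x hx
    have h2 : M / 2 ≤ v x := hx.2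
    refine ⟨?_, by linarith⟩
    by_contra h
    linarith [hout x h]
  obtain ⟨d1, hd1, hd1s⟩ := hKc.exists_cthickening_subset_open hUo hKU
  have hcm : ContinuousAt v xm := hc.continuousAt (mem_nhds_iff.2 ⟨ball 0 1, ball_subset_closedBall, isOpen_ball, by simpa using hxm1⟩)
  obtain ⟨d2, hd2, hd2s⟩ := Metric.continuousAt_iff.1 hcm (M/4) (by linarith)
  set d := min (d1/2) (min d2 (1/2)) with hd
  have hdp : 0 < d := by positivity
  have hdd1 : d ≤ d1/2 := min_le_left _ _
  have hdd2 : d ≤ d2 := (min_le_right _ _).trans (min_le_left _ _)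
  have hdd3 : d ≤ 1/2 := (min_le_right _ _).trans (min_le_right _ _)
  let b : ContDiffBump (0 : EN N) := ⟨d/2, d, by linarith, by linarith⟩
  set ρ := b.normed volume with hρ
  have hρc : ContDiff ℝ (⊤ : ℕ∞) ρ := b.contDiff_normed
  have hρs : HasCompactSupport ρ := b.hasCompactSupport_normed
  have hρ0 : ∀ x, 0 ≤ ρ x := b.nonneg_normed
  have hρ1 : ∫ x, ρ x = 1 := b.integral_normed
  have hρd : ∀ x, d ≤ ‖x‖ → ρ x = 0 := by
    intro x hx
    have : x ∉ Function.support ρ := by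
      rw [hρ, b.support_normed_eq]; simpa [b] using hx
    simpa using this
  have hmc := moll_cont hv hρc.continuous hρs
  set K1 := cthickening d K with hK1
  have hK1U : K1 ⊆ U := (cthickening_mono (by linarith) K).trans hd1s
  have hK1c : IsCompact K1 := hKc.cthickening
  have hxmK : xm ∈ K := ⟨hxm, by show M/2 ≤ v xm; linarith⟩
  have hxmK1 : xm ∈ K1 := self_subset_cthickening K hxmK
  obtain ⟨xs, hxs, hxsm⟩ := hK1c.exists_isMaxOn ⟨xm, hxmK1⟩ hmc.continuousOn
  have hb1 : 3 * M / 4 ≤ moll v ρ xm := by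
    apply le_moll hv hρc.continuous hρs hρ0 hρ1 hρd
    intro y hy
    have := hd2s (x := y) (by rw [dist_eq_norm]; linarith)
    rw [Real.dist_eq, abs_lt] at this
    linarith [this.1]
  have hb2 : moll v ρ xm ≤ moll v ρ xs := hxsm hxmK1
  have hmax : ∀ x, moll v ρ x ≤ moll v ρ xs := by
    intro x
    by_cases hx : x ∈ K1
    · exact hxsm hx
    · have : moll v ρ x ≤ M / 2 := by
        apply moll_le hv hρc.continuous hρs hρ0 hρ1 hρd
        intro y hy
        by_contra hy2
        push Not at hy2
        apply hx
        apply mem_cthickening_of_dist_le x y d K _ (by rw [dist_comm, dist_eq_norm]; exact hy.le)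
        refine ⟨?_, hy2.le⟩
        by_contra h3
        have : ¬ ‖y‖ < 1 := by
          intro h4
          exact h3 (by simpa using h4.le)
        linarith [hout y this]
      linarith
  have hsm : ContDiff ℝ (⊤ : ℕ∞) (fun z => ρ (z - xs)) := hρc.comp (contDiff_id.sub contDiff_const)
  have hsc : HasCompactSupport (fun z => ρ (z - xs)) := hρs.comp_homeomorph (Homeomorph.subRight xs)
  have hst : tsupport (fun z => ρ (z - xs)) ⊆ U := by
    have h1 : tsupport (fun z => ρ (z - xs)) ⊆ closedBall xs d := by
      apply closure_minimal _ isClosed_closedBall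
      intro z hz
      rw [mem_closedBall, dist_eq_norm]
      by_contra h
      exact hz (hρd _ (not_le.1 h).le)
    refine h1.trans ?_
    intro y hy
    apply hd1s
    have h2 : y ∈ cthickening d (cthickening d K) := mem_cthickening_of_dist_le y xs d _ hxs hy
    exact cthickening_mono (by linarith) K (cthickening_cthickening_subset hdp.le hdp.le K h2)
  obtain ⟨C, R, hTF⟩ := exists_TF hsm hsc
  have h1 := hsub _ hsm hsc hst (fun x => hρ0 _)
  have h2 := moll_max hN hα0 hα2 hv hTF hmax (by linarith) (by
    intro k hk
    apply moll_le hv hρc.continuous hρs hρ0 hρ1 hρd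
    intro y hy
    apply hout
    have h3 := (hK1U hxs).1
    have : ‖k‖ ≤ ‖xs‖ + ‖y‖ + ‖y - (xs - k)‖ := by
      calc ‖k‖ = ‖xs - y + (y - (xs - k))‖ := by congr 1; abel
        _ ≤ ‖xs - y‖ + ‖y - (xs - k)‖ := norm_add_le _ _
        _ ≤ _ := by linarith [norm_sub_le xs y]
    intro h4
    linarith)
  linarith



section AbstractSolve
variable {K : Type*} [TopologicalSpace K] [CompactSpace K]

lemma abs_compare {G : C(K, ℝ) →L[ℝ] C(K, ℝ)} {κ : ℝ} (hκ : ∀ q, ‖G q‖ ≤ κ * ‖q‖)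
    (hmp : ∀ q : C(K, ℝ), (∀ x, 0 < G q x → q x ≤ 0) → ∀ x, G q x ≤ 0)
    {F : C(ℝ, ℝ)} (hF : Monotone F) {h u₁ u₂ g₁ g₂ : C(K, ℝ)}
    (h1 : u₁ + G (F.comp u₁) = h + G g₁) (h2 : u₂ + G (F.comp u₂) = h + G g₂) (x : K) :
    u₁ x - u₂ x ≤ κ * ‖g₁ - g₂‖ := by
  set c : C(K, ℝ) := ContinuousMap.const K ‖g₁ - g₂‖ with hc
  have hcn : ‖c‖ ≤ ‖g₁ - g₂‖ := by
    rw [ContinuousMap.norm_le _ (norm_nonneg _)]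
    intro y
    simp [hc]
  have hpos : ∀ y, 0 ≤ G c y := by
    intro y
    have := hmp (-c) (fun z _ => by simp [hc]) y
    rw [map_neg] at this
    simpa using this
  have e : u₁ - u₂ - G c = G (g₁ - g₂ - c - (F.comp u₁ - F.comp u₂)) := by
    simp only [map_sub]
    have e1 : u₁ = h + G g₁ - G (F.comp u₁) := by rw [← h1]; abel
    have e2 : u₂ = h + G g₂ - G (F.comp u₂) := by rw [← h2]; abel
    calc u₁ - u₂ - G c = (h + G g₁ - G (F.comp u₁)) - (h + G g₂ - G (F.comp u₂)) - G c := by rw [← e1, ← e2]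
      _ = _ := by abel
  have h3 := hmp (g₁ - g₂ - c - (F.comp u₁ - F.comp u₂)) (by
    intro y hy
    rw [← e] at hy
    simp only [ContinuousMap.sub_apply] at hy
    have hu : u₂ y ≤ u₁ y := by linarith [hpos y]
    have hFy := hF hu
    have hg : g₁ y - g₂ y ≤ ‖g₁ - g₂‖ := (le_abs_self _).trans (by simpa using (g₁ - g₂).norm_coe_le_norm y)
    simp only [ContinuousMap.sub_apply, ContinuousMap.comp_apply, hc, ContinuousMap.const_apply]
    linarith) x
  rw [← e] at h3
  simp only [ContinuousMap.sub_apply] at h3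
  have h4 : G c x ≤ ‖G c‖ := (le_abs_self _).trans ((G c).norm_coe_le_norm x)
  have h5 : ‖G c‖ ≤ κ * ‖g₁ - g₂‖ := by
    refine (hκ c).trans ?_
    rcases le_or_gt 0 κ with h0 | h0
    · exact mul_le_mul_of_nonneg_left hcn h0
    · have : ‖c‖ = ‖g₁ - g₂‖ := by
        apply le_antisymm hcn
        calc ‖g₁ - g₂‖ = ‖c x‖ := by simp [hc]
          _ ≤ _ := c.norm_coe_le_norm x
      rw [this]
  linarith

lemma abs_compare_norm {G : C(K, ℝ) →L[ℝ] C(K, ℝ)} {κ : ℝ} (hκ0 : 0 < κ) (hκ : ∀ q, ‖G q‖ ≤ κ * ‖q‖)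
    (hmp : ∀ q : C(K, ℝ), (∀ x, 0 < G q x → q x ≤ 0) → ∀ x, G q x ≤ 0)
    {F : C(ℝ, ℝ)} (hF : Monotone F) {h u₁ u₂ g₁ g₂ : C(K, ℝ)}
    (h1 : u₁ + G (F.comp u₁) = h + G g₁) (h2 : u₂ + G (F.comp u₂) = h + G g₂) :
    ‖u₁ - u₂‖ ≤ κ * ‖g₁ - g₂‖ := by
  rw [ContinuousMap.norm_le _ (by positivity)]
  intro x
  rw [ContinuousMap.sub_apply, Real.norm_eq_abs, abs_le]
  have a := abs_compare hκ hmp hF h1 h2 x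
  have b := abs_compare hκ hmp hF h2 h1 x
  rw [norm_sub_rev] at b
  constructor <;> linarith

lemma abs_comp_lip {F : C(ℝ, ℝ)} {L : NNReal} (hL : LipschitzWith L F) (u₁ u₂ : C(K, ℝ)) :
    ‖F.comp u₁ - F.comp u₂‖ ≤ L * ‖u₁ - u₂‖ := by
  rw [ContinuousMap.norm_le _ (by positivity)]
  intro x
  have h1 := hL.dist_le_mul (u₁ x) (u₂ x)
  have h2 := (u₁ - u₂).norm_coe_le_norm x
  rw [Real.dist_eq, Real.dist_eq] at h1
  simp only [ContinuousMap.sub_apply, ContinuousMap.comp_apply, Real.norm_eq_abs] at h2 ⊢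
  exact h1.trans (mul_le_mul_of_nonneg_left h2 L.2)

lemma abs_solve_step {G : C(K, ℝ) →L[ℝ] C(K, ℝ)} {κ : ℝ} (hκ0 : 0 < κ) (hκ : ∀ q, ‖G q‖ ≤ κ * ‖q‖)
    (hmp : ∀ q : C(K, ℝ), (∀ x, 0 < G q x → q x ≤ 0) → ∀ x, G q x ≤ 0)
    {F : C(ℝ, ℝ)} (hF : Monotone F) {L : NNReal} (hL : LipschitzWith L F) (hLκ : κ * L ≤ 1/2) (h : C(K, ℝ)) (k : ℕ) :
    ∀ g : C(K, ℝ), ∃ u : C(K, ℝ), u + G (((k:ℝ) • F).comp u) = h + G g := by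
  induction k with
  | zero =>
    intro g
    refine ⟨h + G g, ?_⟩
    have : ((((0:ℕ):ℝ) • F).comp (h + G g)) = 0 := by ext x; simp
    rw [this]; simp
  | succ k ih =>
    intro g
    choose S hS using ih
    have hmon : Monotone ((k:ℝ) • F) := by
      intro a b hab
      simp only [ContinuousMap.smul_apply, smul_eq_mul]
      exact mul_le_mul_of_nonneg_left (hF hab) (by positivity)
    have hc : ContractingWith (1/2 : NNReal) (fun u => S (g - F.comp u)) := by
      refine ⟨by rw [← NNReal.coe_lt_coe]; norm_num, LipschitzWith.of_dist_le_mul ?_⟩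
      intro u1 u2
      rw [dist_eq_norm, dist_eq_norm]
      have h1 := abs_compare_norm hκ0 hκ hmp hmon (hS (g - F.comp u1)) (hS (g - F.comp u2))
      have h2 : ‖g - F.comp u1 - (g - F.comp u2)‖ ≤ L * ‖u1 - u2‖ := by
        rw [sub_sub_sub_cancel_left, norm_sub_rev]
        exact abs_comp_lip hL u1 u2
      calc _ ≤ κ * (L * ‖u1 - u2‖) := h1.trans (mul_le_mul_of_nonneg_left h2 hκ0.le)
        _ = (κ * L) * ‖u1 - u2‖ := by ring
        _ ≤ 1/2 * ‖u1 - u2‖ := mul_le_mul_of_nonneg_right hLκ (norm_nonneg _)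
        _ = _ := by simp
    have hfix := hc.fixedPoint_isFixedPt
    set u := hc.fixedPoint with hu
    have e := hS (g - F.comp u)
    have e2 : S (g - F.comp u) = u := hfix
    rw [e2] at e
    refine ⟨u, ?_⟩
    have e3 : (((k+1:ℕ):ℝ) • F).comp u = ((k:ℝ) • F).comp u + F.comp u := by
      ext x
      simp; ring
    rw [e3, map_add, ← add_assoc, e, map_sub]
    abel

lemma abs_solve_lip {G : C(K, ℝ) →L[ℝ] C(K, ℝ)} {κ : ℝ} (hκ0 : 0 < κ) (hκ : ∀ q, ‖G q‖ ≤ κ * ‖q‖)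
    (hmp : ∀ q : C(K, ℝ), (∀ x, 0 < G q x → q x ≤ 0) → ∀ x, G q x ≤ 0)
    {F : C(ℝ, ℝ)} (hF : Monotone F) {L : NNReal} (hL : LipschitzWith L F) (h : C(K, ℝ)) :
    ∃ u : C(K, ℝ), u + G (F.comp u) = h := by
  obtain ⟨n, hn⟩ := exists_nat_ge (2 * κ * L)
  have hn0 : (0:ℝ) < (n:ℝ) + 1 := by positivity
  set c : NNReal := ((n:NNReal) + 1)⁻¹ with hc
  have hcc : (c : ℝ) = ((n:ℝ) + 1)⁻¹ := by simp [hc]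
  have hl2 : LipschitzWith (c * L) ((c:ℝ) • F) := by
    apply LipschitzWith.of_dist_le_mul
    intro a b
    have := hL.dist_le_mul a b
    rw [Real.dist_eq] at this ⊢
    simp only [ContinuousMap.smul_apply, smul_eq_mul, ← mul_sub, abs_mul, NNReal.coe_mul, abs_of_nonneg c.2]
    rw [mul_assoc, abs_of_nonneg (show (0:ℝ) ≤ c from c.2)]
    exact mul_le_mul_of_nonneg_left this c.2
  have hm2 : Monotone ((c:ℝ) • F) := by
    intro a b hab
    simp only [ContinuousMap.smul_apply, smul_eq_mul]
    exact mul_le_mul_of_nonneg_left (hF hab) c.2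
  obtain ⟨u, hu⟩ := abs_solve_step hκ0 hκ hmp hm2 hl2 (by
    rw [NNReal.coe_mul, hcc]
    have : κ * ((((n:ℝ) + 1)⁻¹) * L) = (κ * L) / ((n:ℝ) + 1) := by field_simp
    rw [this, div_le_iff₀ hn0]
    linarith) h (n+1) 0
  refine ⟨u, ?_⟩
  have e : (((n+1:ℕ):ℝ) • ((c:ℝ) • F)) = F := by
    ext t
    simp only [ContinuousMap.smul_apply, smul_eq_mul, hcc]
    push_cast
    field_simp
  rw [e] at hu
  simpa using hu

lemma abs_solve {G : C(K, ℝ) →L[ℝ] C(K, ℝ)} {κ : ℝ} (hκ0 : 0 < κ) (hκ : ∀ q, ‖G q‖ ≤ κ * ‖q‖)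
    (hmp : ∀ q : C(K, ℝ), (∀ x, 0 < G q x → q x ≤ 0) → ∀ x, G q x ≤ 0)
    {F : C(ℝ, ℝ)} (happ : ∀ ε : ℝ, 0 < ε → ∃ (F' : C(ℝ, ℝ)) (L : NNReal), Monotone F' ∧ LipschitzWith L F' ∧ ∀ t, |F' t - F t| ≤ ε)
    (h : C(K, ℝ)) :
    ∃ u : C(K, ℝ), u + G (F.comp u) = h := by
  have hn : ∀ n : ℕ, ∃ (F' : C(ℝ, ℝ)) (L : NNReal), Monotone F' ∧ LipschitzWith L F' ∧ ∀ t, |F' t - F t| ≤ 1 / ((n:ℝ) + 1) :=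
    fun n => happ _ (by positivity)
  choose F' L hm hl hb using hn
  have hs := fun n => abs_solve_lip hκ0 hκ hmp (hm n) (hl n) h
  choose u hu using hs
  have hd : ∀ n m k : ℕ, k ≤ n → k ≤ m → dist (u n) (u m) ≤ κ * (2 * (1 / ((k:ℝ) + 1))) := by
    intro n m k hkn hkm
    rw [dist_eq_norm]
    have h1 : u n + G ((F' n).comp (u n)) = h + G 0 := by simpa using hu n
    have h2 : u m + G ((F' n).comp (u m)) = h + G ((F' n).comp (u m) - (F' m).comp (u m)) := by
      rw [map_sub, ← hu m]; abel
    refine (abs_compare_norm hκ0 hκ hmp (hm n) h1 h2).trans (mul_le_mul_of_nonneg_left ?_ hκ0.le)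
    rw [ContinuousMap.norm_le _ (by positivity)]
    intro x
    simp only [ContinuousMap.sub_apply, ContinuousMap.comp_apply, ContinuousMap.zero_apply, ContinuousMap.neg_apply, Real.norm_eq_abs, zero_sub, abs_neg]
    have a := hb n (u m x)
    have b := hb m (u m x)
    have c1 : 1 / ((n:ℝ) + 1) ≤ 1 / ((k:ℝ) + 1) := by
      apply one_div_le_one_div_of_le (by positivity)
      have : (k:ℝ) ≤ n := by exact_mod_cast hkn
      linarith
    have c2 : 1 / ((m:ℝ) + 1) ≤ 1 / ((k:ℝ) + 1) := by
      apply one_div_le_one_div_of_le (by positivity)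
      have : (k:ℝ) ≤ m := by exact_mod_cast hkm
      linarith
    rw [abs_le] at a b ⊢
    constructor <;> linarith [a.1, a.2, b.1, b.2]
  have ht0 := tendsto_one_div_add_atTop_nhds_zero_nat (𝕜 := ℝ)
  have hcs : CauchySeq u := by
    apply cauchySeq_of_le_tendsto_0 (fun k : ℕ => κ * (2 * (1 / ((k:ℝ) + 1)))) hd
    simpa using (ht0.const_mul 2).const_mul κ
  obtain ⟨v, hv⟩ := cauchySeq_tendsto_of_complete hcs
  refine ⟨v, ?_⟩
  have ht : Tendsto (fun n => u n + G (F.comp (u n)) - h) atTop (𝓝 (v + G (F.comp v) - h)) := by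
    apply Tendsto.sub_const
    apply hv.add
    apply (G.continuous.tendsto _).comp
    exact ((ContinuousMap.continuous_postcomp F).tendsto v).comp hv
  have hz : Tendsto (fun n => u n + G (F.comp (u n)) - h) atTop (𝓝 0) := by
    apply squeeze_zero_norm (a := fun n : ℕ => κ * (1 / ((n:ℝ) + 1)))
    · intro n
      have : u n + G (F.comp (u n)) - h = G (F.comp (u n) - (F' n).comp (u n)) := by
        rw [map_sub, ← hu n]; abel
      rw [this]
      refine (hκ _).trans (mul_le_mul_of_nonneg_left ?_ hκ0.le)
      rw [ContinuousMap.norm_le _ (by positivity)]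
      intro x
      simp only [ContinuousMap.sub_apply, ContinuousMap.comp_apply, Real.norm_eq_abs]
      rw [abs_sub_comm]
      exact hb n _
    · simpa using ht0.const_mul κ
  have := tendsto_nhds_unique ht hz
  exact sub_eq_zero.1 this

end AbstractSolve

/-- the truncated power -/
def tpow (γ M : ℝ) (t : ℝ) : ℝ := (max 0 (min t M)) ^ γ

lemma tpow_cont {γ M : ℝ} (hγ : 0 < γ) : Continuous (tpow γ M) := by
  unfold tpow
  apply Continuous.rpow_const (by fun_prop)
  intro x; right; exact hγ.le

lemma tpow_app {γ M : ℝ} (hγ : 0 < γ) (hM : 0 < M) (ε : ℝ) (hε : 0 < ε) :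
    ∃ (F' : C(ℝ, ℝ)) (L : NNReal), Monotone F' ∧ LipschitzWith L F' ∧ ∀ t, |F' t - (⟨tpow γ M, tpow_cont hγ⟩ : C(ℝ, ℝ)) t| ≤ ε := by
  have hcl : ∀ t : ℝ, max 0 (min t M) ∈ Icc 0 M := fun t => ⟨le_max_left _ _, max_le hM.le (min_le_right _ _)⟩
  have hc0 : ContinuousOn (fun s : ℝ => s ^ γ) (Icc 0 (M+1)) := (continuous_id.rpow_const (fun _ => Or.inr hγ.le)).continuousOn
  have huc := isCompact_Icc.uniformContinuousOn_of_continuous hc0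
  rw [Metric.uniformContinuousOn_iff_le] at huc
  obtain ⟨d, hd, hdd⟩ := huc ε hε
  set δ := min d 1 with hδ
  have hδ0 : 0 < δ := by positivity
  have hδ1 : δ ≤ 1 := min_le_right _ _
  have hcd : ContDiffOn ℝ 1 (fun s : ℝ => s ^ γ) (Icc δ (M + δ)) := by
    intro s hs
    exact (contDiffAt_id.rpow_const_of_ne (by have := hs.1; simp only [id]; linarith)).contDiffWithinAt
  obtain ⟨L, hL⟩ := hcd.exists_lipschitzOnWith one_ne_zero (convex_Icc _ _) isCompact_Icc
  refine ⟨⟨fun t => (max 0 (min t M) + δ) ^ γ, ?_⟩, L, ?_, ?_, ?_⟩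
  · apply Continuous.rpow_const (by fun_prop)
    intro x; right; exact hγ.le
  · intro a b hab
    simp only [ContinuousMap.coe_mk]
    apply rpow_le_rpow (by have := (hcl a).1; linarith) _ hγ.le
    gcongr
  · apply LipschitzWith.of_dist_le_mul
    intro a b
    have h1 := hL.dist_le_mul (max 0 (min a M) + δ) ⟨by linarith [(hcl a).1], by linarith [(hcl a).2]⟩ (max 0 (min b M) + δ) ⟨by linarith [(hcl b).1], by linarith [(hcl b).2]⟩
    refine h1.trans (mul_le_mul_of_nonneg_left ?_ L.2)
    rw [dist_add_right, Real.dist_eq, Real.dist_eq]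
    refine (abs_max_sub_max_le_max _ _ _ _).trans ?_
    refine max_le (by simp) ?_
    refine (abs_min_sub_min_le_max _ _ _ _).trans ?_
    simp
  · intro t
    simp only [ContinuousMap.coe_mk, tpow]
    have := hdd (max 0 (min t M) + δ) ⟨by linarith [(hcl t).1], by linarith [(hcl t).2]⟩ (max 0 (min t M)) ⟨(hcl t).1, by linarith [(hcl t).2]⟩
      (by rw [Real.dist_eq]; rw [add_sub_cancel_left, abs_of_pos hδ0]; exact min_le_left _ _)
    rwa [Real.dist_eq] at this



lemma memL_glue {N : ℕ} {α : ℝ} {v f : EN N → ℝ} (hc : ContinuousOn v (closedBall 0 1)) (hf : memLalpha N α f)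
    (h : ∀ x, ¬ ‖x‖ < 1 → v x = f x) : memLalpha N α v := by
  have hw : Continuous (fun y : EN N => (1 + ‖y‖) ^ (-((N : ℝ) + α))) := by
    apply Continuous.rpow_const (by fun_prop)
    intro x; left; positivity
  have h1 : IntegrableOn (fun y : EN N => v y * (1 + ‖y‖) ^ (-((N : ℝ) + α))) (closedBall 0 1) :=
    (hc.mul hw.continuousOn).integrableOn_compact (isCompact_closedBall _ _)
  have h2 : IntegrableOn (fun y : EN N => v y * (1 + ‖y‖) ^ (-((N : ℝ) + α))) (closedBall 0 1)ᶜ := by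
    have h3 : IntegrableOn (fun y : EN N => f y * (1 + ‖y‖) ^ (-((N : ℝ) + α))) (closedBall 0 1)ᶜ := Integrable.integrableOn hf
    apply h3.congr_fun _ measurableSet_closedBall.compl
    intro y hy
    have : ¬ ‖y‖ < 1 := by
      intro h4; exact hy (by simpa using h4.le)
    simp only
    rw [h y this]
  have := h1.union h2
  rw [union_compl_self, integrableOn_univ] at this
  exact this

open Classical in
/-- extension by zero -/
def ext0 {N : ℕ} (q : C(closedBall (0 : EN N) 1, ℝ)) (x : EN N) : ℝ := if h : x ∈ closedBall (0 : EN N) 1 then q ⟨x, h⟩ else 0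

lemma ext0_in {N : ℕ} (q : C(closedBall (0 : EN N) 1, ℝ)) (x : closedBall (0 : EN N) 1) : ext0 q x = q x := by
  unfold ext0; rw [dif_pos x.2]

lemma ext0_out {N : ℕ} (q : C(closedBall (0 : EN N) 1, ℝ)) {x : EN N} (hx : x ∉ closedBall (0 : EN N) 1) : ext0 q x = 0 := by
  unfold ext0; rw [dif_neg hx]

lemma ext0_bd {N : ℕ} (q : C(closedBall (0 : EN N) 1, ℝ)) (x : EN N) : |ext0 q x| ≤ ‖q‖ := by
  by_cases h : x ∈ closedBall (0 : EN N) 1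
  · rw [ext0_in q ⟨x, h⟩]; exact q.norm_coe_le_norm _
  · rw [ext0_out q h]; simp

lemma ext0_contOn {N : ℕ} (q : C(closedBall (0 : EN N) 1, ℝ)) : ContinuousOn (ext0 q) (closedBall 0 1) := by
  rw [continuousOn_iff_continuous_restrict]
  have : (closedBall (0 : EN N) 1).domRestrict (ext0 q) = q := by
    ext x; exact ext0_in q x
  rw [this]; exact q.continuous

lemma ext0_int {N : ℕ} (q : C(closedBall (0 : EN N) 1, ℝ)) : Integrable (ext0 q) := by
  have h1 := (ext0_contOn q).integrableOn_compact (μ := volume) (isCompact_closedBall _ _)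
  rw [← integrable_indicator_iff measurableSet_closedBall] at h1
  apply h1.congr
  filter_upwards with x
  by_cases h : x ∈ closedBall (0 : EN N) 1
  · rw [indicator_of_mem h]
  · rw [indicator_of_notMem h, ext0_out q h]

lemma ext0_green_int {N : ℕ} (hN : 3 ≤ N) {α : ℝ} (hα0 : 0 < α) (hα2 : α < 2) (q : C(closedBall (0 : EN N) 1, ℝ)) (x : EN N) :
    Integrable (fun z => greenB N α x z * ext0 q z) := by
  obtain ⟨M, _, hM⟩ := pot_bound hN hα0 hα2 (ext0_int q) (ext0_bd q)
  exact integrable_green_mul hN hα0 hα2 (hM x).1 (ext0_int q).aestronglyMeasurable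

lemma exists_GC {N : ℕ} (hN : 3 ≤ N) {α : ℝ} (hα0 : 0 < α) (hα2 : α < 2) :
    ∃ (G : C(closedBall (0 : EN N) 1, ℝ) →L[ℝ] C(closedBall (0 : EN N) 1, ℝ)) (κ : ℝ), 0 < κ ∧
      (∀ q x, G q x = Gop α (ext0 q) (x : EN N)) ∧ (∀ q, ‖G q‖ ≤ κ * ‖q‖) := by
  obtain ⟨κ, hκ0, hκ⟩ := Gop_unit hN hα0 hα2
  let T : C(closedBall (0 : EN N) 1, ℝ) → C(closedBall (0 : EN N) 1, ℝ) := fun q =>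
    ⟨(closedBall (0 : EN N) 1).domRestrict (Gop α (ext0 q)), continuousOn_iff_continuous_restrict.1 (Gop_cont hN hα0 hα2 (ext0_int q) (ext0_bd q))⟩
  have hT : ∀ q x, T q x = Gop α (ext0 q) (x : EN N) := fun q x => rfl
  have hadd : ∀ p q, T (p + q) = T p + T q := by
    intro p q
    ext x
    rw [ContinuousMap.add_apply, hT, hT, hT]
    unfold Gop
    rw [← integral_add (ext0_green_int hN hα0 hα2 p x) (ext0_green_int hN hα0 hα2 q x)]
    congr 1
    ext z
    rw [← mul_add]
    congr 1
    unfold ext0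
    split_ifs <;> simp
  have hsmul : ∀ (c : ℝ) q, T (c • q) = c • T q := by
    intro c q
    ext x
    rw [ContinuousMap.smul_apply, hT, hT]
    unfold Gop
    rw [smul_eq_mul, ← integral_const_mul]
    congr 1
    ext z
    rw [mul_left_comm]
    congr 1
    unfold ext0
    split_ifs <;> simp
  have hbd : ∀ q, ‖T q‖ ≤ κ * ‖q‖ := by
    intro q
    rw [ContinuousMap.norm_le _ (by positivity)]
    intro x
    rw [hT]
    unfold Gop
    have h1 : ∫ z, ‖greenB N α (x : EN N) z * ext0 q z‖ ≤ ∫ z, greenB N α (x : EN N) z * ‖q‖ := by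
      apply integral_mono (ext0_green_int hN hα0 hα2 q x).norm ((hκ x).1.mul_const _)
      intro z
      simp only
      rw [norm_mul, Real.norm_of_nonneg (greenB_nonneg hN hα0 hα2 _ _)]
      exact mul_le_mul_of_nonneg_left (ext0_bd q z) (greenB_nonneg hN hα0 hα2 _ _)
    rw [integral_mul_const] at h1
    exact (norm_integral_le_integral_norm _).trans (h1.trans (mul_le_mul_of_nonneg_right (hκ x).2 (norm_nonneg _)))
  refine ⟨LinearMap.mkContinuous ⟨⟨T, hadd⟩, hsmul⟩ κ hbd, κ, hκ0, fun q x => rfl, fun q => hbd q⟩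

lemma GC_mp {N : ℕ} (hN : 3 ≤ N) {α : ℝ} (hα0 : 0 < α) (hα2 : α < 2) (q : C(closedBall (0 : EN N) 1, ℝ))
    (h : ∀ x : closedBall (0 : EN N) 1, 0 < Gop α (ext0 q) (x : EN N) → q x ≤ 0) : ∀ x, Gop α (ext0 q) x ≤ 0 := by
  have hc := Gop_cont hN hα0 hα2 (ext0_int q) (ext0_bd q)
  apply max_principle (by omega) hα0 hα2 _ hc
  · intro x hx; rw [Gop_out hx]
  · intro φ hφ hφc hφs hφ0
    obtain ⟨C, R, hTF⟩ := exists_TF hφ hφc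
    have hz : ∀ z, z ∉ {x | ‖x‖ < 1 ∧ 0 < Gop α (ext0 q) x} → φ z = 0 := fun z hz => by
      by_contra h1
      exact hz (hφs (subset_tsupport φ h1))
    rw [Gop_pair hN hα0 hα2 (ext0_int q) (ext0_bd q) hTF (fun z hz1 => hz z (fun h2 => by linarith [h2.1]))]
    rw [Left.nonneg_neg_iff]
    apply integral_nonpos
    intro z
    simp only [Pi.zero_apply]
    by_cases h1 : z ∈ {x | ‖x‖ < 1 ∧ 0 < Gop α (ext0 q) x}
    · have hz1 : z ∈ closedBall (0 : EN N) 1 := by simpa using h1.1.le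
      have := h ⟨z, hz1⟩ h1.2
      rw [ext0_in q ⟨z, hz1⟩]
      exact mul_nonpos_of_nonpos_of_nonneg this (hφ0 z)
    · rw [hz z h1, mul_zero]
  · apply memL_glue hc (f := fun _ => 0)
    · unfold memLalpha; simp
    · intro x hx; exact Gop_out hx

lemma Hext_pair {N : ℕ} (hN : 3 ≤ N) {α : ℝ} (hα0 : 0 < α) (hα2 : α < 2) {f : EN N → ℝ}
    (hfm : Measurable f) (hf0 : ∀ x, 0 ≤ f x) (hfL : memLalpha N α f)
    (hfc : ∀ z : EN N, ‖z‖ = 1 → ContinuousAt f z) {φ : EN N → ℝ} {C R : ℝ} (h : TF φ C R) (hs : ∀ z, 1 ≤ ‖z‖ → φ z = 0) :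
    ∫ x, Hext α f x * LapS N α φ x = 0 := by
  have hN0 : 0 < N := by omega
  have hi := integrable_PK0_mul hN hα0 hα2 hfm hfL hfc
  have hc := Hext_cont hN hα0 hα2 hfm hi hfc
  have hm : memLalpha N α (Hext α f) := memL_glue hc hfL (fun x hx => Hext_out hx)
  obtain ⟨D, hD0, hD⟩ := h.LapS_bound hN0 hα0 hα2
  have i0 := memL_mul hm h.measurable_LapS.aestronglyMeasurable hD
  obtain ⟨M, hM⟩ := (isCompact_closedBall (0 : EN N) 1).exists_bound_of_continuousOn hc
  have h1 := h.Hf_pair hN hα0 hα2 hs hfm hf0 (fun x hx => integrable_PK_mul hN hα0 hα2 hfm hi hx) (M := M) (by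
    intro x hx
    rw [← Hext_in hx]
    exact (le_abs_self _).trans (hM x (by simpa using hx.le)))
  rw [← integral_add_compl (measurableSet_ball (x := (0 : EN N)) (ε := 1)) i0]
  have e1 : ∫ x in ball (0 : EN N) 1, Hext α f x * LapS N α φ x = ∫ x, LB N α φ x * ∫ y, PK α x y * f y := by
    rw [← integral_indicator measurableSet_ball]
    congr 1
    ext x
    by_cases hx : ‖x‖ < 1
    · rw [indicator_of_mem (by simpa using hx), Hext_in hx, LB_in hx, mul_comm]
    · rw [indicator_of_notMem (by simpa using hx), LB_out hx, zero_mul]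
  have hms : MeasurableSet {y : EN N | 1 < ‖y‖} := measurableSet_lt measurable_const measurable_norm
  have e2 : ∫ x in (ball (0 : EN N) 1)ᶜ, Hext α f x * LapS N α φ x = ∫ y in {y : EN N | 1 < ‖y‖}, f y * LapS N α φ y := by
    rw [← integral_indicator measurableSet_ball.compl, ← integral_indicator hms]
    apply integral_congr_ae
    filter_upwards [norm_one_ae N hN0] with x hx
    by_cases hx1 : ‖x‖ < 1
    · rw [indicator_of_notMem (by simpa using hx1), indicator_of_notMem]
      simp only [mem_ofPred_eq]; linarith
    · rw [indicator_of_mem (by simpa using hx1), indicator_of_mem, Hext_out hx1]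
      exact lt_of_le_of_ne (not_lt.1 hx1) (Ne.symm hx)
  rw [e1, e2, h1]
  ring

lemma int_pow_phi {N : ℕ} {γ : ℝ} (hγ : 0 < γ) {w φ : EN N → ℝ} (hw : ContinuousOn w (closedBall 0 1)) (hφ : Continuous φ)
    (hs : ∀ z, 1 ≤ ‖z‖ → φ z = 0) : Integrable (fun x => w x ^ γ * φ x) := by
  have h1 : IntegrableOn (fun x => w x ^ γ * φ x) (closedBall 0 1) :=
    ((hw.rpow_const (fun x _ => Or.inr hγ.le)).mul hφ.continuousOn).integrableOn_compact (isCompact_closedBall _ _)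
  rw [← integrable_indicator_iff measurableSet_closedBall] at h1
  apply h1.congr
  filter_upwards with x
  by_cases h : x ∈ closedBall (0 : EN N) 1
  · rw [indicator_of_mem h]
  · rw [indicator_of_notMem h, hs x (by simp at h; exact h.le), mul_zero]

lemma sol_le {N : ℕ} (hN : 3 ≤ N) {α : ℝ} (hα0 : 0 < α) (hα2 : α < 2) {γ : ℝ} (hγ : 0 < γ) {f u w : EN N → ℝ}
    (hu0 : ∀ x, 0 ≤ u x) (huL : memLalpha N α u) (huf : ∀ x : EN N, ¬ ‖x‖ < 1 → u x = f x)
    (huc : ContinuousOn u (closedBall (0 : EN N) 1)) (hus : IsSolution N α γ (ball (0 : EN N) 1) u)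
    (hwL : memLalpha N α w) (hwf : ∀ x : EN N, ¬ ‖x‖ < 1 → w x = f x)
    (hwc : ContinuousOn w (closedBall (0 : EN N) 1)) (hws : IsSolution N α γ (ball (0 : EN N) 1) w) :
    ∀ x, w x ≤ u x := by
  have hN0 : 0 < N := by omega
  have hvL : memLalpha N α (fun x => w x - u x) := by
    unfold memLalpha at *
    have := hwL.sub huL
    apply this.congr
    filter_upwards with x
    simp only [Pi.sub_apply]; ring
  have := max_principle hN0 hα0 hα2 hvL (hwc.sub huc) (fun x hx => by rw [hwf x hx, huf x hx, sub_self]) (by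
    intro φ hφ hφc hφs hφ0
    obtain ⟨C, R, hTF⟩ := exists_TF hφ hφc
    have hz : ∀ z, z ∉ {x | ‖x‖ < 1 ∧ 0 < w x - u x} → φ z = 0 := fun z hz => by
      by_contra h1
      exact hz (hφs (subset_tsupport φ h1))
    have hz1 : ∀ z, 1 ≤ ‖z‖ → φ z = 0 := fun z hz1 => hz z (fun h2 => by linarith [h2.1])
    obtain ⟨D, hD0, hD⟩ := hTF.LapS_bound hN0 hα0 hα2
    have i1 := memL_mul hwL hTF.measurable_LapS.aestronglyMeasurable hD
    have i2 := memL_mul huL hTF.measurable_LapS.aestronglyMeasurable hD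
    have hφs2 : tsupport φ ⊆ ball (0 : EN N) 1 := fun x hx => by simpa using (hφs hx).1
    have e1 := hws.2.2.2 φ hφ hφc hφs2 hφ0
    have e2 := hus.2.2.2 φ hφ hφc hφs2 hφ0
    rw [hTF.fracLap_eq hN0 hα0 hα2] at e1 e2
    have e3 : ∫ z, (w z - u z) * LapS N α φ z = (∫ z, w z * LapS N α φ z) - ∫ z, u z * LapS N α φ z := by
      rw [← integral_sub i1 i2]
      congr 1; ext z; ring
    rw [e3, e1, e2, sub_nonneg]
    apply integral_mono (int_pow_phi hγ huc hφ.continuous hz1) (int_pow_phi hγ hwc hφ.continuous hz1)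
    intro z
    simp only
    by_cases h1 : z ∈ {x | ‖x‖ < 1 ∧ 0 < w x - u x}
    · apply mul_le_mul_of_nonneg_right _ (hφ0 z)
      exact rpow_le_rpow (hu0 z) (by linarith [h1.2]) hγ.le
    · rw [hz z h1, mul_zero, mul_zero])
  intro x
  linarith [this x]

lemma Hball_eq {N : ℕ} (hN : 3 ≤ N) {α : ℝ} (hα0 : 0 < α) (hα2 : α < 2) (f : EN N → ℝ) {x : EN N} (hx : ‖x‖ < 1) :
    Hball N α 0 1 f x = Hext α f x := by
  have hms : MeasurableSet {y : EN N | 1 < ‖y - 0‖} := measurableSet_lt measurable_const (by fun_prop)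
  rw [Hext_in hx]
  unfold Hball
  rw [← integral_indicator hms]
  congr 1
  ext y
  by_cases hy : 1 < ‖y‖
  · rw [indicator_of_mem (by simpa using hy), PK_eq_poisson (by omega) hα0 hα2 hx hy]
  · rw [indicator_of_notMem (by simpa using hy), PK_zero (not_lt.1 hy), zero_mul]

theorem exists_sol {N : ℕ} (hN : 3 ≤ N) {α : ℝ} (hα0 : 0 < α) (hα2 : α < 2)
    {γ : ℝ} (hγ : 0 < γ) {f : EN N → ℝ}
    (hfm : Measurable f) (hf0 : ∀ x, 0 ≤ f x) (hfL : memLalpha N α f)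
    (hfc : ∀ z : EN N, ‖z‖ = 1 → ContinuousAt f z) :
    ∃ u : EN N → ℝ,
      ((∀ x, 0 ≤ u x) ∧ memLalpha N α u ∧ (∀ x : EN N, ¬ ‖x‖ < 1 → u x = f x) ∧
        ContinuousOn u (Metric.closedBall (0 : EN N) 1) ∧
        IsSolution N α γ (Metric.ball (0 : EN N) 1) u) ∧
      (∀ x ∈ Metric.ball (0 : EN N) 1,
        u x + (∫ y in Metric.ball (0 : EN N) 1, greenB N α x y * u y ^ γ) =
          Hball N α 0 1 f x) := by
  have hN0 : 0 < N := by omega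
  have hi := integrable_PK0_mul hN hα0 hα2 hfm hfL hfc
  have hHc := Hext_cont hN hα0 hα2 hfm hi hfc
  have hHL : memLalpha N α (Hext α f) := memL_glue hHc hfL (fun x hx => Hext_out hx)
  obtain ⟨M0, hM0⟩ := (isCompact_closedBall (0 : EN N) 1).exists_bound_of_continuousOn hHc
  set M := max M0 1 with hM
  have hMp : 0 < M := lt_of_lt_of_le one_pos (le_max_right _ _)
  have hHM : ∀ x ∈ closedBall (0 : EN N) 1, Hext α f x ≤ M := fun x hx =>
    (le_abs_self _).trans ((hM0 x hx).trans (le_max_left _ _))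
  obtain ⟨G, κ, hκ0, hG, hκ⟩ := exists_GC hN hα0 hα2
  have hmp : ∀ q : C(closedBall (0 : EN N) 1, ℝ), (∀ x, 0 < G q x → q x ≤ 0) → ∀ x, G q x ≤ 0 := by
    intro q hq x
    rw [hG]
    apply GC_mp hN hα0 hα2 q
    intro y hy
    exact hq y (by rw [hG]; exact hy)
  have : CompactSpace (closedBall (0 : EN N) 1) := isCompact_iff_compactSpace.1 (isCompact_closedBall _ _)
  obtain ⟨q, hq⟩ := abs_solve hκ0 hκ hmp (F := ⟨tpow γ M, tpow_cont hγ⟩) (tpow_app hγ hMp)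
    (⟨(closedBall (0 : EN N) 1).domRestrict (Hext α f), continuousOn_iff_continuous_restrict.1 hHc⟩)
  set p := (⟨tpow γ M, tpow_cont hγ⟩ : C(ℝ, ℝ)).comp q with hp
  set g := ext0 p with hg
  have hgc := Gop_cont hN hα0 hα2 (ext0_int p) (ext0_bd p)
  have hgL : memLalpha N α (Gop α g) := by
    apply memL_glue hgc (f := fun _ => 0)
    · unfold memLalpha; simp
    · intro x hx; exact Gop_out hx
  set u : EN N → ℝ := fun x => Hext α f x - Gop α g x with hu
  have huc : ContinuousOn u (closedBall 0 1) := hHc.sub hgc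
  have huf : ∀ x : EN N, ¬ ‖x‖ < 1 → u x = f x := by
    intro x hx
    simp only [hu]
    rw [Hext_out hx, Gop_out hx, sub_zero]
  have huL : memLalpha N α u := memL_glue huc hfL huf
  have huq : ∀ x : closedBall (0 : EN N) 1, u x = q x := by
    intro x
    have h1 := DFunLike.congr_fun hq x
    rw [ContinuousMap.add_apply, hG] at h1
    simp only [ContinuousMap.coe_mk, domRestrict_apply] at h1
    simp only [hu]
    rw [← h1, add_sub_cancel_right]
  have hgu : ∀ x ∈ closedBall (0 : EN N) 1, g x = tpow γ M (u x) := by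
    intro x hx
    rw [hg, ext0_in p ⟨x, hx⟩, huq ⟨x, hx⟩]
    rfl
  have hg0 : ∀ x, 0 ≤ g x := by
    intro x
    by_cases hx : x ∈ closedBall (0 : EN N) 1
    · rw [hgu x hx]; unfold tpow; apply rpow_nonneg; exact le_max_left _ _
    · rw [hg, ext0_out p hx]
  have hpair : ∀ (φ : EN N → ℝ) (C R : ℝ), TF φ C R → (∀ z, 1 ≤ ‖z‖ → φ z = 0) →
      ∫ z, u z * LapS N α φ z = ∫ z, g z * φ z := by
    intro φ C R hTF hs
    obtain ⟨D, hD0, hD⟩ := hTF.LapS_bound hN0 hα0 hα2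
    have i1 := memL_mul hHL hTF.measurable_LapS.aestronglyMeasurable hD
    have i2 := memL_mul hgL hTF.measurable_LapS.aestronglyMeasurable hD
    have e3 : ∫ z, u z * LapS N α φ z = (∫ z, Hext α f z * LapS N α φ z) - ∫ z, Gop α g z * LapS N α φ z := by
      rw [← integral_sub i1 i2]
      congr 1; ext z; simp only [hu]; ring
    rw [e3, Hext_pair hN hα0 hα2 hfm hf0 hfL hfc hTF hs, Gop_pair hN hα0 hα2 (ext0_int p) (ext0_bd p) hTF hs]
    ring
  have hu0 : ∀ x, 0 ≤ u x := by
    have hnL : memLalpha N α (fun x => - u x) := by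
      unfold memLalpha at *
      apply huL.neg.congr
      filter_upwards with x
      simp
    have := max_principle hN0 hα0 hα2 hnL huc.neg (fun x hx => by rw [huf x hx]; linarith [hf0 x]) (by
      intro φ hφ hφc hφs hφ0
      obtain ⟨C, R, hTF⟩ := exists_TF hφ hφc
      have hz : ∀ z, z ∉ {x | ‖x‖ < 1 ∧ 0 < - u x} → φ z = 0 := fun z hz => by
        by_contra h1
        exact hz (hφs (subset_tsupport φ h1))
      have hz1 : ∀ z, 1 ≤ ‖z‖ → φ z = 0 := fun z hz1 => hz z (fun h2 => by linarith [h2.1])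
      have e := hpair φ C R hTF hz1
      have e0 : ∫ z, g z * φ z = 0 := by
        apply integral_eq_zero_of_ae
        filter_upwards with z
        simp only [Pi.zero_apply]
        by_cases h1 : z ∈ {x | ‖x‖ < 1 ∧ 0 < - u x}
        · rw [hgu z (by simpa using h1.1.le)]
          unfold tpow
          rw [max_eq_left ((min_le_left _ _).trans (by linarith [h1.2])), zero_rpow hγ.ne', zero_mul]
        · rw [hz z h1, mul_zero]
      simp only [neg_mul]
      rw [integral_neg, e, e0, neg_zero])
    intro x
    linarith [this x]
  have hGp : ∀ x, 0 ≤ Gop α g x := fun x => integral_nonneg (fun z => mul_nonneg (greenB_nonneg hN hα0 hα2 _ _) (hg0 z))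
  have hgu2 : ∀ x ∈ closedBall (0 : EN N) 1, g x = u x ^ γ := by
    intro x hx
    rw [hgu x hx]
    unfold tpow
    have : u x ≤ M := by
      have h1 := hHM x hx
      have h2 := hGp x
      simp only [hu]; linarith
    rw [min_eq_left this, max_eq_right (hu0 x)]
  refine ⟨u, ⟨hu0, huL, huf, huc, hu0, huc.mono ball_subset_closedBall, huL, ?_⟩, ?_⟩
  · intro φ hφ hφc hφs hφ0
    obtain ⟨C, R, hTF⟩ := exists_TF hφ hφc
    have hz1 : ∀ z, 1 ≤ ‖z‖ → φ z = 0 := fun z hz1 => by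
      by_contra h1
      have := hφs (subset_tsupport φ h1)
      simp at this
      linarith
    rw [hTF.fracLap_eq hN0 hα0 hα2, hpair φ C R hTF hz1]
    congr 1
    ext z
    by_cases hz : z ∈ closedBall (0 : EN N) 1
    · rw [hgu2 z hz]
    · rw [hz1 z (by simp at hz; exact hz.le), mul_zero, mul_zero]
  · intro x hx
    have hx1 : ‖x‖ < 1 := by simpa using hx
    rw [Hball_eq hN hα0 hα2 f hx1]
    have e : ∫ y in ball (0 : EN N) 1, greenB N α x y * u y ^ γ = Gop α g x := by
      rw [← integral_indicator measurableSet_ball]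
      unfold Gop
      congr 1
      ext y
      by_cases hy : ‖y‖ < 1
      · rw [indicator_of_mem (by simpa using hy), hgu2 y (by simpa using hy.le)]
      · rw [indicator_of_notMem (by simpa using hy), greenB_out hy, zero_mul]
    rw [e]
    simp only [hu]
    ring


/-- existence and uniqueness for the Dirichlet problem with unbounded boundary
datum `f`, together with the integral identity. -/
theorem statement_7 (N : ℕ) (hN : 3 ≤ N) (α : ℝ) (hα0 : 0 < α) (hα2 : α < 2)
    (γ : ℝ) (hγ : 0 < γ) (f : EN N → ℝ)
    (hfm : Measurable f) (hf0 : ∀ x, 0 ≤ f x) (hfL : memLalpha N α f)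
    (hfc : ∀ z : EN N, ‖z‖ = 1 → ContinuousAt f z) :
    ∃ u : EN N → ℝ,
      ((∀ x, 0 ≤ u x) ∧ memLalpha N α u ∧ (∀ x : EN N, ¬ ‖x‖ < 1 → u x = f x) ∧
        ContinuousOn u (Metric.closedBall (0 : EN N) 1) ∧
        IsSolution N α γ (Metric.ball (0 : EN N) 1) u) ∧
      (∀ x ∈ Metric.ball (0 : EN N) 1,
        u x + (∫ y in Metric.ball (0 : EN N) 1, greenB N α x y * u y ^ γ) =
          Hball N α 0 1 f x) ∧
      (∀ w : EN N → ℝ,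
        ((∀ x, 0 ≤ w x) ∧ memLalpha N α w ∧ (∀ x : EN N, ¬ ‖x‖ < 1 → w x = f x) ∧
          ContinuousOn w (Metric.closedBall (0 : EN N) 1) ∧
          IsSolution N α γ (Metric.ball (0 : EN N) 1) w) → w = u) := by
  obtain ⟨u, ⟨hu0, huL, huf, huc, hus⟩, hid⟩ := exists_sol hN hα0 hα2 hγ hfm hf0 hfL hfc
  refine ⟨u, ⟨hu0, huL, huf, huc, hus⟩, hid, ?_⟩
  rintro w ⟨hw0, hwL, hwf, hwc, hws⟩
  ext x
  exact le_antisymm (sol_le hN hα0 hα2 hγ hu0 huL huf huc hus hwL hwf hwc hws x)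
    (sol_le hN hα0 hα2 hγ hw0 hwL hwf hwc hws huL huf huc hus x)

end
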